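/- For every natural number m ≥ 2 there exists a constant C > 0 such that for every finite field F of even order q, writing G = Sp_{2m}(F), there exists a subset A ⊆ G with |A| ≤ 4 such that the number of y ∈ G for which some x ∈ A makes {x, y} invariably generate G is at least (1 − C/q) · |G|. -/

import Mathlib

/-- `{x, y}` invariably generates `G`: for all `g, h`, the conjugates
`g * x * g⁻¹` and `h * y * h⁻¹` generate `G`. -/
def InvGen {G : Type*} [Group G] (x y : G) : Prop :=
  ∀ g h : G, Subgroup.closure {g * x * g⁻¹, h * y * h⁻¹} = ⊤
section
namespace SG
open MvPolynomial in
theorem subst_mono {ι F : Type*} [Field F] (G : ι → MvPolynomial ι F)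
    (hG : ∀ i, G i - X i ∈ idealOfVars ι F ^ 2) (e : ι →₀ ℕ) (c : F) :
    aeval G (monomial e c) - monomial e c ∈ idealOfVars ι F ^ (e.degree + 1) := by
  classical
  have hX : ∀ i, (X i : MvPolynomial ι F) ∈ idealOfVars ι F := fun i =>
    Ideal.subset_span ⟨i, rfl⟩
  induction e using Finsupp.induction_linear generalizing c with
  | zero => simp
  | single i k =>
    rw [← C_mul_X_pow_eq_monomial, map_mul, map_pow, aeval_X, aeval_C, MvPolynomial.algebraMap_eq, ← mul_sub]
    refine Ideal.mul_mem_left _ _ ?_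
    simp only [Finsupp.degree_single]
    have : G i ^ k - X i ^ k ∈ idealOfVars ι F ^ (k+1) ∧ G i ^ k ∈ idealOfVars ι F ^ k := by
      have hGi : G i ∈ idealOfVars ι F := by
        have := Ideal.pow_le_self (I := idealOfVars ι F) (n := 2) (by norm_num) (hG i)
        have h2 := Ideal.add_mem _ this (hX i)
        simpa using h2
      refine ⟨?_, Ideal.pow_mem_pow hGi k⟩
      induction k with
      | zero => simp
      | succ k ih =>
        have : G i ^ (k+1) - X i ^ (k+1) = (G i ^ k - X i ^ k) * G i + X i ^ k * (G i - X i) := by ring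
        rw [this]
        refine Ideal.add_mem _ ?_ ?_
        · rw [pow_succ (idealOfVars ι F) (k+1)]
          exact Ideal.mul_mem_mul ih hGi
        · rw [show k+1+1 = k+2 from rfl, pow_add]
          exact Ideal.mul_mem_mul (Ideal.pow_mem_pow (hX i) k) (hG i)
    exact this.1
  | add f g hf hg =>
    have h1 : monomial (f+g) c = monomial f c * monomial g (1:F) := by simp [monomial_mul]
    have hf' := hf c
    have hg' := hg 1
    rw [h1, map_mul]
    have : aeval G (monomial f c) * aeval G (monomial g (1:F)) - monomial f c * monomial g (1:F)
      = (aeval G (monomial f c) - monomial f c) * aeval G (monomial g (1:F)) + monomial f c * (aeval G (monomial g (1:F)) - monomial g (1:F)) := by ring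
    rw [this]
    have m1 : ∀ (h : ι →₀ ℕ) (a : F), monomial h a ∈ idealOfVars ι F ^ h.degree := by
      intro h a
      by_cases ha : a = 0
      · simp [ha]
      · exact (monomial_mem_pow_idealOfVars_iff _ _ ha).2 le_rfl
    have m2 : aeval G (monomial g (1:F)) ∈ idealOfVars ι F ^ g.degree := by
      have h3 := Ideal.add_mem _ (Ideal.pow_le_pow_right (Nat.le_succ _) hg') (m1 g 1)
      simpa using h3
    rw [map_add]
    refine Ideal.add_mem _ ?_ ?_
    · rw [show f.degree + g.degree + 1 = (f.degree + 1) + g.degree by ring, pow_add]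
      exact Ideal.mul_mem_mul hf' m2
    · rw [show f.degree + g.degree + 1 = f.degree + (g.degree + 1) by ring, pow_add]
      exact Ideal.mul_mem_mul (m1 f c) hg'
open MvPolynomial in
theorem subst_inj {ι F : Type*} [Field F] (G : ι → MvPolynomial ι F)
    (hG : ∀ i, G i - X i ∈ idealOfVars ι F ^ 2) (P : MvPolynomial ι F) (h0 : aeval G P = 0) : P = 0 := by
  classical
  by_contra hP
  have hs : P.support.Nonempty := by simpa [Finset.nonempty_iff_ne_empty] using hP
  obtain ⟨e, he, hmin⟩ := P.support.exists_min_image (fun e => e.degree) hs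
  have h1 : aeval G P - P ∈ idealOfVars ι F ^ (e.degree + 1) := by
    have : aeval G P - P = ∑ f ∈ P.support, (aeval G (monomial f (P.coeff f)) - monomial f (P.coeff f)) := by
      rw [Finset.sum_sub_distrib, ← map_sum, ← P.as_sum]
    rw [this]
    refine Ideal.sum_mem _ fun f hf => Ideal.pow_le_pow_right ?_ (subst_mono G hG f _)
    have := hmin f hf
    omega
  rw [h0, zero_sub, neg_mem_iff, mem_pow_idealOfVars_iff] at h1
  have := h1 e he
  omega
open MvPolynomial in
theorem count_lemma {ι F : Type} [Field F] [Fintype F] [Fintype ι] (G : ι → MvPolynomial ι F)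
    (hG : ∀ i, G i - X i ∈ idealOfVars ι F ^ 2) (D n0 : ℕ) (hD : ∀ i, (G i).totalDegree ≤ D)
    (hq : n0 * Fintype.card ι * D ≤ Fintype.card F - 1)
    (S : Finset (ι → F)) (hS : ∀ t : ι → F, (fun i => eval t (G i)) ∈ S) :
    (n0+1)^(Fintype.card ι) ≤ S.card := by
  classical
  by_contra hlt
  push Not at hlt
  let mon : (ι → Fin (n0+1)) → (ι →₀ ℕ) := fun e => Finsupp.equivFunOnFinite.symm (fun i => (e i : ℕ))
  have mon_inj : Function.Injective mon := by
    intro a b h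
    have := Finsupp.equivFunOnFinite.symm.injective h
    funext i
    exact Fin.ext (congrFun this i)
  let Φ : ((ι → Fin (n0+1)) → F) →ₗ[F] MvPolynomial ι F :=
    Fintype.linearCombination F (fun e => monomial (mon e) (1:F))
  let Ψ : ((ι → Fin (n0+1)) → F) →ₗ[F] (S → F) :=
    LinearMap.pi (fun s => (aeval (R := F) (s : ι → F)).toLinearMap ∘ₗ Φ)
  have hker : ∃ c, c ≠ 0 ∧ Ψ c = 0 := by
    by_contra hno
    push Not at hno
    have hinj : Function.Injective Ψ := by
      rw [injective_iff_map_eq_zero]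
      intro a ha
      by_contra hne
      exact hno a hne ha
    have := LinearMap.finrank_le_finrank_of_injective hinj
    simp at this
    omega
  obtain ⟨c, hc, hc0⟩ := hker
  set P := Φ c with hPdef
  have hPs : P = ∑ e, monomial (mon e) (c e) := by
    simp [P, Φ, Fintype.linearCombination_apply, smul_monomial]
  have hP : P ≠ 0 := by
    intro h
    apply hc
    funext e
    have := congrArg (coeff (mon e)) h
    rw [hPs] at this
    simpa [coeff_sum, coeff_monomial, mon_inj.eq_iff] using this
  apply hP
  apply subst_inj G hG
  apply eq_zero_of_eval_eq_zero
  · intro t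
    have h1 := congrFun hc0 ⟨_, hS t⟩
    have h2 : eval t (aeval G P) = aeval (R := F) (fun i => eval t (G i)) P := by
      rw [aeval_def, aeval_def, MvPolynomial.eval_eval₂]
      congr 1
      ext a
      simp [MvPolynomial.algebraMap_eq]
    rw [h2]
    exact h1
  · rw [mem_restrictDegree]
    intro s hs i
    have h3 : (aeval G P).totalDegree ≤ n0 * Fintype.card ι * D := by
      rw [hPs, map_sum]
      refine (totalDegree_finsetSum _ _).trans (Finset.sup_le fun e _ => ?_)
      rw [aeval_monomial, MvPolynomial.algebraMap_eq, Finsupp.prod_fintype _ _ (by simp)]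
      refine (totalDegree_mul _ _).trans ?_
      rw [totalDegree_C, zero_add]
      refine (totalDegree_finsetProd _ _).trans ?_
      calc ∑ i, (G i ^ (mon e i)).totalDegree ≤ ∑ i : ι, n0 * D := by
            refine Finset.sum_le_sum fun i _ => (totalDegree_pow _ _).trans ?_
            refine Nat.mul_le_mul ?_ (hD i)
            have := (e i).2
            simp only [mon, Finsupp.equivFunOnFinite_symm_apply_apply]
            omega
        _ = _ := by simp; ring
    calc s i ≤ s.degree := Finsupp.le_degree i s
      _ ≤ (aeval G P).totalDegree := le_totalDegree hs
      _ ≤ _ := h3.trans hq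
end SG
end
section
namespace SG
open MvPolynomial in
theorem curve_count {r : ℕ} {k F : Type} [Field F] [Fintype F] [Fintype k] [DecidableEq k]
    (T : Submonoid (Matrix k k F)) (Cv : Fin r → Matrix k k (Polynomial F)) (Dm : Fin r → Matrix k k F)
    (D n0 : ℕ) (hdeg : ∀ i a b, (Cv i a b).natDegree ≤ D)
    (h0 : ∀ i, (Cv i).map (Polynomial.eval 0) = 1) (h1 : ∀ i, (Cv i).map (fun p => p.coeff 1) = Dm i)
    (hT : ∀ i t, (Cv i).map (Polynomial.eval t) ∈ T) (hli : LinearIndependent F Dm)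
    (hq : n0 * r * (r * D) ≤ Fintype.card F - 1) : (n0+1)^r ≤ Nat.card T := by
  classical
  let Cm : Fin r → Matrix k k (MvPolynomial (Fin r) F) := fun i =>
    (Polynomial.aeval (R := F) (X i : MvPolynomial (Fin r) F)).toRingHom.mapMatrix (Cv i)
  let π : MvPolynomial (Fin r) F →+* MvPolynomial (Fin r) F ⧸ (idealOfVars (Fin r) F ^ 2) := Ideal.Quotient.mk _
  have hXX : ∀ i j, π (X i) * π (X j) = 0 := by
    intro i j
    rw [← map_mul, Ideal.Quotient.eq_zero_iff_mem, pow_two]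
    exact Ideal.mul_mem_mul (Ideal.subset_span ⟨i, rfl⟩) (Ideal.subset_span ⟨j, rfl⟩)
  let DD : Fin r → Matrix k k (MvPolynomial (Fin r) F ⧸ (idealOfVars (Fin r) F ^ 2)) := fun i =>
    (Dm i).map (fun a => π (C a))
  have hC : ∀ i, π.mapMatrix (Cm i) = 1 + π (X i) • DD i := by
    intro i
    ext a b
    have e0 : (Cv i a b).coeff 0 = (1 : Matrix k k F) a b := by
      have := congrFun (congrFun (h0 i) a) b
      rw [Polynomial.coeff_zero_eq_eval_zero]; exact this
    have e1 : (Cv i a b).coeff 1 = Dm i a b := congrFun (congrFun (h1 i) a) b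
    have key : ∀ p : Polynomial F, π (Polynomial.aeval (X i : MvPolynomial (Fin r) F) p)
        = π (C (p.coeff 0)) + π (X i) * π (C (p.coeff 1)) := by
      intro p
      conv_lhs => rw [← p.divX_mul_X_add, ← p.divX.divX_mul_X_add]
      have := hXX i i
      simp only [map_add, map_mul, Polynomial.aeval_X, Polynomial.aeval_C, MvPolynomial.algebraMap_eq, Polynomial.coeff_divX]
      linear_combination (π (Polynomial.aeval (X i : MvPolynomial (Fin r) F) p.divX.divX)) * this
    have := key (Cv i a b)
    simp only [RingHom.mapMatrix_apply, Matrix.map_apply, Cm, Matrix.add_apply, Matrix.smul_apply, DD, smul_eq_mul]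
    refine this.trans ?_
    rw [e0, e1, Matrix.one_apply, Matrix.one_apply]
    congr 1
    split_ifs <;> simp
  have hprod : ∀ l : List (Fin r), π.mapMatrix (l.map Cm).prod = 1 + (l.map fun i => π (X i) • DD i).sum := by
    intro l
    induction l with
    | nil => simp
    | cons i l ih =>
      have hz : ∀ l : List (Fin r), (π (X i) • DD i) * (l.map fun i => π (X i) • DD i).sum = 0 := by
        intro l
        induction l with
        | nil => simp
        | cons j l ih2 =>
          rw [List.map_cons, List.sum_cons, mul_add, ih2, smul_mul_smul_comm, hXX, zero_smul, add_zero]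
      rw [List.map_cons, List.prod_cons, map_mul, ih, hC, List.map_cons, List.sum_cons, mul_add, add_mul, add_mul, hz]
      simp only [mul_one, one_mul]; abel
  let Ψ := ((List.finRange r).map Cm).prod
  have hΨdeg : ∀ l : List (Fin r), ∀ a b, ((l.map Cm).prod a b).totalDegree ≤ l.length * D := by
    intro l
    induction l with
    | nil =>
      intro a b
      simp only [List.map_nil, List.prod_nil, Matrix.one_apply]
      split_ifs <;> simp
    | cons i l ih =>
      intro a b
      rw [List.map_cons, List.prod_cons, Matrix.mul_apply]
      refine totalDegree_finsetSum_le fun c _ => (totalDegree_mul _ _).trans ?_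
      have h2 : (Cm i a c).totalDegree ≤ D := by
        change (Polynomial.aeval (X i : MvPolynomial (Fin r) F) (Cv i a c)).totalDegree ≤ D
        rw [Polynomial.aeval_eq_sum_range]
        refine totalDegree_finsetSum_le fun j hj => (totalDegree_smul_le _ _).trans ((totalDegree_pow _ _).trans ?_)
        rw [totalDegree_X, mul_one]
        have := hdeg i a c
        simp at hj; omega
      have := ih c b
      rw [List.length_cons]
      nlinarith
  -- dual functionals
  have hdual : ∃ φ : Fin r → Matrix k k F, ∀ j i, ∑ a, ∑ b, φ j a b * Dm i a b = if i = j then 1 else 0 := by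
    have : ∀ j, ∃ f : Matrix k k F →ₗ[F] F, ∀ i, f (Dm i) = if i = j then 1 else 0 := by
      intro j
      obtain ⟨g, hg⟩ := LinearMap.exists_extend (p := Submodule.span F (Set.range Dm)) ((Finsupp.lapply j) ∘ₗ hli.repr)
      refine ⟨g, fun i => ?_⟩
      have h := LinearMap.congr_fun hg ⟨Dm i, Submodule.subset_span ⟨i, rfl⟩⟩
      simp only [LinearMap.comp_apply, Submodule.subtype_apply] at h
      rw [h]
      have := hli.repr_eq_single i ⟨Dm i, Submodule.subset_span ⟨i, rfl⟩⟩ rfl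
      simp only [Finsupp.lapply_apply]
      rw [this, Finsupp.single_apply]
    choose f hf using this
    refine ⟨fun j => Matrix.of fun a b => f j (Matrix.single a b 1), fun j i => ?_⟩
    rw [← hf j i]
    conv_rhs => rw [Matrix.matrix_eq_sum_single (Dm i)]
    simp only [map_sum]
    refine Finset.sum_congr rfl fun a _ => Finset.sum_congr rfl fun b _ => ?_
    have : Matrix.single a b (Dm i a b) = Dm i a b • Matrix.single a b (1:F) := by simp
    rw [this, map_smul, Matrix.of_apply, smul_eq_mul, mul_comm]
  obtain ⟨φ, hφ⟩ := hdual
  let G : Fin r → MvPolynomial (Fin r) F := fun j => ∑ a, ∑ b, C (φ j a b) * (Ψ a b - C ((1 : Matrix k k F) a b))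
  have hGX : ∀ i, G i - X i ∈ idealOfVars (Fin r) F ^ 2 := by
    intro j
    rw [← Ideal.Quotient.eq_zero_iff_mem]
    change π _ = 0
    rw [map_sub, sub_eq_zero]
    simp only [G, map_sum, map_mul, map_sub]
    have hΨ : ∀ a b, π (Ψ a b) = π (C ((1 : Matrix k k F) a b)) + ∑ i, π (X i) * π (C (Dm i a b)) := by
      intro a b
      have := congrFun (congrFun (hprod (List.finRange r)) a) b
      rw [RingHom.mapMatrix_apply, Matrix.map_apply] at this
      refine this.trans ?_
      rw [Matrix.add_apply, Matrix.one_apply, Matrix.one_apply, ← List.ofFn_eq_map, List.sum_ofFn, Matrix.sum_apply]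
      congr 1
      split_ifs <;> simp
    simp only [hΨ, add_sub_cancel_left, Finset.mul_sum]
    calc _ = ∑ a, ∑ i, ∑ b, π (C (φ j a b)) * (π (X i) * π (C (Dm i a b))) :=
          Finset.sum_congr rfl fun a _ => Finset.sum_comm
      _ = ∑ i, ∑ a, ∑ b, π (C (φ j a b)) * (π (X i) * π (C (Dm i a b))) := Finset.sum_comm
      _ = ∑ i, π (X i) * π (C (∑ a, ∑ b, φ j a b * Dm i a b)) := by
          refine Finset.sum_congr rfl fun i _ => ?_
          simp only [map_sum, map_mul, Finset.mul_sum]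
          refine Finset.sum_congr rfl fun a _ => Finset.sum_congr rfl fun b _ => ?_
          ring
      _ = π (X j) := by
          simp only [hφ]
          rw [Finset.sum_eq_single j] <;> simp +contextual
  have hGdeg : ∀ i, (G i).totalDegree ≤ r * D := by
    intro j
    refine totalDegree_finsetSum_le fun a _ => totalDegree_finsetSum_le fun b _ => (totalDegree_mul _ _).trans ?_
    rw [totalDegree_C, zero_add]
    refine (totalDegree_sub _ _).trans (max_le ?_ ?_)
    · simpa using hΨdeg (List.finRange r) a b
    · rw [totalDegree_C]; exact Nat.zero_le _
  have hfin : (T : Set (Matrix k k F)).Finite := Set.toFinite _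
  let g : Matrix k k F → (Fin r → F) := fun M j => ∑ a, ∑ b, φ j a b * (M a b - (1 : Matrix k k F) a b)
  have hmem : ∀ t : Fin r → F, ∀ l : List (Fin r), (eval t).mapMatrix (l.map Cm).prod ∈ T := by
    intro t l
    rw [map_list_prod, List.map_map]
    refine T.list_prod_mem ?_
    intro M hM
    obtain ⟨i, -, rfl⟩ := List.mem_map.1 hM
    convert hT i (t i) using 1
    ext a b
    simp only [Function.comp_apply, RingHom.mapMatrix_apply, Matrix.map_apply, Cm]
    change eval t (Polynomial.aeval (X i : MvPolynomial (Fin r) F) (Cv i a b)) = _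
    rw [Polynomial.aeval_def, ← MvPolynomial.coe_aeval_eq_eval]
    have := Polynomial.hom_eval₂ (Cv i a b) (algebraMap F (MvPolynomial (Fin r) F)) (aeval (R := F) t).toRingHom (X i)
    simp only [AlgHom.toRingHom_eq_coe, RingHom.coe_coe] at this ⊢
    rw [this, aeval_X, Polynomial.eval, AlgHom.comp_algebraMap]; rfl
  have := count_lemma G hGX (r * D) n0 hGdeg (by simpa using hq) (hfin.toFinset.image g) (by
    intro t
    rw [Finset.mem_image]
    refine ⟨(eval t).mapMatrix Ψ, by simpa using hmem t (List.finRange r), ?_⟩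
    funext j
    simp [g, G])
  rw [Fintype.card_fin] at this
  refine this.trans (Finset.card_image_le.trans ?_)
  rw [← Set.ncard_eq_toFinset_card _ hfin]
  exact le_of_eq (Nat.card_coe_set_eq (T : Set (Matrix k k F))).symm
end SG
end
section
namespace SG
set_option linter.all false
open Matrix
section forms
variable {n K : Type} [Fintype n] [DecidableEq n] [Field K]
/-- symmetric, square one, zero diagonal -/
structure Sy (J : Matrix n n K) : Prop where
  symm : Jᵀ = J
  sq : J * J = 1
  diag : ∀ i, J i i = 0
def om (J : Matrix n n K) (v w : n → K) : K := v ⬝ᵥ (J *ᵥ w)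
def adj (J : Matrix n n K) (A : Matrix n n K) : Matrix n n K := J * Aᵀ * J
variable {J : Matrix n n K}
theorem om_add_left (u v w : n → K) : om J (u + v) w = om J u w + om J v w := by simp [om, add_dotProduct]
theorem om_add_right (u v w : n → K) : om J u (v + w) = om J u v + om J u w := by
  simp [om, mulVec_add]
theorem om_smul_left (c : K) (v w : n → K) : om J (c • v) w = c * om J v w := by simp [om]
theorem om_smul_right (c : K) (v w : n → K) : om J v (c • w) = c * om J v w := by
  simp [om, mulVec_smul]
theorem om_zero_left (w : n → K) : om J 0 w = 0 := by simp [om]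
theorem om_zero_right (w : n → K) : om J w 0 = 0 := by simp [om]
theorem om_comm (hJ : Sy J) (v w : n → K) : om J v w = om J w v := by
  rw [om, om, dotProduct_mulVec, ← mulVec_transpose, hJ.symm, dotProduct_comm]
theorem om_self [CharP K 2] (hJ : Sy J) (v : n → K) : om J v v = 0 := by
  have : om J v v = ∑ p : n × n, v p.1 * (J p.1 p.2 * v p.2) := by
    simp [om, dotProduct, mulVec, Finset.mul_sum, Fintype.sum_prod_type]
  rw [this]
  refine Finset.sum_involution (fun p _ => p.swap) ?_ ?_ (by simp) (by simp)
  · intro p _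
    have h : J p.2 p.1 = J p.1 p.2 := congrFun (congrFun hJ.symm p.1) p.2
    simp only [Prod.fst_swap, Prod.snd_swap, h]
    have := CharTwo.add_self_eq_zero (v p.1 * (J p.1 p.2 * v p.2))
    linear_combination this
  · rintro ⟨i, j⟩ _ h1 h2
    simp only [Prod.swap_prod_mk, Prod.mk.injEq] at h2
    obtain ⟨rfl, _⟩ := h2
    simp [hJ.diag] at h1
theorem om_adj (hJ : Sy J) (A : Matrix n n K) (v w : n → K) : om J (A *ᵥ v) w = om J v (adj J A *ᵥ w) := by
  have : J * adj J A = Aᵀ * J := by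
    rw [adj, ← Matrix.mul_assoc, ← Matrix.mul_assoc, hJ.sq, Matrix.one_mul]
  rw [om, om, mulVec_mulVec, this, ← mulVec_mulVec, dotProduct_mulVec v, vecMul_transpose]
theorem adj_adj (hJ : Sy J) (A : Matrix n n K) : adj J (adj J A) = A := by
  rw [adj, adj, transpose_mul, transpose_mul, transpose_transpose, hJ.symm]
  have := hJ.sq
  calc J * (J * (A * J)) * J = (J * J) * A * (J * J) := by noncomm_ring
    _ = A := by rw [this]; simp
theorem adj_mul (hJ : Sy J) (A B : Matrix n n K) : adj J (A * B) = adj J B * adj J A := by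
  rw [adj, adj, adj, transpose_mul]
  calc J * (Bᵀ * Aᵀ) * J = J * Bᵀ * 1 * Aᵀ * J := by simp [Matrix.mul_assoc]
    _ = _ := by rw [← hJ.sq]; noncomm_ring
theorem adj_one (hJ : Sy J) : adj J (1 : Matrix n n K) = 1 := by simp [adj, hJ.sq]
theorem adj_add (A B : Matrix n n K) : adj J (A + B) = adj J A + adj J B := by
  simp [adj, Matrix.mul_add, Matrix.add_mul]
theorem adj_smul (c : K) (A : Matrix n n K) : adj J (c • A) = c • adj J A := by
  simp [adj]
theorem om_adj' (hJ : Sy J) (A : Matrix n n K) (v w : n → K) : om J v (A *ᵥ w) = om J (adj J A *ᵥ v) w := by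
  rw [om_adj hJ, adj_adj hJ]
theorem om_nondeg (hJ : Sy J) (v : n → K) (h : ∀ w, om J v w = 0) : v = 0 := by
  have h2 : v ᵥ* J = 0 := by
    refine dotProduct_eq_zero _ fun w => ?_
    have := h w
    rwa [om, dotProduct_mulVec] at this
  have h3 : (v ᵥ* J) ᵥ* J = 0 := by rw [h2]; simp
  rwa [vecMul_vecMul, hJ.sq, vecMul_one] at h3
theorem om_ext (hJ : Sy J) (v v' : n → K) (h : ∀ w, om J v w = om J v' w) : v = v' := by
  rw [← sub_eq_zero]
  refine om_nondeg hJ _ fun w => ?_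
  have : v = (v - v') + v' := by abel
  have h2 := h w
  rw [this, om_add_left] at h2
  simpa using h2
end forms
section sp
variable {l K : Type} [Fintype l] [DecidableEq l] [Field K] [CharP K 2]
theorem sy_J : Sy (Matrix.J l K) := by
  have hn : ∀ A : Matrix (l ⊕ l) (l ⊕ l) K, -A = A := fun A => by
    ext i j; exact CharTwo.neg_eq _
  refine ⟨?_, ?_, ?_⟩
  · rw [J_transpose, hn]
  · rw [J_squared, hn]
  · rintro (i | i) <;> simp [Matrix.J]
theorem mem_sp {A : Matrix (l ⊕ l) (l ⊕ l) K} :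
    A ∈ symplecticGroup l K ↔ A * adj (Matrix.J l K) A = 1 := by
  rw [SymplecticGroup.mem_iff, adj]
  have h := (sy_J (l := l) (K := K)).sq
  constructor
  · intro h1
    rw [← Matrix.mul_assoc, ← Matrix.mul_assoc, h1, h]
  · intro h1
    calc A * Matrix.J l K * Aᵀ = (A * (Matrix.J l K * Aᵀ * Matrix.J l K)) * Matrix.J l K := by
            simp only [Matrix.mul_assoc, h, Matrix.mul_one]
      _ = _ := by rw [h1, Matrix.one_mul]
theorem mem_sp' {A : Matrix (l ⊕ l) (l ⊕ l) K} :
    A ∈ symplecticGroup l K ↔ adj (Matrix.J l K) A * A = 1 := by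
  rw [mem_sp, mul_eq_one_comm]
theorem sp_om {A : Matrix (l ⊕ l) (l ⊕ l) K} (hA : A ∈ symplecticGroup l K) (v w : l ⊕ l → K) :
    om (Matrix.J l K) (A *ᵥ v) (A *ᵥ w) = om (Matrix.J l K) v w := by
  rw [om_adj sy_J, mulVec_mulVec, mem_sp'.1 hA, one_mulVec]
theorem mem_sp_of_om {A : Matrix (l ⊕ l) (l ⊕ l) K} (h : ∀ v w, om (Matrix.J l K) (A *ᵥ v) (A *ᵥ w) = om (Matrix.J l K) v w) : A ∈ symplecticGroup l K := by
  rw [mem_sp']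
  refine Matrix.ext_of_mulVec_single fun j => ?_
  refine om_ext sy_J _ _ fun w => ?_
  rw [om_comm sy_J, ← mulVec_mulVec, ← om_adj sy_J, h, om_comm sy_J, one_mulVec]
theorem sp_inv (A : symplecticGroup l K) : ((A⁻¹ : symplecticGroup l K) : Matrix (l ⊕ l) (l ⊕ l) K) = adj (Matrix.J l K) A := by
  have h1 : ((A⁻¹ : symplecticGroup l K) : Matrix (l ⊕ l) (l ⊕ l) K) * A = 1 := by
    rw [← Submonoid.coe_mul, inv_mul_cancel]; rfl
  have h2 := mem_sp.1 A.2
  calc _ = ((A⁻¹ : symplecticGroup l K) : Matrix (l ⊕ l) (l ⊕ l) K) * (A * adj (Matrix.J l K) A) := by rw [h2, mul_one]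
    _ = _ := by rw [← mul_assoc, h1, one_mul]
end sp
end SG
end
section
namespace SG
set_option linter.all false
open Matrix
section
variable {l K : Type} [Fintype l] [DecidableEq l] [Field K] [CharP K 2]
local notation "ω" => om (Matrix.J l K)
/-- transvection -/
def tv (v : l ⊕ l → K) (a : K) : Matrix (l ⊕ l) (l ⊕ l) K := 1 + a • vecMulVec v (Matrix.J l K *ᵥ v)
theorem tv_mulVec (v : l ⊕ l → K) (a : K) (u : l ⊕ l → K) : tv v a *ᵥ u = u + (a * ω u v) • v := by
  rw [tv, add_mulVec, one_mulVec, smul_mulVec, vecMulVec_mulVec, om, dotProduct_comm]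
  ext i; simp; ring
theorem tv_mem (v : l ⊕ l → K) (a : K) : tv v a ∈ symplecticGroup l K := by
  refine mem_sp_of_om fun u w => ?_
  rw [tv_mulVec, tv_mulVec]
  simp only [om_add_left, om_add_right, om_smul_left, om_smul_right, om_self sy_J, om_comm sy_J v w]
  have := CharTwo.add_self_eq_zero (a * ω u v * ω w v)
  linear_combination this
theorem tv_mul (v : l ⊕ l → K) (a b : K) : tv v a * tv v b = tv v (a + b) := by
  refine Matrix.ext_of_mulVec_single fun j => ?_
  simp only [← mulVec_mulVec, tv_mulVec, om_add_left, om_smul_left, om_self sy_J]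
  ext i; simp; ring
theorem tv_zero (v : l ⊕ l → K) : tv v (0:K) = 1 := by simp [tv]
theorem tv_inv (v : l ⊕ l → K) (a : K) : tv v a * tv v a = 1 := by
  rw [tv_mul, CharTwo.add_self_eq_zero, tv_zero]
theorem tv_smul (c : K) (v : l ⊕ l → K) (a : K) : tv (c • v) a = tv v (c^2 * a) := by
  refine Matrix.ext_of_mulVec_single fun j => ?_
  simp only [tv_mulVec, om_smul_right]
  ext i; simp; ring
theorem tv_move (u w : l ⊕ l → K) (h : ω u w ≠ 0) : tv (u + w) (ω u w)⁻¹ *ᵥ u = w := by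
  rw [tv_mulVec, om_add_right, om_self sy_J, zero_add, inv_mul_cancel₀ h, one_smul, ← add_assoc]
  ext i; simp [CharTwo.add_self_eq_zero]
theorem tv_conj (g : symplecticGroup l K) (v : l ⊕ l → K) (a : K) :
    (g : Matrix (l ⊕ l) (l ⊕ l) K) * tv v a * ((g⁻¹ : symplecticGroup l K) : Matrix (l ⊕ l) (l ⊕ l) K) = tv ((g : Matrix (l ⊕ l) (l ⊕ l) K) *ᵥ v) a := by
  have h1 : (g : Matrix (l ⊕ l) (l ⊕ l) K) * ((g⁻¹ : symplecticGroup l K) : Matrix (l ⊕ l) (l ⊕ l) K) = 1 := by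
    rw [← Submonoid.coe_mul, mul_inv_cancel]; rfl
  refine Matrix.ext_of_mulVec_single fun j => ?_
  simp only [← mulVec_mulVec, tv_mulVec, mulVec_add, mulVec_smul]
  have h3 : ∀ u, (g : Matrix (l ⊕ l) (l ⊕ l) K) *ᵥ (((g⁻¹ : symplecticGroup l K) : Matrix (l ⊕ l) (l ⊕ l) K) *ᵥ u) = u := by
    intro u; rw [mulVec_mulVec, h1, one_mulVec]
  rw [h3]
  congr 3
  conv_rhs => rw [← h3 (Pi.single j 1)]
  rw [sp_om g.2]
/-- vectors vanishing on the coordinates in s -/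
def Us (s : Finset l) (v : l ⊕ l → K) : Prop := ∀ j ∈ s, v (Sum.inl j) = 0 ∧ v (Sum.inr j) = 0
abbrev ee (i : l) : l ⊕ l → K := Pi.single (Sum.inl i) 1
abbrev ff (i : l) : l ⊕ l → K := Pi.single (Sum.inr i) 1
theorem om_ee (i : l) (u : l ⊕ l → K) : ω u (ee i) = u (Sum.inr i) := by
  simp [om, Matrix.J, ee, dotProduct, Fintype.sum_sum_type, Matrix.one_apply]
theorem om_ff (i : l) (u : l ⊕ l → K) : ω u (ff i) = u (Sum.inl i) := by
  simp [om, Matrix.J, ff, dotProduct, Fintype.sum_sum_type, Matrix.one_apply, CharTwo.neg_eq]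
theorem Us_add {s : Finset l} {v w : l ⊕ l → K} (hv : Us s v) (hw : Us s w) : Us s (v + w) := by
  intro j hj; simp [hv j hj, hw j hj]
theorem Us_ee {s : Finset l} {i : l} (h : i ∉ s) : Us s (ee i : l ⊕ l → K) := by
  intro j hj
  have : j ≠ i := fun e => h (e ▸ hj)
  simp [ee, Pi.single_apply, this]
theorem Us_ff {s : Finset l} {i : l} (h : i ∉ s) : Us s (ff i : l ⊕ l → K) := by
  intro j hj
  have : j ≠ i := fun e => h (e ▸ hj)
  simp [ff, Pi.single_apply, this]
theorem move2 (s : Finset l) (u z w : l ⊕ l → K) (hu : Us s u) (hz : Us s z) (hw : Us s w) (h1 : ω u z ≠ 0) (h2 : ω z w ≠ 0) :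
    ∃ v1 a1 v2 a2, Us s v1 ∧ Us s v2 ∧ tv v2 a2 *ᵥ (tv v1 a1 *ᵥ u) = w :=
  ⟨_, _, _, _, Us_add hu hz, Us_add hz hw, by rw [tv_move u z h1, tv_move z w h2]⟩
theorem step1 (s : Finset l) (i : l) (hi : i ∉ s) (u : l ⊕ l → K) (hu : Us s u) (h0 : u ≠ 0) :
    ∃ v1 a1 v2 a2, Us s v1 ∧ Us s v2 ∧ tv v2 a2 *ᵥ (tv v1 a1 *ᵥ u) = ee i := by
  have hfe : ω (ff i : l ⊕ l → K) (ee i) = 1 := by rw [om_ee]; simp [ff]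
  by_cases h1 : ω u (ff i) ≠ 0
  · exact move2 s u (ff i) (ee i) hu (Us_ff hi) (Us_ee hi) h1 (by rw [hfe]; exact one_ne_zero)
  push Not at h1
  obtain ⟨z, hz, hz2⟩ : ∃ z, Us s z ∧ ω u z ≠ 0 := by
    obtain ⟨k, hk⟩ := Function.ne_iff.1 h0
    rcases k with k | k
    · refine ⟨ff k, Us_ff fun hks => hk (hu k hks).1, ?_⟩
      rw [om_ff]; exact hk
    · refine ⟨ee k, Us_ee fun hks => hk (hu k hks).2, ?_⟩
      rw [om_ee]; exact hk
  by_cases h2 : ω z (ee i) = 0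
  · refine move2 s u (z + ff i) (ee i) hu (Us_add hz (Us_ff hi)) (Us_ee hi) ?_ ?_
    · rw [om_add_right, h1, add_zero]; exact hz2
    · rw [om_add_left, h2, hfe]; simp
  · exact move2 s u z (ee i) hu hz (Us_ee hi) hz2 h2
theorem step2 (s : Finset l) (i : l) (hi : i ∉ s) (u : l ⊕ l → K) (hu : Us s u) (h0 : ω u (ee i) = 1) :
    ∃ v1 a1 v2 a2, Us s v1 ∧ Us s v2 ∧ ω (ee i) v1 = 0 ∧ ω (ee i) v2 = 0 ∧ tv v2 a2 *ᵥ (tv v1 a1 *ᵥ u) = ff i := by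
  have hfe : ω (ff i : l ⊕ l → K) (ee i) = 1 := by rw [om_ee]; simp [ff]
  have hef : ω (ee i : l ⊕ l → K) (ff i) = 1 := by rw [om_comm sy_J, hfe]
  have hue : ω (ee i) u = 1 := by rw [om_comm sy_J, h0]
  have h11 : (1:K) + 1 = 0 := CharTwo.add_self_eq_zero 1
  by_cases h1 : ω u (ff i) = 0
  · have a1 : ω u (u + ee i) = 1 := by rw [om_add_right, om_self sy_J, h0, zero_add]
    have a2 : ω (u + ee i) (ff i) = 1 := by rw [om_add_left, h1, hef, zero_add]
    refine ⟨u + (u + ee i), (ω u (u + ee i))⁻¹, (u + ee i) + ff i, (ω (u + ee i) (ff i))⁻¹, Us_add hu (Us_add hu (Us_ee hi)), Us_add (Us_add hu (Us_ee hi)) (Us_ff hi), ?_, ?_, ?_⟩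
    · simp only [om_add_right, hue, om_self sy_J]; linear_combination h11
    · simp only [om_add_right, hue, hef, om_self sy_J]; linear_combination h11
    · rw [tv_move u _ (by rw [a1]; exact one_ne_zero), tv_move _ _ (by rw [a2]; exact one_ne_zero)]
  · refine ⟨u + ff i, (ω u (ff i))⁻¹, 0, 0, Us_add hu (Us_ff hi), fun j _ => by simp, ?_, om_zero_right _, ?_⟩
    · rw [om_add_right, hue, hef, h11]
    · rw [tv_move _ _ h1, tv_zero, one_mulVec]
theorem tv_fix (s : Finset l) (v : l ⊕ l → K) (hv : Us s v) (a : K) (j : l) (hj : j ∈ s) :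
    tv v a *ᵥ ee j = ee j ∧ tv v a *ᵥ ff j = ff j := by
  constructor
  · rw [tv_mulVec, om_comm sy_J, om_ee, (hv j hj).2]; simp
  · rw [tv_mulVec, om_comm sy_J, om_ff, (hv j hj).1]; simp
theorem reduce (A : Matrix (l ⊕ l) (l ⊕ l) K) (hA : A ∈ symplecticGroup l K) (s : Finset l) :
    ∃ L : List ((l ⊕ l → K) × K), L.length = 4 * s.card ∧
      ∀ j ∈ s, ((L.map fun p => tv p.1 p.2).prod * A) *ᵥ ee j = ee j ∧ ((L.map fun p => tv p.1 p.2).prod * A) *ᵥ ff j = ff j := by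
  induction s using Finset.induction_on with
  | empty => exact ⟨[], by simp, by simp⟩
  | insert i s hi ih =>
    obtain ⟨L, hL, hfix⟩ := ih
    have hLm : (L.map fun p => tv p.1 p.2).prod ∈ symplecticGroup l K := by
      refine Submonoid.list_prod_mem _ fun M hM => ?_
      obtain ⟨p, -, rfl⟩ := List.mem_map.1 hM
      exact tv_mem _ _
    set B := (L.map fun p => tv p.1 p.2).prod * A with hB
    have hBm : B ∈ symplecticGroup l K := mul_mem hLm hA
    have hUs : ∀ u, Us s u → Us s (B *ᵥ u) := by
      intro u hu j hj
      constructor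
      · rw [← om_ff j (B *ᵥ u)]; conv_lhs => rw [← (hfix j hj).2]
        rw [sp_om hBm, om_ff]; exact (hu j hj).1
      · rw [← om_ee j (B *ᵥ u)]; conv_lhs => rw [← (hfix j hj).1]
        rw [sp_om hBm, om_ee]; exact (hu j hj).2
    have hne : B *ᵥ ee i ≠ 0 := by
      intro h
      have := congrArg (fun v => adj (Matrix.J l K) B *ᵥ v) h
      simp only [mulVec_mulVec, mem_sp'.1 hBm, one_mulVec, mulVec_zero] at this
      have := congrFun this (Sum.inl i)
      simp [ee] at this
    obtain ⟨v1, a1, v2, a2, hv1, hv2, h12⟩ := step1 s i hi _ (hUs _ (Us_ee hi)) hne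
    have hUt : ∀ (v : l ⊕ l → K) a u, Us s v → Us s u → Us s (tv v a *ᵥ u) := by
      intro v a u hv hu j hj
      rw [tv_mulVec]; simp [hv j hj, hu j hj]
    set B2 := tv v2 a2 * (tv v1 a1 * B) with hB2
    have hB2m : B2 ∈ symplecticGroup l K := mul_mem (tv_mem _ _) (mul_mem (tv_mem _ _) hBm)
    have hB2e : B2 *ᵥ ee i = ee i := by
      rw [hB2, ← mulVec_mulVec, ← mulVec_mulVec, h12]
    have hU2 : Us s (B2 *ᵥ ff i) := by
      rw [hB2, ← mulVec_mulVec, ← mulVec_mulVec]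
      exact hUt _ _ _ hv2 (hUt _ _ _ hv1 (hUs _ (Us_ff hi)))
    have h01 : ω (B2 *ᵥ ff i) (ee i) = 1 := by
      conv_lhs => rw [← hB2e]
      rw [sp_om hB2m, om_ee]; simp [ff]
    obtain ⟨v3, a3, v4, a4, hv3, hv4, he3, he4, h34⟩ := step2 s i hi _ hU2 h01
    refine ⟨(v4, a4) :: (v3, a3) :: (v2, a2) :: (v1, a1) :: L, by simp [hL, hi]; ring, ?_⟩
    have hp : ((((v4, a4) :: (v3, a3) :: (v2, a2) :: (v1, a1) :: L).map fun p : (l ⊕ l → K) × K => tv p.1 p.2).prod * A)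
        = tv v4 a4 * (tv v3 a3 * B2) := by
      simp only [List.map_cons, List.prod_cons, hB2, hB, Matrix.mul_assoc]
    rw [hp]
    intro j hj
    rcases Finset.mem_insert.1 hj with rfl | hj
    · constructor
      · rw [← mulVec_mulVec, ← mulVec_mulVec, hB2e]
        rw [tv_mulVec v3, he3, mul_zero, zero_smul, add_zero, tv_mulVec, he4, mul_zero, zero_smul, add_zero]
      · rw [← mulVec_mulVec, ← mulVec_mulVec, h34]
    · simp only [hB2, ← mulVec_mulVec, (hfix j hj).1, (hfix j hj).2, (tv_fix s _ hv1 a1 j hj).1, (tv_fix s _ hv2 a2 j hj).1,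
        (tv_fix s _ hv3 a3 j hj).1, (tv_fix s _ hv4 a4 j hj).1, (tv_fix s _ hv1 a1 j hj).2, (tv_fix s _ hv2 a2 j hj).2,
        (tv_fix s _ hv3 a3 j hj).2, (tv_fix s _ hv4 a4 j hj).2, and_self]
theorem tv_list_inv (L : List ((l ⊕ l → K) × K)) :
    (L.reverse.map fun p => tv p.1 p.2).prod * (L.map fun p => tv p.1 p.2).prod = 1 := by
  induction L with
  | nil => simp
  | cons p L ih =>
    simp only [List.reverse_cons, List.map_append, List.map_cons, List.map_nil, List.prod_append, List.prod_cons, List.prod_nil, mul_one]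
    calc _ = (List.map (fun p => tv p.1 p.2) L.reverse).prod * (tv p.1 p.2 * tv p.1 p.2) * (List.map (fun p => tv p.1 p.2) L).prod := by
            simp only [mul_assoc]
      _ = _ := by rw [tv_inv, mul_one, ih]
theorem sp_gen (A : Matrix (l ⊕ l) (l ⊕ l) K) (hA : A ∈ symplecticGroup l K) :
    ∃ L : List ((l ⊕ l → K) × K), L.length = 4 * Fintype.card l ∧ A = (L.map fun p => tv p.1 p.2).prod := by
  obtain ⟨L, hL, h⟩ := reduce A hA Finset.univ
  have h1 : (L.map fun p => tv p.1 p.2).prod * A = 1 := by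
    refine Matrix.ext_of_mulVec_single fun j => ?_
    rw [one_mulVec]
    rcases j with j | j
    · exact (h j (Finset.mem_univ _)).1
    · exact (h j (Finset.mem_univ _)).2
  refine ⟨L.reverse, by simpa using hL, ?_⟩
  have := tv_list_inv L
  calc A = ((L.reverse.map fun p => tv p.1 p.2).prod * (L.map fun p => tv p.1 p.2).prod) * A := by rw [this, one_mul]
    _ = _ := by rw [mul_assoc, h1, mul_one]
theorem sp_trans (u : l ⊕ l → K) (hu : u ≠ 0) (i : l) : ∃ g : symplecticGroup l K, (g : Matrix (l ⊕ l) (l ⊕ l) K) *ᵥ u = ee i := by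
  obtain ⟨v1, a1, v2, a2, -, -, h⟩ := step1 ∅ i (by simp) u (by intro j hj; simp at hj) hu
  exact ⟨⟨tv v2 a2, tv_mem _ _⟩ * ⟨tv v1 a1, tv_mem _ _⟩, by
    rw [Submonoid.coe_mul, ← mulVec_mulVec]; exact h⟩
end
end SG
end
section
namespace SG
set_option linter.all false
open Matrix
theorem char2_sqrt {F : Type} [Field F] [Fintype F] [CharP F 2] (b : F) : ∃ c, c^2 = b := by
  have hinj : Function.Injective (fun c : F => c^2) := by
    intro a b h
    exact frobenius_inj F 2 h
  exact (Finite.injective_iff_surjective.1 hinj) b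
theorem index_bound {l F : Type} [Fintype l] [DecidableEq l] [Nonempty l] [Field F] [Fintype F] [CharP F 2] (H : Subgroup (symplecticGroup l F)) (c : ℕ)
    (hq : c.factorial < Fintype.card F) (hidx : H.index ≤ c) : H = ⊤ := by
  classical
  set N0 := H.normalCore with hN0
  have hNi : N0.index ≤ c.factorial := by
    have h1 : N0 = (MulAction.toPermHom (symplecticGroup l F) (symplecticGroup l F ⧸ H)).ker := Subgroup.normalCore_eq_ker H
    rw [h1, Subgroup.index_ker]
    have h2 : Nat.card (MulAction.toPermHom (symplecticGroup l F) (symplecticGroup l F ⧸ H)).range ≤ Nat.card (Equiv.Perm (symplecticGroup l F ⧸ H)) :=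
      Nat.card_le_card_of_injective _ Subtype.val_injective
    rw [Nat.card_perm] at h2
    exact h2.trans (Nat.factorial_le hidx)
  let T : (l ⊕ l → F) → F → symplecticGroup l F := fun v a => ⟨tv v a, tv_mem v a⟩
  obtain ⟨i⟩ := ‹Nonempty l›
  have hpig : ∃ a b : F, a ≠ b ∧ (T (ee i) a : symplecticGroup l F ⧸ N0) = T (ee i) b := by
    by_contra hno
    push Not at hno
    have hinj : Function.Injective (fun a => (T (ee i) a : symplecticGroup l F ⧸ N0)) := by
      intro a b h
      by_contra hne
      exact hno a b hne h
    have := Nat.card_le_card_of_injective _ hinj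
    rw [Nat.card_eq_fintype_card] at this
    change _ ≤ N0.index at this
    omega
  obtain ⟨a, b, hab, h⟩ := hpig
  rw [QuotientGroup.eq] at h
  have hTm : ∀ v a b, T v a * T v b = T v (a + b) := fun v a b => Subtype.ext (tv_mul v a b)
  have hT0 : ∀ v, T v 0 = 1 := fun v => Subtype.ext (tv_zero v)
  have hTi : ∀ v a, (T v a)⁻¹ = T v a := fun v a => by
    rw [inv_eq_iff_mul_eq_one, hTm, CharTwo.add_self_eq_zero, hT0]
  rw [hTi, hTm] at h
  have hc : a + b ≠ 0 := by
    intro h; apply hab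
    rw [← sub_eq_zero, CharTwo.sub_eq_add]; exact h
  set c0 := a + b
  have h2 : ∀ d, T (ee i) d ∈ N0 → ∀ w, w ≠ 0 → T w d ∈ N0 := by
    intro d hd w hw
    obtain ⟨g, hg⟩ := sp_trans w hw i
    have hn : N0.Normal := H.normalCore_normal
    have := hn.conj_mem _ hd g⁻¹
    convert this using 1
    refine Subtype.ext ?_
    have h4 := tv_conj g⁻¹ (ee i) d
    rw [← hg, mulVec_mulVec] at h4
    have h5 : ((g⁻¹ : symplecticGroup l F) : Matrix (l ⊕ l) (l ⊕ l) F) * g = 1 := by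
      rw [← Submonoid.coe_mul, inv_mul_cancel]; rfl
    rw [h5, one_mulVec] at h4
    rw [Submonoid.coe_mul, Submonoid.coe_mul]
    change tv w d = _ * tv (ee i) d * _
    rw [← hg, h4]
  have h3 : ∀ w d, T w d ∈ N0 := by
    intro w d
    by_cases hd : d = 0
    · rw [hd, hT0]; exact one_mem _
    by_cases hw : w = 0
    · have : T w d = 1 := Subtype.ext (by simp [T, hw, tv])
      rw [this]; exact one_mem _
    obtain ⟨e, he⟩ := char2_sqrt (d / c0)
    have he0 : e ≠ 0 := by
      rintro rfl
      have : d / c0 = 0 := by rw [← he]; simp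
      simp [hd, hc] at this
    have h6 := h2 c0 h (e • w) (smul_ne_zero he0 hw)
    have h7 : T (e • w) c0 = T w d := Subtype.ext (by
      change tv (e • w) c0 = tv w d
      rw [tv_smul, he, div_mul_cancel₀ _ hc])
    rwa [h7] at h6
  have h4 : N0 = ⊤ := by
    rw [eq_top_iff]
    rintro g -
    obtain ⟨L, -, hL⟩ := sp_gen g.1 g.2
    have : g = (L.map fun p => T p.1 p.2).prod := by
      apply Subtype.ext
      rw [hL, Submonoid.coe_list_prod, List.map_map]; rfl
    rw [this]
    refine Subgroup.list_prod_mem _ fun x hx => ?_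
    obtain ⟨p, -, rfl⟩ := List.mem_map.1 hx
    exact h3 _ _
  rw [eq_top_iff, ← h4]
  exact H.normalCore_le
end SG
end
section
namespace SG
set_option linter.all false
open Matrix
section
variable {n τ F : Type} [Fintype n] [DecidableEq n] [Field F]
def md (A : Matrix n n (MvPolynomial τ F)) (d : ℕ) : Prop := ∀ i j, (A i j).totalDegree ≤ d
theorem md_mono {A : Matrix n n (MvPolynomial τ F)} {d e : ℕ} (h : md A d) (hde : d ≤ e) : md A e := fun i j => (h i j).trans hde
theorem md_one : md (1 : Matrix n n (MvPolynomial τ F)) 0 := by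
  intro i j
  rw [Matrix.one_apply]; split_ifs <;> simp
theorem md_mul {A B : Matrix n n (MvPolynomial τ F)} {d e : ℕ} (hA : md A d) (hB : md B e) : md (A * B) (d + e) := by
  intro i j
  rw [Matrix.mul_apply]
  exact MvPolynomial.totalDegree_finsetSum_le fun k _ => (MvPolynomial.totalDegree_mul _ _).trans (add_le_add (hA _ _) (hB _ _))
theorem md_pow {A : Matrix n n (MvPolynomial τ F)} {d : ℕ} (hA : md A d) (k : ℕ) : md (A ^ k) (k * d) := by
  induction k with
  | zero => simpa using md_one
  | succ k ih => rw [pow_succ, add_mul, one_mul]; exact md_mul ih hA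
theorem md_list {L : List (Matrix n n (MvPolynomial τ F))} {d : ℕ} (hL : ∀ A ∈ L, md A d) : md L.prod (L.length * d) := by
  induction L with
  | nil => simpa using md_one
  | cons A L ih =>
    rw [List.prod_cons, List.length_cons, add_mul, one_mul, add_comm]
    exact md_mul (hL A (by simp)) (ih fun B hB => hL B (by simp [hB]))
theorem md_det {A : Matrix n n (MvPolynomial τ F)} {d : ℕ} (hA : md A d) : A.det.totalDegree ≤ Fintype.card n * d := by
  rw [Matrix.det_apply']
  refine MvPolynomial.totalDegree_finsetSum_le fun s _ => (MvPolynomial.totalDegree_mul _ _).trans ?_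
  have : ((((Equiv.Perm.sign s : ℤˣ) : ℤ)) : MvPolynomial τ F).totalDegree = 0 := by
    rw [← map_intCast (MvPolynomial.C : F →+* MvPolynomial τ F)]; exact MvPolynomial.totalDegree_C _
  rw [this, zero_add]
  refine (MvPolynomial.totalDegree_finsetProd _ _).trans ?_
  calc _ ≤ ∑ i : n, d := Finset.sum_le_sum fun i _ => hA _ _
    _ = _ := by simp
end
section
variable {l : Type} [Fintype l] [DecidableEq l]
def tvR {R : Type} [CommRing R] (v : l ⊕ l → R) (a : R) : Matrix (l ⊕ l) (l ⊕ l) R := 1 + a • vecMulVec v (Matrix.J l R *ᵥ v)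
theorem tvR_map {R S : Type} [CommRing R] [CommRing S] (f : R →+* S) (v : l ⊕ l → R) (a : R) :
    f.mapMatrix (tvR v a) = tvR (fun i => f (v i)) (f a) := by
  have hJ : ∀ i j, f (Matrix.J l R i j) = Matrix.J l S i j := by
    rintro (i|i) (j|j) <;> simp [Matrix.J, Matrix.one_apply] <;> split_ifs <;> simp
  ext i j
  simp only [tvR, RingHom.mapMatrix_apply, Matrix.map_apply, Matrix.add_apply, Matrix.smul_apply, vecMulVec_apply, mulVec, dotProduct, smul_eq_mul, map_add, map_mul, map_sum, hJ]
  congr 1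
  rw [Matrix.one_apply, Matrix.one_apply]; split_ifs <;> simp
theorem tvR_md {τ F : Type} [Field F] (v : l ⊕ l → MvPolynomial τ F) (a : MvPolynomial τ F) (ha : a.totalDegree ≤ 1) (hv : ∀ i, (v i).totalDegree ≤ 1) :
    md (tvR v a) 3 := by
  intro i j
  simp only [tvR, Matrix.add_apply, Matrix.smul_apply, vecMulVec_apply, mulVec, dotProduct, smul_eq_mul]
  refine (MvPolynomial.totalDegree_add _ _).trans (max_le ((md_one i j).trans (by norm_num)) ?_)
  refine (MvPolynomial.totalDegree_mul _ _).trans ?_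
  have h2 := MvPolynomial.totalDegree_mul (v i) (∑ x, Matrix.J l (MvPolynomial τ F) j x * v x)
  have h3 : (∑ x, Matrix.J l (MvPolynomial τ F) j x * v x).totalDegree ≤ 1 := by
    refine MvPolynomial.totalDegree_finsetSum_le fun x _ => (MvPolynomial.totalDegree_mul _ _).trans ?_
    have : (Matrix.J l (MvPolynomial τ F) j x).totalDegree = 0 := by
      rcases j with j|j <;> rcases x with x|x <;> simp [Matrix.J, Matrix.one_apply] <;> split_ifs <;> simp
    rw [this, zero_add]; exact hv x
  have := hv i
  omega
noncomputable def PP (N : ℕ) {R : Type} [CommRing R] (y : Matrix (l ⊕ l) (l ⊕ l) R) : R :=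
  (Matrix.of fun i j => ((y ^ (N * (Fintype.equivFin (l ⊕ l) j : ℕ))) *ᵥ (fun _ => 1)) i).det * (y - 1).det
theorem PP_map (N : ℕ) {R S : Type} [CommRing R] [CommRing S] (f : R →+* S) (y : Matrix (l ⊕ l) (l ⊕ l) R) :
    f (PP N y) = PP N (f.mapMatrix y) := by
  rw [PP, PP, map_mul, RingHom.map_det, RingHom.map_det, map_sub, map_one]
  congr 2
  ext i j
  simp only [RingHom.mapMatrix_apply, Matrix.map_apply, Matrix.of_apply]
  rw [RingHom.map_mulVec, ← RingHom.mapMatrix_apply, map_pow]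
  have h1 : (f ∘ fun _ : l ⊕ l => (1:R)) = fun _ => 1 := by funext k; simp
  rw [h1]
  rfl
theorem PP_deg (N : ℕ) {τ F : Type} [Field F] (y : Matrix (l ⊕ l) (l ⊕ l) (MvPolynomial τ F)) (d : ℕ) (hy : md y d) :
    (PP N y).totalDegree ≤ Fintype.card (l ⊕ l) * (N * Fintype.card (l ⊕ l) * d) + Fintype.card (l ⊕ l) * d := by
  rw [PP]
  refine (MvPolynomial.totalDegree_mul _ _).trans (add_le_add (md_det ?_) (md_det ?_))
  · intro i j
    rw [Matrix.of_apply, mulVec, dotProduct]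
    refine MvPolynomial.totalDegree_finsetSum_le fun k _ => (MvPolynomial.totalDegree_mul _ _).trans ?_
    have h := md_pow hy (N * (Fintype.equivFin (l ⊕ l) j : ℕ)) i k
    rw [MvPolynomial.totalDegree_one, add_zero]
    refine h.trans (Nat.mul_le_mul_right _ (Nat.mul_le_mul_left _ (Fin.is_lt _).le))
  · intro i j
    rw [Matrix.sub_apply]
    exact (MvPolynomial.totalDegree_sub _ _).trans (max_le (hy i j) ((md_one i j).trans (Nat.zero_le _)))
theorem exists_PP (N : ℕ) (hN : 0 < N) {K : Type} [Field K] [CharP K 2] [Infinite K] : ∃ y ∈ symplecticGroup l K, PP N y ≠ 0 := by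
  classical
  set M := N * (2 * Fintype.card l).factorial with hM
  have hMpos : 0 < M := Nat.mul_pos hN (Nat.factorial_pos _)
  obtain ⟨a, ha⟩ : ∃ a : K, a ∉ ((Polynomial.X ^ M - 1 : Polynomial K) * Polynomial.X).roots.toFinset := Infinite.exists_notMem_finset _
  have hne : (Polynomial.X ^ M - 1 : Polynomial K) * Polynomial.X ≠ 0 :=
    mul_ne_zero (Polynomial.X_pow_sub_C_ne_zero hMpos 1) Polynomial.X_ne_zero
  rw [Multiset.mem_toFinset, Polynomial.mem_roots hne] at ha
  simp only [Polynomial.IsRoot, Polynomial.eval_mul, Polynomial.eval_sub, Polynomial.eval_pow, Polynomial.eval_X, Polynomial.eval_one, mul_eq_zero, not_or] at ha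
  obtain ⟨ha1, ha0⟩ := ha
  rw [sub_eq_zero] at ha1
  have hk : ∀ k : ℤ, k ≠ 0 → |k| ≤ 2 * Fintype.card l → a ^ ((N : ℤ) * k) ≠ 1 := by
    intro k hk0 hk h
    apply ha1
    have hdvd : (k.natAbs) ∣ (2 * Fintype.card l).factorial := Nat.dvd_factorial (by omega) (by rw [Int.abs_eq_natAbs] at hk; omega)
    obtain ⟨c, hc⟩ := hdvd
    have h1 : a ^ ((N : ℤ) * k.natAbs) = 1 := by
      rcases Int.natAbs_eq k with h' | h'
      · rw [← h']; exact h
      · have : (N : ℤ) * (k.natAbs : ℤ) = -((N:ℤ) * k) := by rw [h']; simp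
        rw [this, _root_.zpow_neg, h, inv_one]
    have h2 : a ^ (N * k.natAbs) = 1 := by exact_mod_cast h1
    rw [hM, hc, ← mul_assoc, pow_mul, h2, one_pow]
  let z : l ⊕ l → ℤ := Sum.elim (fun i => ((Fintype.equivFin l i : ℕ) : ℤ) + 1) (fun i => -(((Fintype.equivFin l i : ℕ) : ℤ) + 1))
  have hzb : ∀ x, |z x| ≤ Fintype.card l ∧ z x ≠ 0 := by
    rintro (i | i) <;> simp only [z, Sum.elim_inl, Sum.elim_inr] <;> have := (Fintype.equivFin l i).is_lt <;> constructor <;> (try rw [abs_le]) <;> omega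
  have hzi : Function.Injective z := by
    rintro (i | i) (j | j) h <;> simp only [z, Sum.elim_inl, Sum.elim_inr] at h
    · congr 1; apply (Fintype.equivFin l).injective; apply Fin.ext; omega
    · omega
    · omega
    · congr 1; apply (Fintype.equivFin l).injective; apply Fin.ext; omega
  let lam : l ⊕ l → K := fun x => a ^ (z x)
  have hlz : ∀ x, lam x ≠ 0 := fun x => zpow_ne_zero _ ha0
  refine ⟨diagonal lam, ?_, ?_⟩
  · rw [SymplecticGroup.mem_iff]
    ext i j
    simp only [diagonal_transpose, diagonal_mul, mul_diagonal]
    have key : ∀ i : l, lam (Sum.inl i) * lam (Sum.inr i) = 1 := by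
      intro i; simp only [lam, z, Sum.elim_inl, Sum.elim_inr]
      rw [← zpow_add₀ ha0]; simp
    have key2 : ∀ i : l, lam (Sum.inr i) * lam (Sum.inl i) = 1 := by
      intro i; rw [mul_comm]; exact key i
    rcases i with i | i <;> rcases j with j | j <;> simp [Matrix.J, Matrix.one_apply]
    · split_ifs with h
      · subst h; exact key i
      · rfl
    · split_ifs with h
      · subst h; exact key2 i
      · rfl
  · rw [PP]
    refine mul_ne_zero ?_ ?_
    · set e := Fintype.equivFin (l ⊕ l)
      have : (Matrix.of fun i j => ((diagonal lam ^ (N * (e j : ℕ))) *ᵥ (fun _ => 1)) i)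
          = (vandermonde (fun i => lam (e.symm i) ^ N)).submatrix e e := by
        ext i j
        simp only [Matrix.of_apply, diagonal_pow, mulVec_diagonal, submatrix_apply, vandermonde_apply, Equiv.symm_apply_apply, mul_one, Pi.pow_apply, pow_mul]
      rw [this, det_submatrix_equiv_self, det_vandermonde_ne_zero_iff]
      intro i j hij
      apply e.symm.injective
      by_contra hne
      have hzne : z (e.symm i) - z (e.symm j) ≠ 0 := by
        rw [sub_ne_zero]; exact fun h => hne (hzi h)
      refine hk _ hzne ?_ ?_
      · have h1 := (hzb (e.symm i)).1
        have h2 := (hzb (e.symm j)).1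
        have := abs_sub (z (e.symm i)) (z (e.symm j))
        omega
      · simp only [lam] at hij
        rw [mul_sub, zpow_sub₀ ha0, div_eq_one_iff_eq (zpow_ne_zero _ ha0)]
        rw [← zpow_natCast, ← zpow_natCast, ← _root_.zpow_mul, ← _root_.zpow_mul] at hij
        rw [mul_comm (N:ℤ), mul_comm (N:ℤ)]; exact hij
    · rw [← diagonal_one, diagonal_sub, det_diagonal, Finset.prod_ne_zero_iff]
      intro x _
      rw [sub_ne_zero]
      intro h
      refine hk (z x) (hzb x).2 ?_ ?_
      · have := (hzb x).1; omega
      · rw [mul_comm, _root_.zpow_mul]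
        change (lam x) ^ (N:ℤ) = 1
        rw [h]; simp
end
end SG
end
section
namespace SG
set_option linter.all false
open Matrix
theorem sp_map {l F K : Type} [Fintype l] [DecidableEq l] [Field F] [Field K] (f : F →+* K) (A : Matrix (l ⊕ l) (l ⊕ l) F)
    (hA : A ∈ symplecticGroup l F) : f.mapMatrix A ∈ symplecticGroup l K := by
  exact SymplecticGroup.map_mem hA f
theorem count_generic (m N : ℕ) (hN : 0 < N) : ∃ C : ℕ, ∀ (F : Type) [Field F] [Fintype F] [CharP F 2],
    Fintype.card F * Nat.card {y : symplecticGroup (Fin m) F // PP N (y : Matrix (Fin m ⊕ Fin m) (Fin m ⊕ Fin m) F) = 0} ≤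
      C * Nat.card (symplecticGroup (Fin m) F) := by
  classical
  set n := Fin m ⊕ Fin m with hn
  refine ⟨Fintype.card n * (N * Fintype.card n * (4 * m * 3)) + Fintype.card n * (4 * m * 3), ?_⟩
  intro F _ _ _
  set B := Fintype.card n * (N * Fintype.card n * (4 * m * 3)) + Fintype.card n * (4 * m * 3) with hB
  let τ := Fin (4 * m) × Option n
  set M := Fintype.card τ with hM
  let e : τ ≃ Fin M := Fintype.equivFin τ
  let R := MvPolynomial (Fin M) F
  let Y : Matrix n n R := (List.ofFn fun k : Fin (4 * m) => tvR (fun j => (MvPolynomial.X (e (k, some j)) : R)) (MvPolynomial.X (e (k, none)))).prod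
  have hYdeg : md Y (4 * m * 3) := by
    have := md_list (L := List.ofFn fun k : Fin (4 * m) => tvR (fun j => (MvPolynomial.X (e (k, some j)) : R)) (MvPolynomial.X (e (k, none)))) (d := 3) (by
      intro A hA
      obtain ⟨k, rfl⟩ := (List.mem_ofFn' _ _).1 hA
      exact tvR_md _ _ (by simp) (by simp))
    simpa using this
  have hYmap : ∀ {S : Type} [CommRing S] (f : R →+* S), f.mapMatrix Y =
      (List.ofFn fun k : Fin (4 * m) => tvR (fun j => f (MvPolynomial.X (e (k, some j)))) (f (MvPolynomial.X (e (k, none))))).prod := by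
    intro S _ f
    rw [map_list_prod, List.map_ofFn]
    congr 2
    funext k
    rw [Function.comp_apply, tvR_map]
  let K := AlgebraicClosure F
  have : CharP K 2 := charP_of_injective_algebraMap (algebraMap F K).injective 2
  let Cg : (symplecticGroup (Fin m) F) → Matrix n n R := fun g => (MvPolynomial.C : F →+* R).mapMatrix (g : Matrix n n F)
  let P : (symplecticGroup (Fin m) F) → R := fun g => PP N (Cg g * Y)
  have hPdeg : ∀ g, (P g).totalDegree ≤ B := by
    intro g
    refine PP_deg N _ _ ?_
    have h0 : md (Cg g) 0 := fun i j => by simp [Cg]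
    simpa using md_mul h0 hYdeg
  have hPne : ∀ g, P g ≠ 0 := by
    intro g hg
    obtain ⟨y0, hy0, hPy⟩ := exists_PP (l := Fin m) N hN (K := K)
    have hgK : (algebraMap F K).mapMatrix ((g⁻¹ : (symplecticGroup (Fin m) F)) : Matrix n n F) ∈ symplecticGroup (Fin m) K := sp_map (algebraMap F K) _ (g⁻¹ : (symplecticGroup (Fin m) F)).2
    obtain ⟨L, hL, hLe⟩ := sp_gen _ (mul_mem hgK hy0)
    rw [Fintype.card_fin] at hL
    let t : Fin M → K := fun x => match e.symm x with
      | (k, some j) => (L.get (k.cast hL.symm)).1 j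
      | (k, none) => (L.get (k.cast hL.symm)).2
    have ht1 : ∀ k j, t (e (k, some j)) = (L.get (k.cast hL.symm)).1 j := fun k j => by simp [t]
    have ht2 : ∀ k, t (e (k, none)) = (L.get (k.cast hL.symm)).2 := fun k => by simp [t]
    let f : R →+* K := (MvPolynomial.aeval (R := F) t).toRingHom
    have hfX : ∀ i, f (MvPolynomial.X i) = t i := fun i => MvPolynomial.aeval_X _ _
    have h1 : f.mapMatrix Y = (L.map fun p => tv p.1 p.2).prod := by
      rw [hYmap]
      congr 1
      simp only [hfX, ht1, ht2]
      apply List.ext_get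
      · simp [hL]
      · intro i h1 h2
        simp only [List.get_eq_getElem, List.getElem_map, List.getElem_ofFn]
        rfl
    have h2 : f.mapMatrix (Cg g) = (algebraMap F K).mapMatrix (g : Matrix n n F) := by
      ext i j
      simp only [Cg, RingHom.mapMatrix_apply, Matrix.map_apply]
      exact MvPolynomial.aeval_C _ _
    apply hPy
    have h3 : f (P g) = 0 := by rw [hg, map_zero]
    rw [PP_map, map_mul, h1, h2, ← hLe, ← mul_assoc, ← map_mul] at h3
    have h4 : g.1 * ((g⁻¹ : (symplecticGroup (Fin m) F)) : Matrix n n F) = 1 := by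
      rw [← Submonoid.coe_mul, mul_inv_cancel]; rfl
    rwa [h4, map_one, one_mul] at h3
  have hSZ : ∀ g, Fintype.card F * (Finset.univ.filter fun t : Fin M → F => MvPolynomial.eval t (P g) = 0).card ≤ B * Fintype.card F ^ M := by
    intro g
    have h := MvPolynomial.schwartz_zippel_totalDegree (hPne g) (Finset.univ : Finset F)
    rw [Fintype.piFinset_univ, Finset.card_univ] at h
    have hq : (0 : ℚ≥0) < Fintype.card F := by exact_mod_cast Fintype.card_pos
    rw [div_le_div_iff₀ (pow_pos hq _) hq] at h
    have h' : (Finset.univ.filter fun t : Fin M → F => MvPolynomial.eval t (P g) = 0).card * Fintype.card F ≤ (P g).totalDegree * Fintype.card F ^ M := by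
      exact_mod_cast h
    calc _ = _ := mul_comm _ _
      _ ≤ _ := h'
      _ ≤ _ := Nat.mul_le_mul_right _ (hPdeg g)
  -- evaluated Y
  let yt : (Fin M → F) → (symplecticGroup (Fin m) F) := fun t => ⟨(MvPolynomial.eval t).mapMatrix Y, by
    rw [hYmap]
    refine Submonoid.list_prod_mem _ fun A hA => ?_
    obtain ⟨k, rfl⟩ := (List.mem_ofFn' _ _).1 hA
    exact tv_mem _ _⟩
  have hev : ∀ t g, MvPolynomial.eval t (P g) = PP N ((g * yt t : (symplecticGroup (Fin m) F)) : Matrix n n F) := by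
    intro t g
    rw [PP_map, map_mul, Submonoid.coe_mul]
    congr 2
    ext i j
    simp [Cg]
  have hfG : Fintype (symplecticGroup (Fin m) F) := Fintype.ofFinite _
  set Z : Finset (symplecticGroup (Fin m) F) := Finset.univ.filter fun y : (symplecticGroup (Fin m) F) => PP N y.1 = 0 with hZ
  have hZc : Nat.card {y : (symplecticGroup (Fin m) F) // PP N y.1 = 0} = Z.card := by
    rw [Nat.card_eq_fintype_card, Fintype.card_subtype]
  have hcount : ∀ t, (Finset.univ.filter fun g : (symplecticGroup (Fin m) F) => MvPolynomial.eval t (P g) = 0).card = Z.card := by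
    intro t
    refine Finset.card_bij (fun g _ => g * yt t) ?_ ?_ ?_
    · intro g hg
      simp only [Finset.mem_filter, Finset.mem_univ, true_and, hev, hZ] at hg ⊢
      exact hg
    · intro a _ b _ h; exact mul_right_cancel h
    · intro b hb
      refine ⟨b * (yt t)⁻¹, ?_, by simp⟩
      simp only [Finset.mem_filter, Finset.mem_univ, true_and, hev, hZ] at hb ⊢
      rwa [inv_mul_cancel_right]
  have hdouble : ∑ g : (symplecticGroup (Fin m) F), (Finset.univ.filter fun t : Fin M → F => MvPolynomial.eval t (P g) = 0).card
      = ∑ t : Fin M → F, (Finset.univ.filter fun g : (symplecticGroup (Fin m) F) => MvPolynomial.eval t (P g) = 0).card := by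
    simp only [Finset.card_filter]
    exact Finset.sum_comm
  have hR : ∑ t : Fin M → F, (Finset.univ.filter fun g : (symplecticGroup (Fin m) F) => MvPolynomial.eval t (P g) = 0).card = Fintype.card F ^ M * Z.card := by
    simp only [hcount, Finset.sum_const, Finset.card_univ, smul_eq_mul]
    simp
  have hLs : Fintype.card F * ∑ g : (symplecticGroup (Fin m) F), (Finset.univ.filter fun t : Fin M → F => MvPolynomial.eval t (P g) = 0).card ≤ Fintype.card (symplecticGroup (Fin m) F) * (B * Fintype.card F ^ M) := by
    rw [Finset.mul_sum]
    calc _ ≤ ∑ g : (symplecticGroup (Fin m) F), B * Fintype.card F ^ M := Finset.sum_le_sum fun g _ => hSZ g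
      _ = _ := by simp
  rw [hdouble, hR] at hLs
  rw [hZc, Nat.card_eq_fintype_card]
  have hpos : 0 < Fintype.card F ^ M := pow_pos Fintype.card_pos _
  refine Nat.le_of_mul_le_mul_right ?_ hpos
  calc _ = Fintype.card F * (Fintype.card F ^ M * Z.card) := by ring
    _ ≤ _ := hLs
    _ = _ := by ring
end SG
end
section
namespace SG
set_option linter.all false
open Matrix
abbrev Tri (n : Type) [Fintype n] : Type := {p : n × n // Fintype.equivFin n p.1 ≤ Fintype.equivFin n p.2}
theorem sub_one_eq {n F : Type} [Fintype n] [DecidableEq n] [Field F] [CharP F 2] {J : Matrix n n F} (hJ : Sy J) (A : Matrix n n F)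
    (hA : A * adj J A = 1) (hdet : IsUnit (A - 1).det) : (A - 1)⁻¹ * J + ((A - 1)⁻¹ * J)ᵀ = J := by
  set C := A - 1 with hC
  have hneg : ∀ A : Matrix n n F, -A = A := fun A => by ext i j; exact CharTwo.neg_eq _
  have hsub : ∀ A B : Matrix n n F, A - B = A + B := fun A B => by ext i j; exact CharTwo.sub_eq_add _ _
  have hC1 : adj J C = adj J A - 1 := by
    rw [hC, hsub, adj_add, adj_one hJ, hsub]
  have h1 : C * adj J C = -(C + adj J C) := by
    rw [hC1, hC]
    have : (A - 1) * (adj J A - 1) = A * adj J A - A - adj J A + 1 := by noncomm_ring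
    rw [this, hA]; abel
  set B := C⁻¹ with hB
  have hBC : B * C = 1 := nonsing_inv_mul _ hdet
  have hCB : C * B = 1 := mul_nonsing_inv _ hdet
  have hCB' : adj J C * adj J B = 1 := by rw [← adj_mul hJ, hBC, adj_one hJ]
  have h2 : adj J B + B = 1 := by
    calc adj J B + B = (B * C) * adj J B + B * (adj J C * adj J B) := by rw [hBC, hCB', one_mul, mul_one]
      _ = B * (C + adj J C) * adj J B := by noncomm_ring
      _ = B * (C * adj J C) * adj J B := by rw [h1, hneg]
      _ = (B * C) * (adj J C * adj J B) := by noncomm_ring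
      _ = 1 := by rw [hBC, hCB', one_mul]
  rw [transpose_mul, hJ.symm]
  have h3 := congrArg (fun M => M * J) h2
  simp only [add_mul, one_mul, adj] at h3
  rw [mul_assoc _ J J, hJ.sq, mul_one] at h3
  rw [add_comm]; exact h3
theorem card_sp_le (m : ℕ) : ∃ q0 : ℕ, ∀ (F : Type) [Field F] [Fintype F] [CharP F 2], q0 ≤ Fintype.card F →
    Nat.card (symplecticGroup (Fin m) F) ≤ 2 * Fintype.card F ^ Fintype.card (Tri (Fin m ⊕ Fin m)) := by
  classical
  obtain ⟨C, hC⟩ := count_generic m 1 one_pos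
  refine ⟨2 * C, ?_⟩
  intro F _ _ _ hq
  have h := hC F
  set n := Fin m ⊕ Fin m
  have hfG : Fintype (symplecticGroup (Fin m) F) := Fintype.ofFinite _
  set a := Nat.card {y : symplecticGroup (Fin m) F // PP 1 y.1 = 0} with ha
  set b := Nat.card {y : symplecticGroup (Fin m) F // ¬ PP 1 y.1 = 0} with hb
  have hab : a + b = Nat.card (symplecticGroup (Fin m) F) := by
    rw [ha, hb, ← Nat.card_sum]
    exact Nat.card_congr (Equiv.sumCompl _)
  have hbq : b ≤ Fintype.card F ^ Fintype.card (Tri n) := by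
    have hdet : ∀ y : {y : symplecticGroup (Fin m) F // ¬ PP 1 y.1 = 0}, IsUnit ((y.1 : Matrix n n F) - 1).det := by
      intro y
      have := y.2
      rw [PP, mul_eq_zero, not_or] at this
      exact isUnit_iff_ne_zero.2 this.2
    let f : {y : symplecticGroup (Fin m) F // ¬ PP 1 y.1 = 0} → (Tri n → F) :=
      fun y p => (((y.1 : Matrix n n F) - 1)⁻¹ * Matrix.J (Fin m) F) p.1.1 p.1.2
    have hf : Function.Injective f := by
      intro y y' hyy
      have e1 := sub_one_eq sy_J _ (mem_sp.1 y.1.2) (hdet y)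
      have e2 := sub_one_eq sy_J _ (mem_sp.1 y'.1.2) (hdet y')
      set X := ((y.1 : Matrix n n F) - 1)⁻¹ * Matrix.J (Fin m) F with hX
      set X' := ((y'.1 : Matrix n n F) - 1)⁻¹ * Matrix.J (Fin m) F with hX'
      have hle : ∀ i j, Fintype.equivFin n i ≤ Fintype.equivFin n j → X i j = X' i j := fun i j hij =>
        congrFun hyy ⟨(i, j), hij⟩
      have hXX : X = X' := by
        ext i j
        rcases le_total (Fintype.equivFin n i) (Fintype.equivFin n j) with hij | hij
        · exact hle i j hij
        · have a1 := congrFun (congrFun e1 i) j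
          have a2 := congrFun (congrFun e2 i) j
          rw [Matrix.add_apply, transpose_apply] at a1 a2
          rw [← a2, hle j i hij] at a1
          exact add_right_cancel a1
      have hBB : ((y.1 : Matrix n n F) - 1)⁻¹ = ((y'.1 : Matrix n n F) - 1)⁻¹ := by
        have := congrArg (fun M => M * Matrix.J (Fin m) F) hXX
        simp only [hX, hX', mul_assoc, (sy_J (l := Fin m) (K := F)).sq, mul_one] at this
        exact this
      have h5 : (y.1 : Matrix n n F) - 1 = (y'.1 : Matrix n n F) - 1 := by
        rw [← nonsing_inv_nonsing_inv _ (hdet y), hBB, nonsing_inv_nonsing_inv _ (hdet y')]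
      exact Subtype.ext (Subtype.ext (sub_left_inj.1 h5))
    have := Nat.card_le_card_of_injective f hf
    rw [Nat.card_fun, Nat.card_eq_fintype_card (α := F), Nat.card_eq_fintype_card (α := Tri n)] at this
    exact this
  have : 2 * a ≤ Nat.card (symplecticGroup (Fin m) F) := by
    rcases Nat.eq_zero_or_pos C with h0 | h0
    · rw [h0, zero_mul] at h
      have : a = 0 := by
        have hp : 0 < Fintype.card F := Fintype.card_pos
        rcases Nat.mul_eq_zero.1 (Nat.le_zero.1 h) with h' | h'
        · omega
        · exact h'
      omega
    · refine Nat.le_of_mul_le_mul_left ?_ h0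
      calc C * (2 * a) = (2 * C) * a := by ring
        _ ≤ Fintype.card F * a := Nat.mul_le_mul_right _ hq
        _ ≤ _ := h
  change _ ≤ 2 * Fintype.card F ^ Fintype.card (Tri n)
  omega
end SG
end
section
namespace SG
set_option linter.all false
open Matrix
section lie
variable {n K : Type} [Fintype n] [DecidableEq n] [Field K]
/-- Hadamard multipliers preserving `M` -/
def Had (M : Submodule K (Matrix n n K)) : Subalgebra K (n → n → K) where
  carrier := {f | ∀ z ∈ M, (Matrix.of fun i j => f i j * z i j) ∈ M}
  mul_mem' := by
    intro f g hf hg z hz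
    have := hf _ (hg z hz)
    convert this using 2
    ext i j; simp [mul_assoc]
  add_mem' := by
    intro f g hf hg z hz
    have := M.add_mem (hf z hz) (hg z hz)
    convert this using 1
    ext i j; simp [add_mul]
  algebraMap_mem' := by
    intro c z hz
    have := M.smul_mem c hz
    convert this using 1
    ext i j; simp [Pi.algebraMap_apply]
theorem aeval_mem_aux {A : Type} [CommRing A] [Algebra K A] (S : Subalgebra K A) {a : A} (h : a ∈ S) (p : Polynomial K) :
    Polynomial.aeval a p ∈ S := by
  have := Polynomial.aeval_mem_adjoin_singleton (p := p) K a
  exact Algebra.adjoin_le (by simpa using h) this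
theorem had_weight (M : Submodule K (Matrix n n K)) (lam : n → K) (h0 : ∀ i, lam i ≠ 0)
    (hx : ∀ z ∈ M, diagonal lam * z * diagonal (fun i => (lam i)⁻¹) ∈ M) (f : K → K) :
    (fun i j => f (lam i * (lam j)⁻¹)) ∈ Had M := by
  classical
  have h1 : (fun i j => lam i * (lam j)⁻¹) ∈ Had M := by
    intro z hz
    convert hx z hz using 1
    ext i j
    simp [diagonal_mul, mul_diagonal]; ring
  let s : Finset K := Finset.univ.image (fun p : n × n => lam p.1 * (lam p.2)⁻¹)
  let p : Polynomial K := Lagrange.interpolate s id f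
  have h2 : Polynomial.aeval (fun i j => lam i * (lam j)⁻¹ : n → n → K) p ∈ Had M :=
    aeval_mem_aux (Had M) h1 p
  convert h2 using 1
  ext i j
  have h3 : ∀ (p : Polynomial K), Polynomial.aeval (fun i j => lam i * (lam j)⁻¹ : n → n → K) p i j = p.eval (lam i * (lam j)⁻¹) := by
    intro p
    let φ : (n → n → K) →ₐ[K] K := (Pi.evalAlgHom K (fun _ => K) j).comp (Pi.evalAlgHom K (fun _ => n → K) i)
    have := Polynomial.aeval_algHom_apply φ (fun i j => lam i * (lam j)⁻¹ : n → n → K) p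
    refine this.symm.trans ?_
    rw [← Polynomial.coe_aeval_eq_eval]; rfl
  rw [h3]
  exact (Lagrange.eval_interpolate_at_node (r := f) (s := s) (v := id) (fun a _ b _ h => h) (i := lam i * (lam j)⁻¹)
    (Finset.mem_image.2 ⟨(i, j), Finset.mem_univ _, rfl⟩)).symm
theorem had_diag [CharP K 2] (M : Submodule K (Matrix n n K)) (d : n → K)
    (hx : ∀ z ∈ M, diagonal d * z + z * diagonal d ∈ M) :
    (fun i j => d i + d j) ∈ Had M := by
  intro z hz
  convert hx z hz using 1
  ext i j
  simp [diagonal_mul, mul_diagonal]; ring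
/-- block indicator -/
def bl (σ : n → n) (k : n) : n → K := fun i => if i = k ∨ i = σ k then 1 else 0
variable [CharP K 2] (M : Submodule K (Matrix n n K)) (lam : n → K) (h0 : ∀ i, lam i ≠ 0) (hinj : Function.Injective lam)
    (hx : ∀ z ∈ M, diagonal lam * z * diagonal (fun i => (lam i)⁻¹) ∈ M)
    (σ : n → n) (hσ : ∀ i, σ (σ i) = i) (hσ1 : ∀ i, σ i ≠ i) (hls : ∀ i, lam (σ i) = (lam i)⁻¹)
    (a : n) (he : ∀ k, k ≠ a → k ≠ σ a → ∀ z ∈ M, diagonal (bl σ k) * z + z * diagonal (bl σ k) ∈ M)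
def inB (σ : n → n) (k i : n) : Prop := i = k ∨ i = σ k
theorem block_logic {B : Type} {bi bj ba bp bq : B} (hij : bj ≠ bi)
    (fp : bp ≠ bi ∧ bp ≠ bj ∧ bp ≠ ba → (bp = bp ↔ bq = bp))
    (fq : bq ≠ bi ∧ bq ≠ bj ∧ bq ≠ ba → (bp = bq ↔ bq = bq))
    (fi : bi ≠ ba → (bp = bi ↔ ¬bq = bi)) (fj : bj ≠ ba → (bp = bj ↔ ¬bq = bj)) :
    (bp = bj ∧ bq = bi) ∨ (bq = bj ∧ bp = bi) := by
  by_cases h1 : bi = ba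
  · subst h1
    have := fj hij
    by_cases h2 : bp = bj
    · by_cases h3 : bq = bi
      · exact Or.inl ⟨h2, h3⟩
      · exact absurd ((fq ⟨h3, this.1 h2, h3⟩).2 rfl) (fun h => this.1 h2 (h ▸ h2))
    · have h4 : bq = bj := by by_contra h; exact h2 (this.2 h)
      by_cases h3 : bp = bi
      · exact Or.inr ⟨h4, h3⟩
      · exact absurd ((fp ⟨h3, h2, h3⟩).1 rfl) (fun h => h2 (h ▸ h4))
  · have g1 := fi h1
    by_cases h2 : bj = ba
    · subst h2
      by_cases h3 : bp = bi
      · by_cases h4 : bq = bj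
        · exact Or.inr ⟨h4, h3⟩
        · exact absurd ((fq ⟨g1.1 h3, h4, h4⟩).2 rfl) (fun h => g1.1 h3 (h ▸ h3))
      · have h4 : bq = bi := by by_contra h; exact h3 (g1.2 h)
        by_cases h5 : bp = bj
        · exact Or.inl ⟨h5, h4⟩
        · exact absurd ((fp ⟨h3, h5, h5⟩).1 rfl) (fun h => h3 (h ▸ h4))
    · have g2 := fj h2
      grind
theorem lam_sq (hσ1 : ∀ i, σ i ≠ i) (hinj : Function.Injective lam) (h0 : ∀ i, lam i ≠ 0)
   (hls : ∀ i, lam (σ i) = (lam i)⁻¹) {i j : n} (h : lam i * lam i = lam j * lam j) : i = j := by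
  apply hinj
  have : (lam i + lam j) * (lam i + lam j) = 0 := by
    have h2 : (2:K) = 0 := CharTwo.two_eq_zero
    linear_combination h + (lam i * lam j + lam j * lam j)* h2
  have := mul_self_eq_zero.1 this
  exact CharTwo.add_eq_zero.1 this
theorem lam_one (hσ1 : ∀ i, σ i ≠ i) (hinj : Function.Injective lam) (h0 : ∀ i, lam i ≠ 0)
   (hls : ∀ i, lam (σ i) = (lam i)⁻¹) {i : n} (h : lam i * lam i = 1) : False := by
  apply hσ1 i
  apply hinj
  rw [hls]
  exact inv_eq_of_mul_eq_one_left h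
include h0 hinj hx hσ hσ1 hls he in
theorem had_pair {i j : n} (h1 : j ≠ i) (h2 : j ≠ σ i) :
    (fun p q => if (p = j ∧ q = i) ∨ (p = σ i ∧ q = σ j) then (1:K) else 0) ∈ Had M := by
  classical
  have hb : ∀ k, k ≠ a → k ≠ σ a → (fun p q => bl σ k p + bl σ k q : n → n → K) ∈ Had M := fun k hk hk' =>
    had_diag M _ (he k hk hk')
  let S := Finset.univ.filter (fun k : n => k ≠ i ∧ k ≠ σ i ∧ k ≠ j ∧ k ≠ σ j ∧ k ≠ a ∧ k ≠ σ a)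
  let T := ({i, j} : Finset n).filter (fun k => k ≠ a ∧ k ≠ σ a)
  have hS : (∏ k ∈ S, (1 + fun p q => bl σ k p + bl σ k q) : n → n → K) ∈ Had M := by
    refine Subalgebra.prod_mem _ fun k hk => ?_
    simp only [S, Finset.mem_filter] at hk
    exact Subalgebra.add_mem _ (Subalgebra.one_mem _) (hb k hk.2.2.2.2.2.1 hk.2.2.2.2.2.2)
  have hT : (∏ k ∈ T, (fun p q => bl σ k p + bl σ k q) : n → n → K) ∈ Had M := by
    refine Subalgebra.prod_mem _ fun k hk => ?_
    simp only [T, Finset.mem_filter] at hk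
    exact hb k hk.2.1 hk.2.2
  have hW := had_weight M lam h0 hx (fun w => if w = lam j * (lam i)⁻¹ then 1 else 0)
  convert Subalgebra.mul_mem _ (Subalgebra.mul_mem _ hS hT) hW using 1
  ext p q
  simp only [Pi.mul_apply, Finset.prod_apply, Pi.add_apply, Pi.one_apply]
  have hinjσ : ∀ x y, σ x = σ y → x = y := fun x y h => by rw [← hσ x, h, hσ]
  have bl1 : ∀ k p, (p = k ∨ p = σ k) → bl σ k p = (1:K) := fun k p h => by rw [bl, if_pos h]
  have bl0 : ∀ k p, ¬ (p = k ∨ p = σ k) → bl σ k p = (0:K) := fun k p h => by rw [bl, if_neg h]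
  have h11 : (1:K) + 1 = 0 := CharTwo.add_self_eq_zero 1
  split_ifs with hpq hw hw
  · symm
    rw [mul_one]
    have e1 : ∀ k ∈ S, (1:K) + (bl σ k p + bl σ k q) = 1 := by
      intro k hk
      simp only [S, Finset.mem_filter] at hk
      rw [bl0 k p, bl0 k q] <;> grind
    have e2 : ∀ k ∈ T, (bl σ k p + bl σ k q : K) = 1 := by
      intro k hk
      simp only [T, Finset.mem_filter, Finset.mem_insert, Finset.mem_singleton] at hk
      by_cases hkp : p = k ∨ p = σ k
      · rw [bl1 k p hkp, bl0 k q, add_zero]; grind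
      · rw [bl0 k p hkp, bl1 k q, zero_add]; grind
    rw [Finset.prod_congr rfl e1, Finset.prod_congr rfl e2]; simp
  · exfalso
    apply hw
    rcases hpq with ⟨rfl, rfl⟩ | ⟨rfl, rfl⟩
    · rfl
    · rw [hls, hls, inv_inv, mul_comm]
  · symm
    rw [mul_one]
    by_contra hne
    have hne1 := fun k hk => Finset.prod_ne_zero_iff.1 (left_ne_zero_of_mul hne) k hk
    have hne2 := fun k hk => Finset.prod_ne_zero_iff.1 (right_ne_zero_of_mul hne) k hk
    -- not exactly one in block k for k ∈ S
    have f1 : ∀ k ∈ S, ((p = k ∨ p = σ k) ↔ (q = k ∨ q = σ k)) := by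
      intro k hk
      have := hne1 k hk
      constructor
      · intro h; by_contra h'; apply this; rw [bl1 k p h, bl0 k q h', add_zero, h11]
      · intro h; by_contra h'; apply this; rw [bl1 k q h, bl0 k p h', zero_add, h11]
    have f2 : ∀ k ∈ T, ((p = k ∨ p = σ k) ↔ ¬ (q = k ∨ q = σ k)) := by
      intro k hk
      have := hne2 k hk
      constructor
      · intro h h'; apply this; rw [bl1 k p h, bl1 k q h', h11]
      · intro h; by_contra h'; apply this; rw [bl0 k p h', bl0 k q h, zero_add]
    simp only [S, T, Finset.mem_filter, Finset.mem_univ, true_and, Finset.mem_insert, Finset.mem_singleton] at f1 f2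
    have hcases : ((p = j ∨ p = σ j) ∧ (q = i ∨ q = σ i)) ∨ ((q = j ∨ q = σ j) ∧ (p = i ∨ p = σ i)) := by
      let β : n → Sym2 n := fun p => s(p, σ p)
      have hβ : ∀ p k, (p = k ∨ p = σ k) ↔ β p = β k := by
        intro p k
        simp only [β, Sym2.eq_iff]
        constructor
        · rintro (rfl | rfl)
          · simp
          · simp [hσ]
        · rintro (⟨h, _⟩ | ⟨h, _⟩)
          · exact Or.inl h
          · exact Or.inr h
      have hne' : ∀ p k, (p ≠ k ∧ p ≠ σ k) ↔ β p ≠ β k := by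
        intro p k; rw [Ne, Ne, ← not_or, hβ]
      have hij : β j ≠ β i := (hne' j i).1 ⟨h1, h2⟩
      simp only [hβ] at f1 f2 ⊢
      simp only [← and_assoc, hne'] at f1 f2
      simp only [and_assoc, hne'] at f1 f2
      have fi := f2 i
      have fj := f2 j
      have fp := f1 p
      have fq := f1 q
      generalize β i = bi at *
      generalize β j = bj at *
      generalize β a = ba at *
      generalize hbp : β p = bp at *
      generalize hbq : β q = bq at *
      clear f1 f2 hne hne1 hne2
      simp only [true_or, or_true, true_and] at fi fj
      clear hne' hβ hW hT hS hb bl1 bl0 hx he hpq hw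
      exact block_logic hij fp fq fi fj
    have key1 : lam p * lam i = lam j * lam q := by
      field_simp [h0] at hw
      linear_combination hw
    have hn := fun {i j} => lam_sq (lam := lam) σ hσ1 hinj h0 hls (i := i) (j := j)
    have hn1 := fun {i} => lam_one (lam := lam) σ hσ1 hinj h0 hls (i := i)
    have hj0 := h0 j
    have hi0 := h0 i
    apply hpq
    rcases hcases with ⟨rfl | rfl, rfl | rfl⟩ | ⟨rfl | rfl, rfl | rfl⟩
    · exact Or.inl ⟨rfl, rfl⟩
    · exfalso; rw [hls] at key1; apply hn1 (i := i); field_simp at key1; linear_combination key1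
    · exfalso; rw [hls] at key1; apply hn1 (i := j); field_simp at key1; linear_combination -key1
    · exfalso; rw [hls, hls] at key1; apply h1; apply hn; field_simp at key1; linear_combination -key1
    · exfalso; apply h1; apply hn; linear_combination -key1
    · exfalso; rw [hls] at key1; apply hn1 (i := q); field_simp at key1; linear_combination -key1
    · exfalso; rw [hls] at key1; apply hn1 (i := p); field_simp at key1; linear_combination key1
    · exact Or.inr ⟨rfl, rfl⟩
  · simp
end lie
end SG
end
section
namespace SG
set_option linter.all false
open Matrix
section lie2
variable {n K : Type} [Fintype n] [DecidableEq n] [Field K]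
theorem lemmaZ (y : (Matrix n n K)ˣ) (D : Set (Matrix n n K)) (hD : ∀ d ∈ D, ∃ g, d = diagonal g)
    (hy : ∀ d ∈ D, y.1 * d * (y⁻¹).1 ∈ D) (d : Matrix n n K) (hd : d ∈ D) :
    ∃ k, 0 < k ∧ k ≤ Fintype.card n ^ Fintype.card n ∧ Commute d (y.1 ^ k) := by
  have hk : ∀ k : ℕ, ((y ^ k : (Matrix n n K)ˣ) : Matrix n n K) * d * (((y ^ k)⁻¹ : (Matrix n n K)ˣ) : Matrix n n K) ∈ D := by
    intro k
    induction k with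
    | zero => simpa using hd
    | succ k ih =>
      have := hy _ ih
      convert this using 1
      rw [pow_succ', _root_.mul_inv_rev, Units.val_mul, Units.val_mul]
      simp only [mul_assoc]
  obtain ⟨g, hg⟩ := hD d hd
  have h1 : ∀ k : ℕ, ∃ t : n → n, ((y ^ k : (Matrix n n K)ˣ) : Matrix n n K) * d * (((y ^ k)⁻¹ : (Matrix n n K)ˣ) : Matrix n n K) = diagonal (g ∘ t) := by
    intro k
    obtain ⟨f, hf⟩ := hD _ (hk k)
    have h2 : ((y ^ k : (Matrix n n K)ˣ) : Matrix n n K) * d = diagonal f * ((y ^ k : (Matrix n n K)ˣ) : Matrix n n K) := by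
      rw [← hf, mul_assoc, mul_assoc, Units.inv_mul, mul_one]
    have h3 : ∀ i, ∃ j, f i = g j := by
      intro i
      have : ∃ j, ((y ^ k : (Matrix n n K)ˣ) : Matrix n n K) i j ≠ 0 := by
        by_contra hcon
        push Not at hcon
        have h4 := congrFun (congrFun (Units.mul_inv (y ^ k)) i) i
        rw [Matrix.mul_apply, Matrix.one_apply_eq] at h4
        simp [hcon] at h4
      obtain ⟨j, hj⟩ := this
      refine ⟨j, ?_⟩
      have h4 := congrFun (congrFun h2 i) j
      rw [hg, mul_diagonal, diagonal_mul, mul_comm] at h4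
      exact (mul_right_cancel₀ hj h4).symm
    choose t ht using h3
    exact ⟨t, by rw [hf]; congr 1; ext i; exact ht i⟩
  choose t ht using h1
  have hcard : Fintype.card (n → n) < Fintype.card (Fin (Fintype.card n ^ Fintype.card n + 1)) := by
    rw [Fintype.card_fin, Fintype.card_fun]; omega
  obtain ⟨k, l, hkl, he⟩ := Fintype.exists_ne_map_eq_of_card_lt (fun k : Fin (Fintype.card n ^ Fintype.card n + 1) => t k) hcard
  wlog hlt : k < l generalizing k l
  · exact this l k hkl.symm he.symm (lt_of_le_of_ne (not_lt.1 hlt) hkl.symm)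
  have hlt' : (k : ℕ) < l := hlt
  refine ⟨l - k, by omega, by omega, ?_⟩
  have he' : t k = t l := he
  have h5 : ((y ^ (k:ℕ) : (Matrix n n K)ˣ) : Matrix n n K) * d * (((y ^ (k:ℕ))⁻¹ : (Matrix n n K)ˣ) : Matrix n n K) =
    ((y ^ (l:ℕ) : (Matrix n n K)ˣ) : Matrix n n K) * d * (((y ^ (l:ℕ))⁻¹ : (Matrix n n K)ˣ) : Matrix n n K) := by
    rw [ht, ht, he']
  have h6 : y ^ (l:ℕ) = y ^ (k:ℕ) * y ^ ((l:ℕ) - k) := by rw [← pow_add]; congr 1; omega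
  rw [h6, _root_.mul_inv_rev, Units.val_mul, Units.val_mul] at h5
  have h7 := congrArg (fun A => (((y ^ (k:ℕ))⁻¹ : (Matrix n n K)ˣ) : Matrix n n K) * A * ((y ^ (k:ℕ) : (Matrix n n K)ˣ) : Matrix n n K)) h5
  simp only [← mul_assoc, Units.inv_mul, one_mul] at h7
  simp only [mul_assoc, Units.inv_mul, mul_one] at h7
  rw [Commute, SemiconjBy, ← Units.val_pow_eq_pow_val]
  conv_lhs => rw [h7]
  simp only [mul_assoc, Units.inv_mul, mul_one]
structure LD (H : Subgroup (Matrix n n K)ˣ) (M : Submodule K (Matrix n n K)) (x y : (Matrix n n K)ˣ) (lam : n → K)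
    (σ : n → n) (c : n → K) (a : n) : Prop where
  span : Submodule.span K ((fun h : (Matrix n n K)ˣ => (h : Matrix n n K)) '' H) = ⊤
  xH : x ∈ H
  yH : y ∈ H
  x_eq : x.1 = diagonal lam
  h0 : ∀ i, lam i ≠ 0
  hinj : Function.Injective lam
  hσ : ∀ i, σ (σ i) = i
  hσ1 : ∀ i, σ i ≠ i
  hls : ∀ i, lam (σ i) = (lam i)⁻¹
  hc : ∀ i, c i ≠ 0
  hcs : ∀ i, c (σ i) = c i
  conj : ∀ h ∈ H, ∀ z ∈ M, h.1 * z * (h⁻¹).1 ∈ M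
  br : ∀ z ∈ M, ∀ w ∈ M, z * w + w * z ∈ M
  alt1 : ∀ z ∈ M, ∀ i, z i (σ i) = 0
  alt2 : ∀ z ∈ M, ∀ i j, c i * z i j = c j * z (σ j) (σ i)
  he : ∀ k, k ≠ a → k ≠ σ a → diagonal (bl σ k) ∈ M
  hZ : ∀ z : Matrix n n K, Commute z x → (∃ k, 0 < k ∧ k ≤ Fintype.card n ^ Fintype.card n ∧ Commute z (y.1 ^ k)) →
    ∃ s : K, z = s • 1
  hm : ∃ k, k ≠ a ∧ k ≠ σ a
variable [CharP K 2] {H : Subgroup (Matrix n n K)ˣ} {M : Submodule K (Matrix n n K)} {x y : (Matrix n n K)ˣ} {lam : n → K}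
    {σ : n → n} {c : n → K} {a : n}
namespace LD
theorem x_inv (D : LD H M x y lam σ c a) : (x⁻¹).1 = diagonal (fun i => (lam i)⁻¹) := by
  have h1 : diagonal (fun i => (lam i)⁻¹) * x.1 = 1 := by
    rw [D.x_eq, diagonal_mul_diagonal]
    rw [← diagonal_one]; congr 1; ext i; exact inv_mul_cancel₀ (D.h0 i)
  calc _ = (diagonal (fun i => (lam i)⁻¹) * x.1) * (x⁻¹).1 := by rw [h1, one_mul]
    _ = _ := by rw [mul_assoc, Units.mul_inv, mul_one]
theorem scalar_of_diag (D : LD H M x y lam σ c a) (S : Set (Matrix n n K)) (hD : ∀ d ∈ S, ∃ g, d = diagonal g)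
    (hy : ∀ d ∈ S, y.1 * d * (y⁻¹).1 ∈ S) (d : Matrix n n K) (hd : d ∈ S) :
    ∃ s : K, d = s • 1 := by
  refine D.hZ d ?_ (lemmaZ y S hD hy d hd)
  obtain ⟨g, rfl⟩ := hD d hd
  rw [D.x_eq, Commute, SemiconjBy, diagonal_mul_diagonal, diagonal_mul_diagonal]
  congr 1; ext i; ring
theorem irr (D : LD H M x y lam σ c a) (W : Submodule K (n → K)) (hW : ∀ h ∈ H, ∀ w ∈ W, h.1 *ᵥ w ∈ W) : W = ⊥ ∨ W = ⊤ := by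
  have h1 : ∀ A : Matrix n n K, ∀ w ∈ W, A *ᵥ w ∈ W := by
    intro A w hw
    have hA : A ∈ Submodule.span K ((fun h : (Matrix n n K)ˣ => (h : Matrix n n K)) '' H) := by rw [D.span]; trivial
    induction hA using Submodule.span_induction with
    | mem A h => obtain ⟨h, hh, rfl⟩ := h; exact hW h hh w hw
    | zero => simp
    | add A B _ _ h1 h2 => rw [add_mulVec]; exact W.add_mem h1 h2
    | smul c A _ h1 => rw [smul_mulVec]; exact W.smul_mem c h1
  by_cases hb : W = ⊥
  · exact Or.inl hb
  right
  obtain ⟨w, hw, hw0⟩ := W.exists_mem_ne_zero_of_ne_bot hb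
  obtain ⟨i, hi⟩ := Function.ne_iff.1 hw0
  rw [eq_top_iff]
  intro v _
  have h2 := h1 (vecMulVec v (Pi.single i (w i)⁻¹)) w hw
  convert h2
  rw [vecMulVec_mulVec]
  simp only [single_dotProduct]
  rw [inv_mul_cancel₀ hi]; simp
theorem comm_scalar (D : LD H M x y lam σ c a) (z : Matrix n n K) (hz : ∀ h ∈ H, Commute z (h : Matrix n n K)) : ∃ s : K, z = s • 1 := by
  have h1 : ∀ A : Matrix n n K, Commute z A := by
    intro A
    have hA : A ∈ Submodule.span K ((fun h : (Matrix n n K)ˣ => (h : Matrix n n K)) '' H) := by rw [D.span]; trivial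
    induction hA using Submodule.span_induction with
    | mem A h => obtain ⟨h, hh, rfl⟩ := h; exact hz h hh
    | zero => exact Commute.zero_right _
    | add A B _ _ h1 h2 => exact h1.add_right h2
    | smul c A _ h1 => exact h1.smul_right c
  exact D.hZ z (h1 _) ⟨1, one_pos, Nat.pos_of_ne_zero (by
    have : Nonempty n := ⟨a⟩
    exact pow_ne_zero _ Fintype.card_ne_zero), h1 _⟩
/-- commuting with the available block idempotents -/
theorem block_diag (D : LD H M x y lam σ c a) (z : Matrix n n K) (hz : ∀ m ∈ M, z * m = m * z) (p q : n) (h1 : q ≠ p) (h2 : q ≠ σ p) : z p q = 0 := by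
  have key : ∀ k, k ≠ a → k ≠ σ a → z p q * bl σ k q = bl σ k p * z p q := by
    intro k hk hk'
    have := congrFun (congrFun (hz _ (D.he k hk hk')) p) q
    rwa [mul_diagonal, diagonal_mul] at this
  have hqs : p ≠ σ q := fun h => h2 (by rw [h, D.hσ])
  by_cases hp : p = a ∨ p = σ a
  · have hq1 : q ≠ a := by
      rintro rfl
      rcases hp with h | h
      · exact h1 h.symm
      · exact hqs h
    have hq2 : q ≠ σ a := by
      rintro rfl
      rcases hp with rfl | h
      · exact h2 rfl
      · exact h1 h.symm
    have := key q hq1 hq2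
    simpa [bl, h1.symm, hqs] using this
  · push Not at hp
    have := key p hp.1 hp.2
    simpa [bl, h1, h2] using this.symm
theorem not_comm (D : LD H M x y lam σ c a) (hcomm : ∀ z ∈ M, ∀ w ∈ M, z * w = w * z) : False := by
  have hd : ∀ d ∈ (M : Set (Matrix n n K)), ∃ g, d = diagonal g := by
    intro d hd
    refine ⟨fun i => d i i, ?_⟩
    ext p q
    by_cases h1 : q = p
    · subst h1; simp
    · rw [diagonal_apply_ne' _ h1]
      by_cases h2 : q = σ p
      · subst h2; exact D.alt1 d hd p
      · exact D.block_diag d (fun m hm => hcomm d hd m hm) p q h1 h2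
  obtain ⟨k, hk1, hk2⟩ := D.hm
  obtain ⟨s, hs⟩ := D.scalar_of_diag M hd (fun d hd => D.conj y D.yH d hd) _ (D.he k hk1 hk2)
  have e1 := congrFun (congrFun hs k) k
  have e2 := congrFun (congrFun hs a) a
  have : a ≠ σ k := fun h => hk2 (by rw [h, D.hσ])
  simp [bl] at e1
  simp [bl, hk1.symm, this] at e2
  rw [← e2] at e1
  exact one_ne_zero e1
theorem commutant (D : LD H M x y lam σ c a) (z : Matrix n n K) (hz : ∀ m ∈ M, z * m = m * z) : ∃ s : K, z = s • 1 := by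
  classical
  let C : Submodule K (Matrix n n K) :=
    { carrier := {z | ∀ m ∈ M, z * m = m * z}
      add_mem' := fun {z w} h1 h2 m hm => by rw [add_mul, mul_add, h1 m hm, h2 m hm]
      zero_mem' := fun m hm => by simp
      smul_mem' := fun c z h m hm => by rw [smul_mul_assoc, mul_smul_comm, h m hm] }
  have hCconj : ∀ h ∈ H, ∀ z ∈ C, h.1 * z * (h⁻¹).1 ∈ C := by
    intro h hh z hz m hm
    have h1 := hz _ (D.conj h⁻¹ (H.inv_mem hh) m hm)
    rw [inv_inv] at h1
    have h2 := congrArg (fun A => h.1 * A * (h⁻¹).1) h1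
    simp only [← mul_assoc, Units.mul_inv, one_mul] at h2
    simp only [mul_assoc, Units.mul_inv, mul_one] at h2
    simp only [mul_assoc]
    exact h2
  by_cases hcase : ∀ z ∈ C, ∀ i, z i (σ i) = 0
  · refine D.scalar_of_diag C ?_ (fun d hd => hCconj y D.yH d hd) z hz
    intro d hd
    refine ⟨fun i => d i i, ?_⟩
    ext p q
    by_cases h1 : q = p
    · subst h1; simp
    · rw [diagonal_apply_ne' _ h1]
      by_cases h2 : q = σ p
      · subst h2; exact hcase d hd p
      · exact D.block_diag d hd p q h1 h2
  · exfalso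
    push Not at hcase
    obtain ⟨w, hw, i, hwi⟩ := hcase
    have hH := had_weight C lam D.h0 (fun z hz => by
      have := hCconj x D.xH z hz
      rwa [D.x_eq, D.x_inv] at this) (fun w => if w = lam i * lam i then 1 else 0)
    have h1 := hH w hw
    have h2 : (Matrix.of fun p q => (if lam p * (lam q)⁻¹ = lam i * lam i then 1 else 0) * w p q) = single i (σ i) (w i (σ i)) := by
      ext p q
      rw [of_apply]
      by_cases h1 : q = p
      · subst h1
        rw [mul_inv_cancel₀ (D.h0 q), if_neg, zero_mul, single_apply_of_ne]
        · rintro ⟨h, h'⟩; exact D.hσ1 i (h'.trans h.symm)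
        · intro h; exact lam_one lam σ D.hσ1 D.hinj D.h0 D.hls h.symm
      · by_cases h2 : q = σ p
        · subst h2
          rw [D.hls, inv_inv]
          by_cases hp : p = i
          · subst hp; simp
          · rw [if_neg, zero_mul, single_apply_of_ne]
            · rintro ⟨h, _⟩; exact hp h.symm
            · intro h; exact hp (lam_sq lam σ D.hσ1 D.hinj D.h0 D.hls h)
        · rw [D.block_diag w hw p q h1 h2, mul_zero, single_apply_of_ne]
          rintro ⟨rfl, rfl⟩; exact h2 rfl
    rw [h2] at h1
    -- e_i is a common eigenvector
    have h3 : ∀ z ∈ M, ∀ p, p ≠ i → z p i = 0 := by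
      intro z hz p hp
      have := congrFun (congrFun (h1 z hz) p) (σ i)
      rw [single_mul_apply_of_ne _ _ _ _ _ hp, mul_single_apply_same] at this
      exact (mul_eq_zero.1 this.symm).resolve_right hwi
    let W : Submodule K (n → K) := Submodule.span K {v | ∀ z ∈ M, ∃ s : K, z *ᵥ v = s • v}
    have hW : ∀ h ∈ H, ∀ w ∈ W, h.1 *ᵥ w ∈ W := by
      intro h hh w hw
      induction hw using Submodule.span_induction with
      | mem v hv =>
        refine Submodule.subset_span ?_
        intro z hz
        obtain ⟨s, hs⟩ := hv _ (D.conj h⁻¹ (H.inv_mem hh) z hz)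
        refine ⟨s, ?_⟩
        have := congrArg (fun u => h.1 *ᵥ u) hs
        simp only [mulVec_mulVec, inv_inv, ← mul_assoc, Units.mul_inv, one_mul, mulVec_smul] at this
        rw [mulVec_mulVec]; exact this
      | zero => simp
      | add A B _ _ h1 h2 => rw [mulVec_add]; exact W.add_mem h1 h2
      | smul c A _ h1 => rw [mulVec_smul]; exact W.smul_mem c h1
    have hi : (Pi.single i 1 : n → K) ∈ W := by
      refine Submodule.subset_span ?_
      intro z hz
      refine ⟨z i i, ?_⟩
      ext p
      rw [mulVec_single_one]
      by_cases hp : p = i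
      · subst hp; simp
      · simp [h3 z hz p hp, hp]
    have hWt : W = ⊤ := by
      rcases D.irr W hW with h | h
      · rw [h, Submodule.mem_bot] at hi
        have := congrFun hi i
        simp at this
      · exact h
    refine D.not_comm fun z hz w hw => ?_
    have : ∀ v ∈ W, (z * w) *ᵥ v = (w * z) *ᵥ v := by
      intro v hv
      induction hv using Submodule.span_induction with
      | mem v hv =>
        obtain ⟨s, hs⟩ := hv z hz
        obtain ⟨t, ht⟩ := hv w hw
        rw [← mulVec_mulVec, ← mulVec_mulVec, hs, ht, mulVec_smul, mulVec_smul, hs, ht, smul_smul, smul_smul, mul_comm]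
      | zero => simp
      | add A B _ _ h1 h2 => rw [mulVec_add, mulVec_add, h1, h2]
      | smul c A _ h1 => rw [mulVec_smul, mulVec_smul, h1]
    refine Matrix.ext_of_mulVec_single fun j => this _ (by rw [hWt]; trivial)
end LD
end lie2
end SG
end
section
namespace SG
set_option linter.all false
open Matrix
section lie3
variable {n K : Type} [Fintype n] [DecidableEq n] [Field K] [CharP K 2] {H : Subgroup (Matrix n n K)ˣ} {M : Submodule K (Matrix n n K)} {x y : (Matrix n n K)ˣ} {lam : n → K}
    {σ : n → n} {c : n → K} {a : n}
def Stab (M : Submodule K (Matrix n n K)) (W : Submodule K (n → K)) : Prop := ∀ z ∈ M, ∀ w ∈ W, z *ᵥ w ∈ W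
namespace LD
theorem stab_sup {W U : Submodule K (n → K)} (h1 : Stab M W) (h2 : Stab M U) : Stab M (W ⊔ U) := by
  intro z hz w hw
  obtain ⟨a, ha, b, hb, rfl⟩ := Submodule.mem_sup.1 hw
  rw [mulVec_add]
  exact Submodule.add_mem_sup (h1 z hz a ha) (h2 z hz b hb)
theorem stab_inf {W U : Submodule K (n → K)} (h1 : Stab M W) (h2 : Stab M U) : Stab M (W ⊓ U) :=
  fun z hz w hw => ⟨h1 z hz w hw.1, h2 z hz w hw.2⟩
theorem stab_map (D : LD H M x y lam σ c a) {W : Submodule K (n → K)} (h1 : Stab M W) (h : (Matrix n n K)ˣ) (hh : h ∈ H) :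
    Stab M (W.map (mulVecLin (h : Matrix n n K))) := by
  rintro z hz _ ⟨w, hw, rfl⟩
  refine ⟨_, h1 _ (D.conj h⁻¹ (H.inv_mem hh) z hz) w hw, ?_⟩
  simp only [mulVecLin_apply, mulVec_mulVec, inv_inv, ← mul_assoc, Units.mul_inv, one_mul]
theorem irrM (D : LD H M x y lam σ c a) (W0 : Submodule K (n → K)) (hW0 : Stab M W0) : W0 = ⊥ ∨ W0 = ⊤ := by
  by_contra hcon
  push Not at hcon
  obtain ⟨hb0, ht0⟩ := hcon
  -- minimal
  obtain ⟨W, ⟨hWs, hWb⟩, hWmin⟩ := WellFounded.has_min (wellFounded_lt (α := Submodule K (n → K)))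
    {W | Stab M W ∧ W ≠ ⊥} ⟨W0, hW0, hb0⟩
  have hWmin' : ∀ U, Stab M U → U ≤ W → U ≠ ⊥ → U = W := by
    intro U hU hUW hUb
    by_contra hne
    exact hWmin U ⟨hU, hUb⟩ (lt_of_le_of_ne hUW hne)
  have hWt : W ≠ ⊤ := by
    rintro rfl
    exact ht0 (hWmin' W0 hW0 le_top hb0)
  obtain ⟨U, ⟨hUs, hUW⟩, hUmax⟩ := WellFounded.has_min (wellFounded_gt (α := Submodule K (n → K)))
    {U | Stab M U ∧ U ⊓ W = ⊥} ⟨⊥, fun z hz w hw => by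
      rw [Submodule.mem_bot] at hw; subst hw; simp, bot_inf_eq _⟩
  have htop : U ⊔ W = ⊤ := by
    by_contra hne
    have h1 : ∃ h ∈ H, ¬ W.map (mulVecLin (h : Matrix n n K)) ≤ U ⊔ W := by
      by_contra hall
      push Not at hall
      let S : Submodule K (n → K) := ⨆ h : H, W.map (mulVecLin ((h : (Matrix n n K)ˣ) : Matrix n n K))
      have hS : S ≤ U ⊔ W := iSup_le fun h => hall h h.2
      have : S = ⊥ ∨ S = ⊤ := by
        refine D.irr S fun g hg w hw => ?_
        induction hw using Submodule.iSup_induction' with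
        | mem h v hv =>
          obtain ⟨u, hu, rfl⟩ := hv
          refine Submodule.mem_iSup_of_mem (⟨g, hg⟩ * h) ⟨u, hu, ?_⟩
          simp [mulVec_mulVec]
        | zero => simp
        | add v w _ _ h1 h2 => rw [mulVec_add]; exact S.add_mem h1 h2
      rcases this with h | h
      · have h2 : W ≤ S := by
          intro w hw
          refine Submodule.mem_iSup_of_mem (1 : H) ⟨w, hw, ?_⟩
          simp
        rw [h] at h2
        exact hWb (le_bot_iff.1 h2)
      · rw [h] at hS
        exact hne (top_le_iff.1 hS)
    obtain ⟨h, hh, hnle⟩ := h1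
    set hW := W.map (mulVecLin (h : Matrix n n K)) with hWdef
    have hdisj : hW ⊓ (U ⊔ W) = ⊥ := by
      by_contra hne2
      -- pull back
      have hs : Stab M (hW ⊓ (U ⊔ W)) := stab_inf (D.stab_map hWs h hh) (stab_sup hUs hWs)
      have hs' := D.stab_map hs h⁻¹ (H.inv_mem hh)
      have hle : (hW ⊓ (U ⊔ W)).map (mulVecLin (h⁻¹).1) ≤ W := by
        rintro _ ⟨_, ⟨⟨w, hw, rfl⟩, _⟩, rfl⟩
        simpa [mulVec_mulVec] using hw
      have hnb : (hW ⊓ (U ⊔ W)).map (mulVecLin (h⁻¹).1) ≠ ⊥ := by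
        obtain ⟨v, hv, hv0⟩ := Submodule.exists_mem_ne_zero_of_ne_bot hne2
        intro hbot
        have : mulVecLin (h⁻¹).1 v ∈ (⊥ : Submodule K (n → K)) := by
          rw [← hbot]; exact ⟨v, hv, rfl⟩
        rw [Submodule.mem_bot, mulVecLin_apply] at this
        have h3 := congrArg (fun u => h.1 *ᵥ u) this
        simp only [mulVec_mulVec, Units.mul_inv, one_mulVec, mulVec_zero] at h3
        exact hv0 h3
      have := hWmin' _ hs' hle hnb
      apply hnle
      rintro _ ⟨w, hw, rfl⟩
      rw [SetLike.mem_coe, ← this] at hw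
      obtain ⟨v, hv, rfl⟩ := hw
      simp only [mulVecLin_apply, mulVec_mulVec, Units.mul_inv, one_mulVec]
      exact hv.2
    refine hUmax (U ⊔ hW) ⟨stab_sup hUs (D.stab_map hWs h hh), ?_⟩ ?_
    · rw [eq_bot_iff]
      rintro v ⟨hv1, hv2⟩
      obtain ⟨u, hu, w, hw, rfl⟩ := Submodule.mem_sup.1 hv1
      have h5 : w ∈ U ⊔ W := by
        have : w = -u + (u + w) := by abel
        rw [this]
        exact Submodule.add_mem_sup (U.neg_mem hu) hv2
      have h6 : w ∈ hW ⊓ (U ⊔ W) := ⟨hw, h5⟩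
      rw [hdisj, Submodule.mem_bot] at h6
      subst h6
      rw [add_zero] at hv2 ⊢
      rw [← hUW]
      exact ⟨hu, hv2⟩
    · refine lt_of_le_of_ne le_sup_left fun heq => hnle ?_
      rw [heq]
      exact le_sup_right.trans le_sup_left
  -- projection
  have hcompl : IsCompl W U := ⟨disjoint_iff.2 (by rw [inf_comm]; exact hUW), codisjoint_iff.2 (by rw [sup_comm]; exact htop)⟩
  let π : (n → K) →ₗ[K] (n → K) := W.subtype ∘ₗ W.projectionOnto U hcompl
  let P : Matrix n n K := LinearMap.toMatrix' π
  have hP : ∀ v, P *ᵥ v = π v := fun v => by rw [LinearMap.toMatrix'_mulVec]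
  have hπW : ∀ w ∈ W, π w = w := by
    intro w hw
    change ((W.projectionOnto U hcompl) w : n → K) = w
    have := Submodule.projectionOnto_apply_left hcompl ⟨w, hw⟩
    rw [this]
  have hπU : ∀ w ∈ U, π w = 0 := by
    intro w hw
    change ((W.projectionOnto U hcompl) w : n → K) = 0
    have := Submodule.projectionOnto_apply_right hcompl ⟨w, hw⟩
    rw [this]; rfl
  obtain ⟨s, hs⟩ := D.commutant P (by
    intro m hm
    refine Matrix.ext_of_mulVec_single fun j => ?_
    rw [← mulVec_mulVec, ← mulVec_mulVec, hP, hP]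
    obtain ⟨u, hu, w, hw, he⟩ := Submodule.mem_sup.1 (by rw [htop]; trivial : (Pi.single j 1 : n → K) ∈ U ⊔ W)
    rw [← he, mulVec_add, map_add, map_add, hπU u hu, hπW w hw, hπU _ (hUs m hm u hu), hπW _ (hWs m hm w hw), zero_add, zero_add])
  obtain ⟨w, hw, hw0⟩ := Submodule.exists_mem_ne_zero_of_ne_bot hWb
  have h1 : s = 1 := by
    have h2 := hP w
    rw [hπW w hw, hs, smul_mulVec, one_mulVec] at h2
    have : (s - 1) • w = 0 := by rw [sub_smul, h2, one_smul, sub_self]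
    rcases smul_eq_zero.1 this with h | h
    · exact sub_eq_zero.1 h
    · exact absurd h hw0
  apply hWt
  rw [eq_top_iff]
  intro v _
  have h2 := hP v
  rw [hs, h1, one_smul, one_mulVec] at h2
  rw [h2]
  exact Subtype.prop _
/-- the basic elements -/
def R (σ : n → n) (c : n → K) (j i : n) : Matrix n n K := single j i 1 + single (σ i) (σ j) (c j / c i)
def N (M : Submodule K (Matrix n n K)) (σ : n → n) (c : n → K) (j i : n) : Prop := j ≠ i ∧ j ≠ σ i ∧ R σ c j i ∈ M
theorem extract (D : LD H M x y lam σ c a) {z : Matrix n n K} (hz : z ∈ M) {j i : n} (h1 : j ≠ i) (h2 : j ≠ σ i) (h3 : z j i ≠ 0) : N M σ c j i := by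
  refine ⟨h1, h2, ?_⟩
  have hp := had_pair M lam D.h0 D.hinj (fun z hz => by
      have := D.conj x D.xH z hz
      rwa [D.x_eq, D.x_inv] at this) σ D.hσ D.hσ1 D.hls a (fun k hk hk' z hz => D.br _ (D.he k hk hk') z hz) h1 h2
  have h4 := M.smul_mem (z j i)⁻¹ (hp z hz)
  convert h4 using 1
  ext p q
  have e := D.alt2 z hz j i
  have hci := D.hc i
  have hne : ¬ (j = σ i ∧ i = σ j) := fun h => h2 h.1
  simp only [R, Matrix.add_apply, single_apply, Matrix.smul_apply, of_apply, smul_eq_mul]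
  by_cases hA : j = p ∧ i = q
  · obtain ⟨rfl, rfl⟩ := hA
    simp [h2.symm, h3]
  · by_cases hB : σ i = p ∧ σ j = q
    · obtain ⟨rfl, rfl⟩ := hB
      have : ¬ (j = σ i ∧ i = σ j) := fun h => h2 h.1
      simp only [this, if_false, and_self, if_true, or_true, zero_add, one_mul]
      field_simp
      linear_combination e
    · have hA' : ¬ (p = j ∧ q = i) := fun h => hA ⟨h.1.symm, h.2.symm⟩
      have hB' : ¬ (p = σ i ∧ q = σ j) := fun h => hB ⟨h.1.symm, h.2.symm⟩
      simp [hA, hB, hA', hB']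
theorem N_symm (D : LD H M x y lam σ c a) {j i : n} (h : N M σ c j i) : N M σ c (σ i) (σ j) := by
  refine D.extract h.2.2 ?_ ?_ ?_
  · intro h'; apply h.1; rw [← D.hσ i, h', D.hσ]
  · rw [D.hσ]; exact fun h' => h.2.1 h'.symm
  · have h1 : ¬ (j = σ i ∧ i = σ j) := fun h' => h.2.1 h'.1
    simp [R, single_apply, h1, D.hc]
theorem N_trans (D : LD H M x y lam σ c a) {k j i : n} (h1 : N M σ c k j) (h2 : N M σ c j i) (h3 : k ≠ i) (h4 : k ≠ σ i) : N M σ c k i := by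
  refine D.extract (D.br _ h1.2.2 _ h2.2.2) h3 h4 ?_
  have g1 := h1.1
  have g2 := h1.2.1
  have g3 := h2.1
  have g4 := h2.2.1
  have hinj : ∀ u v, σ u = σ v ↔ u = v := fun u v => ⟨fun h => by rw [← D.hσ u, h, D.hσ], fun h => by rw [h]⟩
  have hsw : ∀ u v, σ u = v ↔ u = σ v := fun u v => ⟨fun h => by rw [← h, D.hσ], fun h => by rw [h, D.hσ]⟩
  have e : (R σ c k j * R σ c j i + R σ c j i * R σ c k j) k i = 1 := by
    simp only [R, add_mul, mul_add, Matrix.add_apply]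
    rw [single_mul_single_same]
    rw [single_mul_single_of_ne _ _ _ _ (h := g4), single_mul_single_of_ne _ _ _ _ (h := fun h => g2 ((hsw _ _).1 h)),
      single_mul_single_of_ne _ _ _ _ (h := fun h => h3 ((hinj _ _).1 h)), single_mul_single_of_ne _ _ _ _ (h := h3.symm),
      single_mul_single_of_ne _ _ _ _ (h := fun h => g4 ((hsw _ _).1 h.symm)), single_mul_single_of_ne _ _ _ _ (h := fun h => g2 h.symm),
      single_mul_single_same]
    simp [single_apply, h4.symm]
  rw [e]; exact one_ne_zero
theorem edge (D : LD H M x y lam σ c a) (S : Set n) (i : n) (hi : i ∈ S) (k : n) (hk : k ∉ S) : ∃ p ∈ S, ∃ j, j ∉ S ∧ N M σ c j p := by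
  by_contra hcon
  push Not at hcon
  let W : Submodule K (n → K) :=
    { carrier := {v | ∀ j, j ∉ S → v j = 0}
      add_mem' := fun {u v} h1 h2 j hj => by simp [h1 j hj, h2 j hj]
      zero_mem' := fun j hj => rfl
      smul_mem' := fun s v h j hj => by simp [h j hj] }
  have hst : Stab M W := by
    intro z hz w hw j hj
    rw [mulVec, dotProduct]
    refine Finset.sum_eq_zero fun p _ => ?_
    by_cases hp : p ∈ S
    · have : z j p = 0 := by
        by_contra hne
        have h1 : j ≠ p := fun h => hj (h ▸ hp)
        have h2 : j ≠ σ p := by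
          rintro rfl
          have := D.alt1 z hz (σ p)
          rw [D.hσ] at this
          exact hne this
        exact hcon p hp j hj (D.extract hz h1 h2 hne)
      rw [this, zero_mul]
    · rw [hw p hp, mul_zero]
  rcases D.irrM W hst with h | h
  · have : (Pi.single i 1 : n → K) ∈ W := by
      intro j hj
      have : j ≠ i := fun h => hj (h ▸ hi)
      simp [this]
    rw [h, Submodule.mem_bot] at this
    have := congrFun this i
    simp at this
  · have : (Pi.single k 1 : n → K) ∈ W := by rw [h]; trivial
    have := this k hk
    simp at this
theorem N_all (D : LD H M x y lam σ c a) (i k : n) (h1 : k ≠ i) (h2 : k ≠ σ i) : N M σ c k i := by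
  have hsw : ∀ u v, σ u = v ↔ u = σ v := fun u v => ⟨fun h => by rw [← h, D.hσ], fun h => by rw [h, D.hσ]⟩
  let S : Set n := {k | k = i ∨ N M σ c k i}
  have hsi : σ i ∉ S := by
    rintro (h | h)
    · exact D.hσ1 i h
    · exact h.2.1 rfl
  have out : ∀ p ∈ S, ∀ j, j ∉ S → N M σ c j p → j = σ i ∧ N M σ c p i := by
    rintro p hp j hj hN
    rcases hp with rfl | hp
    · exact absurd (Or.inr hN) hj
    · refine ⟨?_, hp⟩
      by_contra hne
      exact hj (Or.inr (D.N_trans hN hp (fun h => hj (Or.inl h)) hne))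
  obtain ⟨p, hpS, j, hjS, hN⟩ := D.edge S i (Or.inl rfl) (σ i) hsi
  obtain ⟨rfl, hpi⟩ := out p hpS j hjS hN
  by_contra hcon
  have hk : k ∉ S ∪ {σ i} := by
    rintro ((h | h) | h)
    · exact h1 h
    · exact hcon h
    · exact h2 h
  obtain ⟨p', hp', j, hj, hN'⟩ := D.edge (S ∪ {σ i}) i (Or.inl (Or.inl rfl)) k hk
  have hjS : j ∉ S := fun h => hj (Or.inl h)
  rcases hp' with hp' | hp'
  · exact hj (Or.inr (out p' hp' j hjS hN').1)
  · have hp'' : p' = σ i := hp'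
    subst hp''
    have hjp : j ≠ p := fun h => hjS (h ▸ hpS)
    have hj1 : j ≠ i := fun h => hjS (Or.inl h)
    have hj2 : j ≠ σ i := fun h => hj (Or.inr h)
    by_cases hjsp : j = σ p
    · have := D.N_symm hN
      rw [D.hσ] at this
      rw [hjsp] at hjS
      exact hjS (Or.inr this)
    · have := D.N_trans hN' hN hjp hjsp
      exact hjS (Or.inr (D.N_trans this hpi hj1 hj2))
theorem e_mem (D : LD H M x y lam σ c a) (k : n) : diagonal (bl σ k) ∈ M := by
  have hsw : ∀ u v, σ u = v ↔ u = σ v := fun u v => ⟨fun h => by rw [← h, D.hσ], fun h => by rw [h, D.hσ]⟩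
  have hinj : ∀ u v, σ u = σ v ↔ u = v := fun u v => ⟨fun h => by rw [← D.hσ u, h, D.hσ], fun h => by rw [h]⟩
  have hsing : ∀ k, (diagonal (bl σ k) : Matrix n n K) = single k k 1 + single (σ k) (σ k) 1 := by
    intro k
    ext p q
    rw [diagonal_apply, Matrix.add_apply, single_apply, single_apply, bl]
    have := D.hσ1 k
    by_cases h : p = q
    · subst h
      by_cases h1 : p = k
      · subst h1; simp [this]
      · by_cases h2 : p = σ k
        · subst h2; simp [this.symm]
        · simp [h1, h2, Ne.symm h1, Ne.symm h2]
    · have e1 : ¬ (k = p ∧ k = q) := fun h' => h (h'.1.symm.trans h'.2)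
      have e2 : ¬ (σ k = p ∧ σ k = q) := fun h' => h (h'.1.symm.trans h'.2)
      simp [h, e1, e2]
  by_cases hk : k ≠ a ∧ k ≠ σ a
  · exact D.he k hk.1 hk.2
  obtain ⟨i, hi1, hi2⟩ := D.hm
  have ha : diagonal (bl σ a) ∈ M := by
    have hai : a ≠ σ i := fun h => hi2 (by rw [h, D.hσ])
    have h1 := (D.N_all i a hi1.symm hai).2.2
    have h2 := (D.N_all a i hi1 hi2).2.2
    have h3 := M.add_mem (D.br _ h1 _ h2) (D.he i hi1 hi2)
    convert h3 using 1
    have hca := D.hc a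
    have hci := D.hc i
    simp only [R, add_mul, mul_add]
    rw [single_mul_single_same, single_mul_single_of_ne _ _ _ _ (h := hi2), single_mul_single_of_ne _ _ _ _ (h := fun h => hi2 h.symm),
      single_mul_single_same, single_mul_single_same, single_mul_single_of_ne _ _ _ _ (h := hai), single_mul_single_of_ne _ _ _ _ (h := hai.symm),
      single_mul_single_same, hsing, hsing]
    have e1 : c a / c i * (c i / c a) = 1 := by field_simp
    have e2 : c i / c a * (c a / c i) = 1 := by field_simp
    rw [e1, e2]
    have h22 : ∀ A : Matrix n n K, A + A = 0 := fun A => by ext p q; exact CharTwo.add_self_eq_zero _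
    have e5 : ∀ A B C D : Matrix n n K, A + B = A + 0 + (0 + C) + (D + 0 + (0 + B)) + (D + C) := by
      intro A B C D
      have : A + 0 + (0 + C) + (D + 0 + (0 + B)) + (D + C) = A + B + (C + C) + (D + D) := by abel
      rw [this, h22, h22]; simp
    rw [one_mul]
    exact e5 _ _ _ _
  rcases not_and_or.1 hk with h | h
  · rw [not_not.1 h]; exact ha
  · rw [not_not.1 h]
    convert ha using 2
    ext p
    simp only [bl, D.hσ]
    simp only [or_comm]
theorem main (D : LD H M x y lam σ c a) (z : Matrix n n K) (h1 : ∀ i, z i (σ i) = 0) (h2 : ∀ i j, c i * z i j = c j * z (σ j) (σ i)) : z ∈ M := by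
  classical
  induction hN : (Finset.univ.filter fun p : n × n => z p.1 p.2 ≠ 0).card using Nat.strong_induction_on generalizing z with
  | _ s ih =>
  by_cases hz : z = 0
  · rw [hz]; exact M.zero_mem
  have : ∃ j i, z j i ≠ 0 := by
    by_contra h; push Not at h; exact hz (by ext p q; exact h p q)
  obtain ⟨j, i, hji⟩ := this
  -- element to subtract
  have key : ∀ r ∈ M, r j i = z j i → (∀ p q, z p q = 0 → r p q = 0) → z ∈ M := by
    intro r hr hr1 hr2
    have : z - r ∈ M := by
      refine ih _ ?_ (z - r) ?_ ?_ rfl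
      · rw [← hN]
        refine Finset.card_lt_card ?_
        rw [Finset.ssubset_iff_of_subset]
        · exact ⟨(j, i), by simpa using hji, fun h => (Finset.mem_filter.1 h).2 (by rw [Matrix.sub_apply, hr1, sub_self])⟩
        · intro p hp
          simp only [Finset.mem_filter, Finset.mem_univ, true_and] at hp ⊢
          intro h; apply hp; simp [h, hr2 _ _ h]
      · intro i; simp [h1 i, D.alt1 r hr i]
      · intro i j
        simp only [Matrix.sub_apply, mul_sub, h2 i j, D.alt2 r hr i j]
    have h3 := M.add_mem this hr
    rwa [sub_add_cancel] at h3
  by_cases hij : j = i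
  · subst hij
    have hs : z (σ j) (σ j) = z j j := (mul_left_cancel₀ (D.hc j) (h2 j j)).symm
    refine key (z j j • diagonal (bl σ j)) (M.smul_mem _ (D.e_mem j)) (by simp [bl]) ?_
    intro p q hpq
    simp only [Matrix.smul_apply, diagonal_apply, bl, smul_eq_mul]
    split_ifs with e1 e2
    · exfalso
      subst e1
      rcases e2 with rfl | rfl
      · exact hji hpq
      · exact hji (hs ▸ hpq)
    · simp
    · simp
  · have hjs : j ≠ σ i := by
      rintro rfl
      have := h1 (σ i)
      rw [D.hσ] at this
      exact hji this
    have hs := h2 j i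
    refine key (z j i • R σ c j i) (M.smul_mem _ (D.N_all i j hij hjs).2.2) ?_ ?_
    · simp [R, single_apply, hjs.symm]
    · intro p q hpq
      simp only [R, Matrix.smul_apply, Matrix.add_apply, single_apply, smul_eq_mul]
      rw [if_neg, if_neg]
      · simp
      · rintro ⟨rfl, rfl⟩
        rw [hpq, mul_zero] at hs
        exact (mul_ne_zero (D.hc j) hji) hs
      · rintro ⟨rfl, rfl⟩
        exact hji hpq
end LD
end lie3
end SG
end
section
namespace SG
set_option linter.all false
open Matrix
section cyc
variable {n K : Type} [Fintype n] [DecidableEq n] [Field K]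
noncomputable def cycM (A : Matrix n n K) (v : n → K) : Matrix n n K := of fun i j => (A ^ (Fintype.equivFin n j : ℕ) *ᵥ v) i
def Cyc (A : Matrix n n K) : Prop := ∃ v : n → K, IsUnit (cycM A v)
theorem cyc_mulVec (A : Matrix n n K) (v : n → K) (u : n → K) : cycM A v *ᵥ u = (∑ j, u j • A ^ (Fintype.equivFin n j : ℕ)) *ᵥ v := by
  ext i
  simp only [mulVec, dotProduct, cycM, of_apply, Matrix.sum_apply, Matrix.smul_apply, smul_eq_mul, Finset.sum_mul, Finset.mul_sum]
  rw [Finset.sum_comm]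
  refine Finset.sum_congr rfl fun j _ => Finset.sum_congr rfl fun k _ => ?_
  ring
theorem cyc_comm {A : Matrix n n K} (hA : Cyc A) {z w : Matrix n n K} (hz : Commute z A) (hw : Commute w A) : Commute z w := by
  obtain ⟨v, hv⟩ := hA
  have hdet := (Matrix.isUnit_iff_isUnit_det _).1 hv
  have h1 : z *ᵥ v = cycM A v *ᵥ ((cycM A v)⁻¹ *ᵥ (z *ᵥ v)) := by
    rw [mulVec_mulVec (z *ᵥ v), mul_nonsing_inv _ hdet, one_mulVec]
  rw [cyc_mulVec] at h1
  set p := ∑ j, ((cycM A v)⁻¹ *ᵥ (z *ᵥ v)) j • A ^ (Fintype.equivFin n j : ℕ) with hp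
  have hpc : ∀ w, Commute w A → Commute w p := by
    intro w hw
    exact Commute.sum_right _ _ _ fun j _ => (hw.pow_right _).smul_right _
  have h2 : z * cycM A v = p * cycM A v := by
    refine Matrix.ext_of_mulVec_single fun j => ?_
    rw [← mulVec_mulVec, ← mulVec_mulVec, cyc_mulVec]
    have h3 : ∀ w : Matrix n n K, Commute w A → Commute w (∑ i, (Pi.single j 1 : n → K) i • A ^ (Fintype.equivFin n i : ℕ)) := fun w hw =>
      Commute.sum_right _ _ _ fun j _ => (hw.pow_right _).smul_right _
    rw [mulVec_mulVec, mulVec_mulVec, (h3 z hz).eq, (h3 p (hpc A (Commute.refl A)).symm).eq, ← mulVec_mulVec, ← mulVec_mulVec, h1]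
  have h4 : z = p := hv.mul_right_cancel h2
  rw [h4]
  exact (hpc w hw).symm
end cyc
section transfer
variable {n F K : Type} [Fintype n] [DecidableEq n] [Field F] [Field K] [Algebra F K]
noncomputable def TT (P : (Matrix n n K)ˣ) : Matrix n n F →+* Matrix n n K where
  toFun A := (P⁻¹).1 * A.map (algebraMap F K) * P
  map_one' := by simp
  map_mul' A B := by
    rw [Matrix.map_mul]
    calc _ = (P⁻¹).1 * A.map (algebraMap F K) * 1 * B.map (algebraMap F K) * P := by simp [mul_assoc]
      _ = _ := by rw [← Units.mul_inv P]; simp only [mul_assoc]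
  map_zero' := by simp
  map_add' A B := by rw [Matrix.map_add _ (by simp), mul_add, add_mul]
theorem TT_apply (P : (Matrix n n K)ˣ) (A : Matrix n n F) : TT P A = (P⁻¹).1 * A.map (algebraMap F K) * P := rfl
theorem TT_smul (P : (Matrix n n K)ˣ) (c : F) (A : Matrix n n F) : TT P (c • A) = algebraMap F K c • TT P A := by
  rw [TT_apply, TT_apply, Matrix.map_smul' _ _ _ (by simp)]
  simp
theorem TT_cyc (P : (Matrix n n K)ˣ) (A : Matrix n n F) (h : Cyc A) : Cyc (TT P A) := by
  obtain ⟨v, hv⟩ := h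
  refine ⟨(P⁻¹).1 *ᵥ (fun i => algebraMap F K (v i)), ?_⟩
  have : cycM (TT P A) ((P⁻¹).1 *ᵥ (fun i => algebraMap F K (v i))) = (P⁻¹).1 * (cycM A v).map (algebraMap F K) := by
    ext i j
    rw [cycM, of_apply, ← map_pow, TT_apply, mulVec_mulVec, mul_assoc, Units.mul_inv, mul_one, ← mulVec_mulVec, Matrix.mul_apply']
    rw [mulVec]
    congr 1
    ext k
    simp only [Matrix.map_apply, cycM, of_apply]
    rw [RingHom.map_mulVec]
    rfl
  rw [this]
  refine (Units.isUnit _).mul ?_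
  have h2 := hv.map (algebraMap F K).mapMatrix
  exact h2
theorem TT_span (P : (Matrix n n K)ˣ) (S : Set (Matrix n n F)) (hS : Submodule.span F S = ⊤) : Submodule.span K (TT P '' S) = ⊤ := by
  have h1 : ∀ A : Matrix n n F, TT P A ∈ Submodule.span K (TT P '' S) := by
    intro A
    have hA : A ∈ Submodule.span F S := by rw [hS]; trivial
    induction hA using Submodule.span_induction with
    | mem A h => exact Submodule.subset_span ⟨A, h, rfl⟩
    | zero => simp
    | add A B _ _ h1 h2 => rw [map_add]; exact Submodule.add_mem _ h1 h2
    | smul c A _ h1 => rw [TT_smul]; exact Submodule.smul_mem _ _ h1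
  rw [eq_top_iff]
  intro B _
  have h2 : B = ∑ i, ∑ j, (P.1 * B * (P⁻¹).1) i j • TT P (single i j (1:F)) := by
    have h3 : ∀ C : Matrix n n K, C = ∑ i, ∑ j, C i j • (single i j (1:F)).map (algebraMap F K) := by
      intro C
      conv_lhs => rw [matrix_eq_sum_single C]
      refine Finset.sum_congr rfl fun i _ => Finset.sum_congr rfl fun j _ => ?_
      ext p q
      simp only [Matrix.smul_apply, Matrix.map_apply, single_apply, smul_eq_mul]
      split_ifs <;> simp
    simp only [TT_apply]
    have h4 := h3 (P.1 * B * (P⁻¹).1)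
    have h5 := congrArg (fun C => (P⁻¹).1 * C * P) h4
    simp only [Finset.mul_sum, Finset.sum_mul, mul_smul_comm, smul_mul_assoc] at h5
    rw [← h5]
    simp only [← mul_assoc, Units.inv_mul, one_mul]
    simp only [mul_assoc, Units.inv_mul, mul_one]
  rw [h2]
  exact Submodule.sum_mem _ fun i _ => Submodule.sum_mem _ fun j _ => Submodule.smul_mem _ _ (h1 _)
theorem TT_descend (P : (Matrix n n K)ˣ) (M : Submodule F (Matrix n n F)) (z : Matrix n n F) (h : TT P z ∈ Submodule.span K (TT P '' (M : Set (Matrix n n F)))) : z ∈ M := by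
  by_contra hz
  obtain ⟨f, hf, hM⟩ := Submodule.exists_le_ker_of_notMem hz
  let g : Matrix n n K →ₗ[K] K :=
    { toFun := fun B => ∑ i, ∑ j, (P.1 * B * (P⁻¹).1) i j * algebraMap F K (f (single i j 1))
      map_add' := fun A B => by
        simp only [mul_add, add_mul, Matrix.add_apply, Finset.sum_add_distrib]
      map_smul' := fun c A => by
        simp only [mul_smul_comm, smul_mul_assoc, Matrix.smul_apply, smul_eq_mul, Finset.mul_sum, RingHom.id_apply, mul_assoc] }
  have hg : ∀ A : Matrix n n F, g (TT P A) = algebraMap F K (f A) := by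
    intro A
    change ∑ i, ∑ j, (P.1 * ((P⁻¹).1 * A.map (algebraMap F K) * P) * (P⁻¹).1) i j * algebraMap F K (f (single i j 1)) = _
    simp only [← mul_assoc, Units.mul_inv, one_mul]
    simp only [mul_assoc, Units.mul_inv, mul_one]
    conv_rhs => rw [matrix_eq_sum_single A]
    rw [map_sum, map_sum]
    refine Finset.sum_congr rfl fun i _ => ?_
    rw [map_sum, map_sum]
    refine Finset.sum_congr rfl fun j _ => ?_
    have : single i j (A i j) = A i j • single i j (1:F) := by rw [smul_single]; simp
    rw [this, map_smul, smul_eq_mul, map_mul]; rfl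
  have : ∀ B ∈ Submodule.span K (TT P '' (M : Set (Matrix n n F))), g B = 0 := by
    intro B hB
    induction hB using Submodule.span_induction with
    | mem A h => obtain ⟨m, hm, rfl⟩ := h; rw [hg, hM hm, map_zero]
    | zero => simp
    | add A B _ _ h1 h2 => rw [map_add, h1, h2, add_zero]
    | smul c A _ h1 => rw [map_smul, h1, smul_zero]
  have h2 := this _ h
  rw [hg] at h2
  exact hf ((algebraMap F K).injective (h2.trans (map_zero _).symm))
def AltM (A : Matrix n n K) : Prop := Aᵀ = A ∧ ∀ i, A i i = 0
theorem altM_dot [CharP K 2] {A : Matrix n n K} (hA : AltM A) (v : n → K) : v ⬝ᵥ (A *ᵥ v) = 0 := by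
  have : v ⬝ᵥ (A *ᵥ v) = ∑ p : n × n, v p.1 * (A p.1 p.2 * v p.2) := by
    simp [dotProduct, mulVec, Finset.mul_sum, Fintype.sum_prod_type]
  rw [this]
  refine Finset.sum_involution (fun p _ => p.swap) ?_ ?_ (by simp) (by simp)
  · intro p _
    have h : A p.2 p.1 = A p.1 p.2 := congrFun (congrFun hA.1 p.1) p.2
    simp only [Prod.fst_swap, Prod.snd_swap, h]
    have := CharTwo.add_self_eq_zero (v p.1 * (A p.1 p.2 * v p.2))
    linear_combination this
  · rintro ⟨i, j⟩ _ h1 h2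
    simp only [Prod.swap_prod_mk, Prod.mk.injEq] at h2
    obtain ⟨rfl, _⟩ := h2
    simp [hA.2] at h1
theorem altM_conj [CharP K 2] {A : Matrix n n K} (hA : AltM A) (P : Matrix n n K) : AltM (Pᵀ * A * P) := by
  refine ⟨by rw [transpose_mul, transpose_mul, transpose_transpose, hA.1, mul_assoc], fun i => ?_⟩
  have := altM_dot hA (P *ᵥ Pi.single i 1)
  rw [mulVec_mulVec, ← vecMul_transpose, ← dotProduct_mulVec, mulVec_mulVec, ← mul_assoc] at this
  simpa using this
theorem altM_map {A : Matrix n n F} (hA : AltM A) : AltM (A.map (algebraMap F K)) :=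
  ⟨by rw [← transpose_map, hA.1], fun i => by rw [Matrix.map_apply, hA.2, map_zero]⟩
/-- alternating endomorphisms -/
def IsAlt (J : Matrix n n F) (z : Matrix n n F) : Prop := AltM (J * z)
end transfer
end SG
end
section
namespace SG
set_option linter.all false
open Matrix
section diag
variable {n F K : Type} [Fintype n] [DecidableEq n] [Field F] [Field K] [Algebra F K]
theorem exists_diag [IsAlgClosed K] (A : Matrix n n F) (hsep : A.charpoly.Separable) :
    ∃ P : (Matrix n n K)ˣ, ∃ lam : n → K, Function.Injective lam ∧ TT P A = diagonal lam := by
  classical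
  set B := A.map (algebraMap F K) with hB
  have hs : B.charpoly.Separable := by rw [hB, charpoly_map]; exact hsep.map
  have hcard : B.charpoly.roots.toFinset.card = Fintype.card n := by
    rw [Multiset.toFinset_card_of_nodup (Polynomial.nodup_roots hs), IsAlgClosed.card_roots_eq_natDegree, charpoly_natDegree_eq_dim]
  let e : n ≃ B.charpoly.roots.toFinset := Fintype.equivOfCardEq (by simp [hcard])
  let lam : n → K := fun i => (e i : K)
  have hinj : Function.Injective lam := fun i j h => e.injective (Subtype.ext h)
  have hv : ∀ i, ∃ v : n → K, v ≠ 0 ∧ B *ᵥ v = lam i • v := by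
    intro i
    have h1 : (lam i) ∈ B.charpoly.roots := Multiset.mem_toFinset.1 (e i).2
    have h2 := (Polynomial.mem_roots'.1 h1).2
    rw [Polynomial.IsRoot, eval_charpoly] at h2
    obtain ⟨v, hv, h3⟩ := exists_mulVec_eq_zero_iff.2 h2
    refine ⟨v, hv, ?_⟩
    rw [sub_mulVec, sub_eq_zero, scalar_apply, ← smul_one_eq_diagonal, smul_mulVec, one_mulVec] at h3
    exact h3.symm
  choose v hv0 hv using hv
  have hli : LinearIndependent K v := by
    refine Module.End.eigenvectors_linearIndependent' (Matrix.toLin' B) lam hinj v fun i => ?_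
    rw [Module.End.hasEigenvector_iff, Module.End.mem_eigenspace_iff]
    exact ⟨by rw [toLin'_apply]; exact hv i, hv0 i⟩
  have hu : IsUnit (of v)ᵀ := by
    rw [← linearIndependent_cols_iff_isUnit]
    exact hli
  obtain ⟨P, hP⟩ := hu
  refine ⟨P, lam, hinj, ?_⟩
  have h4 : B * P.1 = P * diagonal lam := by
    rw [hP]
    ext i j
    rw [mul_diagonal]
    have := congrFun (hv j) i
    simp only [Pi.smul_apply, smul_eq_mul] at this
    rw [transpose_apply, of_apply, mul_comm, ← this]
    rfl
  rw [TT_apply, ← hB, mul_assoc, h4, ← mul_assoc, Units.inv_mul, one_mul]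
theorem diag_of_comm {lam : n → K} (hinj : Function.Injective lam) {z : Matrix n n K} (h : Commute z (diagonal lam)) : z = diagonal (fun i => z i i) := by
  ext i j
  by_cases hij : i = j
  · subst hij; simp
  · rw [diagonal_apply_ne _ hij]
    have := congrFun (congrFun h.eq i) j
    rw [mul_diagonal, diagonal_mul] at this
    have h2 : (lam i - lam j) * z i j = 0 := by linear_combination -this
    rcases mul_eq_zero.1 h2 with h3 | h3
    · exact absurd (hinj (sub_eq_zero.1 h3)) hij
    · exact h3
theorem scalar_of_span (S : Set (Matrix n n K)) (hS : Submodule.span K S = ⊤) (z : Matrix n n K) (hz : ∀ h ∈ S, Commute z h) : ∃ s : K, z = s • 1 := by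
  have h1 : ∀ A : Matrix n n K, Commute z A := by
    intro A
    have hA : A ∈ Submodule.span K S := by rw [hS]; trivial
    induction hA using Submodule.span_induction with
    | mem A h => exact hz A h
    | zero => exact Commute.zero_right _
    | add A B _ _ h1 h2 => exact h1.add_right h2
    | smul c A _ h1 => exact h1.smul_right c
  obtain ⟨s, hs⟩ := mem_range_scalar_of_commute_single (M := z) fun i j _ => (h1 _).symm
  exact ⟨s, by rw [← hs, scalar_apply, smul_one_eq_diagonal]⟩
theorem comm_closure {R : Type} [Ring R] {x y : Rˣ} {z : R} (hx : Commute z x) (hy : Commute z y) (h : Rˣ) (hh : h ∈ Subgroup.closure {x, y}) : Commute z h := by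
  induction hh using Subgroup.closure_induction with
  | mem g hg =>
    rcases hg with rfl | hg
    · exact hx
    · rw [Set.mem_singleton_iff.1 hg]; exact hy
  | one => simp
  | mul a b _ _ h1 h2 => rw [Units.val_mul]; exact h1.mul_right h2
  | inv a _ h1 => exact h1.units_inv_right
end diag
section thmC
variable {n F : Type} [Fintype n] [DecidableEq n] [Field F] [CharP F 2]
theorem thmC {J : Matrix n n F} (hJ : Sy J) (H : Subgroup (Matrix n n F)ˣ) (x y : (Matrix n n F)ˣ)
    (hxH : x ∈ H) (hyH : y ∈ H) (hcl : H ≤ Subgroup.closure {x, y}) (hx1 : adj J x.1 * x = 1)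
    (hspan : Submodule.span F ((fun h : (Matrix n n F)ˣ => (h : Matrix n n F)) '' H) = ⊤)
    (hsep : (x : Matrix n n F).charpoly.Separable) (N : ℕ) (hN : ∀ k, 0 < k → k ≤ Fintype.card n ^ Fintype.card n → k ∣ N)
    (hy : Cyc (y.1 ^ N)) (M : Submodule F (Matrix n n F))
    (hconj : ∀ h ∈ H, ∀ z ∈ M, h.1 * z * (h⁻¹).1 ∈ M)
    (hbr : ∀ z ∈ M, ∀ w ∈ M, z * w + w * z ∈ M) (halt : ∀ z ∈ M, IsAlt J z)
    (ε : Matrix n n F) (hε : Commute ε (x : Matrix n n F)) (hεε : ε * ε = ε) (hεa : adj J ε = ε)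
    (A : Matrix n (Fin 2) F) (B : Matrix (Fin 2) n F) (hAB : 1 - ε = A * B)
    (hM : ∀ j : ℕ, x.1 ^ j * ε + adj J (x.1 ^ j * ε) ∈ M) (hcard : 4 ≤ Fintype.card n)
    (z : Matrix n n F) (hz : IsAlt J z) : z ∈ M := by
  classical
  let K := AlgebraicClosure F
  haveI : CharP K 2 := charP_of_injective_algebraMap (algebraMap F K).injective 2
  obtain ⟨P, lam, hinj, hP⟩ := exists_diag (K := K) _ hsep
  set Jm := J.map (algebraMap F K) with hJm
  set J' := P.1ᵀ * Jm * P with hJ'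
  have hPP : ∀ C : Matrix n n K, P.1 * ((P⁻¹).1 * C) = C := by
    intro C; rw [← mul_assoc, Units.mul_inv, one_mul]
  have hJJ : ∀ C : Matrix n n K, Jm * (Jm * C) = C := by
    intro C; rw [← mul_assoc, hJm, ← Matrix.map_mul, hJ.sq]; simp
  have hadj : ∀ w : Matrix n n F, J' * TT P (adj J w) = (TT P w)ᵀ * J' := by
    intro w
    have h1 : (P⁻¹).1ᵀ * P.1ᵀ = 1 := by
      rw [← transpose_mul, Units.mul_inv, transpose_one]
    rw [TT_apply, TT_apply, hJ', adj, Matrix.map_mul, Matrix.map_mul, ← hJm, transpose_mul, transpose_mul, transpose_map]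
    simp only [mul_assoc]
    rw [hPP, hJJ]
    congr 2
    rw [← mul_assoc _ (P : Matrix n n K)ᵀ, h1, one_mul]
  have hal : ∀ w : Matrix n n F, IsAlt J w → AltM (J' * TT P w) := by
    intro w hw
    have : J' * TT P w = P.1ᵀ * (J * w).map (algebraMap F K) * P := by
      rw [TT_apply, hJ', Matrix.map_mul, ← hJm]
      simp only [mul_assoc]
      rw [hPP]
    rw [this]
    exact altM_conj (altM_map hw) _
  have hJalt : AltM J' := altM_conj (altM_map ⟨hJ.symm, hJ.diag⟩) _
  have hJu : IsUnit J' := by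
    have h1 : IsUnit (P : Matrix n n K)ᵀ := by
      rw [isUnit_transpose]; exact P.isUnit
    refine (h1.mul ?_).mul P.isUnit
    have h2 : IsUnit J := IsUnit.of_mul_eq_one J hJ.sq
    exact h2.map (algebraMap F K).mapMatrix
  have hlam : ∀ i j, J' i j = lam i * J' i j * lam j := by
    intro i j
    have h1 : J' = (diagonal lam) * J' * diagonal lam := by
      have h2 : (TT P (x : Matrix n n F))ᵀ * J' * TT P x.1 = J' := by
        rw [← hadj, mul_assoc, ← map_mul, hx1, map_one, mul_one]
      rw [hP, diagonal_transpose] at h2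
      exact h2.symm
    have h3 := congrFun (congrFun h1 i) j
    rwa [mul_diagonal, diagonal_mul] at h3
  have hex : ∀ i, ∃ j, J' i j ≠ 0 := by
    intro i
    by_contra hcon
    push Not at hcon
    obtain ⟨C, hC⟩ := hJu.exists_right_inv
    have h4 := congrFun (congrFun hC i) i
    rw [Matrix.mul_apply, Matrix.one_apply_eq] at h4
    simp [hcon] at h4
  choose σ hσ using hex
  have hlm : ∀ i j, J' i j ≠ 0 → lam i * lam j = 1 := by
    intro i j h
    have := hlam i j
    have h2 : J' i j * (lam i * lam j - 1) = 0 := by linear_combination -this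
    exact sub_eq_zero.1 ((mul_eq_zero.1 h2).resolve_left h)
  have h0 : ∀ i, lam i ≠ 0 := by
    intro i h
    have := hlm i _ (hσ i)
    rw [h, zero_mul] at this
    exact zero_ne_one this
  have huniq : ∀ i j, J' i j ≠ 0 → j = σ i := by
    intro i j h
    have h1 := hlm i j h
    have h2 := hlm i _ (hσ i)
    exact hinj (mul_left_cancel₀ (h0 i) (h1.trans h2.symm))
  have hsymm : ∀ i j, J' i j = J' j i := fun i j => congrFun (congrFun hJalt.1 j) i
  have hσσ : ∀ i, σ (σ i) = i := fun i => (huniq (σ i) i (by rw [hsymm]; exact hσ i)).symm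
  have hσ1 : ∀ i, σ i ≠ i := fun i h => hσ i (by rw [h]; exact hJalt.2 i)
  have hσinj : Function.Injective σ := fun i j h => by rw [← hσσ i, h, hσσ]
  let c : n → K := fun i => J' i (σ i)
  have hcs : ∀ i, c (σ i) = c i := by
    intro i
    change J' (σ i) (σ (σ i)) = J' i (σ i)
    rw [hσσ, hsymm]
  have hmulJ : ∀ (T : Matrix n n K) i j, (J' * T) i j = c i * T (σ i) j := by
    intro T i j
    rw [Matrix.mul_apply, Finset.sum_eq_single (σ i)]
    · intro k _ hk
      by_cases h : J' i k = 0
      · rw [h, zero_mul]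
      · exact absurd (huniq i k h) hk
    · simp
  have hal1 : ∀ T : Matrix n n K, AltM (J' * T) → ∀ i, T i (σ i) = 0 := by
    intro T hT i
    have := hT.2 (σ i)
    rw [hmulJ, hσσ] at this
    exact (mul_eq_zero.1 this).resolve_left (hσ _)
  have hal2 : ∀ T : Matrix n n K, AltM (J' * T) → ∀ i j, c i * T i j = c j * T (σ j) (σ i) := by
    intro T hT i j
    have := congrFun (congrFun hT.1 j) (σ i)
    rw [transpose_apply, hmulJ, hmulJ, hσσ, hcs] at this
    exact this
  let M' : Submodule K (Matrix n n K) := Submodule.span K (TT P '' (M : Set (Matrix n n F)))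
  have hM'alt : ∀ T ∈ M', AltM (J' * T) := by
    intro T hT
    induction hT using Submodule.span_induction with
    | mem T h => obtain ⟨w, hw, rfl⟩ := h; exact hal w (halt w hw)
    | zero => rw [mul_zero]; exact ⟨by simp, by simp⟩
    | add T U _ _ h1 h2 =>
      rw [mul_add]
      exact ⟨by rw [transpose_add, h1.1, h2.1], fun i => by rw [Matrix.add_apply, h1.2, h2.2, add_zero]⟩
    | smul s T _ h1 =>
      rw [mul_smul_comm]
      exact ⟨by rw [transpose_smul, h1.1], fun i => by rw [Matrix.smul_apply, h1.2, smul_zero]⟩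
  let U : (Matrix n n F)ˣ →* (Matrix n n K)ˣ := Units.map (TT P : Matrix n n F →+* Matrix n n K).toMonoidHom
  have hU : ∀ h, ((U h : (Matrix n n K)ˣ) : Matrix n n K) = TT P (h : Matrix n n F) := fun h => rfl
  let H' := H.map U
  have hspan' : Submodule.span K ((fun h : (Matrix n n K)ˣ => (h : Matrix n n K)) '' H') = ⊤ := by
    rw [← TT_span P _ hspan]
    congr 1
    ext B
    simp only [Set.mem_image, SetLike.mem_coe, H', Subgroup.mem_map]
    constructor
    · rintro ⟨_, ⟨h, hh, rfl⟩, rfl⟩; exact ⟨h, ⟨h, hh, rfl⟩, rfl⟩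
    · rintro ⟨_, ⟨h, hh, rfl⟩, rfl⟩; exact ⟨U h, ⟨h, hh, rfl⟩, rfl⟩
  -- the idempotent
  have hεd : TT P ε = diagonal (fun i => TT P ε i i) := by
    refine diag_of_comm hinj ?_
    rw [← hP]
    exact hε.map (TT P : Matrix n n F →+* Matrix n n K)
  set e : n → K := fun i => TT P ε i i with he
  have hee : ∀ i, e i = 0 ∨ e i = 1 := by
    intro i
    have h1 : TT P ε * TT P ε = TT P ε := by rw [← map_mul, hεε]
    rw [hεd, diagonal_mul_diagonal] at h1
    have h2 := congrFun (diagonal_injective h1) i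
    have h3 : e i * (e i - 1) = 0 := by linear_combination h2
    rcases mul_eq_zero.1 h3 with h | h
    · exact Or.inl h
    · exact Or.inr (sub_eq_zero.1 h)
  have heσ : ∀ i, e (σ i) = e i := by
    intro i
    have h1 := hadj ε
    rw [hεa, hεd, diagonal_transpose] at h1
    have h2 := congrFun (congrFun h1 i) (σ i)
    rw [mul_diagonal, diagonal_mul] at h2
    have h3 : J' i (σ i) * (e (σ i) - e i) = 0 := by linear_combination h2
    exact sub_eq_zero.1 ((mul_eq_zero.1 h3).resolve_left (hσ i))
  have hrank : Fintype.card {i // e i = 0} ≤ 2 := by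
    have h1 : (1 : Matrix n n K) - TT P ε = ((P⁻¹).1 * A.map (algebraMap F K)) * (B.map (algebraMap F K) * P.1) := by
      rw [← map_one (TT P : Matrix n n F →+* Matrix n n K), ← map_sub, hAB, TT_apply, Matrix.map_mul]
      simp only [Matrix.mul_assoc]
    have h2 : ((1 : Matrix n n K) - TT P ε).rank ≤ 2 := by
      rw [h1]
      refine (rank_mul_le_left _ _).trans ((rank_le_card_width _).trans (by rw [Fintype.card_fin]))
    have h3 : (1 : Matrix n n K) - TT P ε = diagonal (fun i => 1 - e i) := by
      rw [hεd, ← diagonal_one, diagonal_sub]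
    rw [h3, rank_diagonal] at h2
    refine le_trans (le_of_eq (Fintype.card_congr (Equiv.subtypeEquivRight fun i => ?_))) h2
    rcases hee i with h | h <;> simp [h]
  have hane : Nonempty n := Fintype.card_pos_iff.1 (by omega)
  obtain ⟨a, ha⟩ : ∃ a, ∀ k, k ≠ a → k ≠ σ a → e k = 1 := by
    by_cases hz : ∃ a, e a = 0
    · obtain ⟨a, ha⟩ := hz
      refine ⟨a, fun k hka hks => (hee k).resolve_left fun hk => ?_⟩
      have h1 : ({a, σ a, k} : Finset n) ⊆ Finset.univ.filter (fun i => e i = 0) := by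
        intro i hi
        simp only [Finset.mem_insert, Finset.mem_singleton] at hi
        simp only [Finset.mem_filter, Finset.mem_univ, true_and]
        rcases hi with rfl | rfl | rfl
        · exact ha
        · rw [heσ, ha]
        · exact hk
      have h2 := Finset.card_le_card h1
      rw [← Fintype.card_subtype, Finset.card_insert_of_notMem, Finset.card_insert_of_notMem, Finset.card_singleton] at h2
      · omega
      · simpa using hks.symm
      · simp only [Finset.mem_insert, Finset.mem_singleton, not_or]
        exact ⟨(hσ1 a).symm, hka.symm⟩
    · push Not at hz
      obtain ⟨a⟩ := hane
      exact ⟨a, fun k _ _ => (hee k).resolve_left (hz k)⟩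
  have hbl : ∀ k, k ≠ a → k ≠ σ a → diagonal (bl σ k) ∈ M' := by
    intro k h1 h2
    have hek := ha k h1 h2
    set L := Lagrange.basis Finset.univ lam k with hL
    set E1 := ∑ j ∈ L.support, L.coeff j • TT P (x.1 ^ j * ε) with hE1
    set E2 := ∑ j ∈ L.support, L.coeff j • TT P (adj J (x.1 ^ j * ε)) with hE2
    have hmem : E1 + E2 ∈ M' := by
      rw [hE1, hE2, ← Finset.sum_add_distrib]
      refine Submodule.sum_mem _ fun j _ => ?_
      rw [← smul_add, ← map_add]
      exact Submodule.smul_mem _ _ (Submodule.subset_span ⟨_, hM j, rfl⟩)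
    have h3 : E1 = diagonal (Pi.single k 1) := by
      have : ∀ j : ℕ, TT P (x.1 ^ j * ε) = diagonal (fun i => lam i ^ j * e i) := by
        intro j
        rw [map_mul, map_pow, hP, hεd, diagonal_pow, diagonal_mul_diagonal]; rfl
      simp only [this] at hE1
      ext i j
      rw [hE1, Matrix.sum_apply]
      by_cases hij : i = j
      · subst hij
        simp only [Matrix.smul_apply, diagonal_apply_eq, smul_eq_mul]
        have h4 : ∑ j ∈ L.support, L.coeff j * (lam i ^ j * e i) = L.eval (lam i) * e i := by
          rw [Polynomial.eval_eq_sum, Polynomial.sum, Finset.sum_mul]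
          exact Finset.sum_congr rfl fun j _ => by ring
        rw [h4]
        by_cases hik : i = k
        · subst hik
          rw [hL, Lagrange.eval_basis_self (hinj.injOn) (Finset.mem_univ _), hek]; simp
        · rw [hL, Lagrange.eval_basis_of_ne (Ne.symm hik) (Finset.mem_univ _), Pi.single_eq_of_ne hik, zero_mul]
      · simp [diagonal_apply_ne _ hij]
    have h4 : J' * E2 = E1ᵀ * J' := by
      rw [hE2, hE1, Finset.mul_sum, transpose_sum, Finset.sum_mul]
      refine Finset.sum_congr rfl fun j _ => ?_
      rw [mul_smul_comm, hadj, transpose_smul, smul_mul_assoc]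
    have h5 : E2 = diagonal (Pi.single (σ k) 1) := by
      refine hJu.mul_left_cancel ?_
      rw [h4, h3, diagonal_transpose]
      ext i j
      rw [mul_diagonal, diagonal_mul]
      by_cases hJ0 : J' i j = 0
      · rw [hJ0]; simp
      · rw [huniq i j hJ0]
        by_cases hik : i = k
        · subst hik; simp
        · rw [Pi.single_eq_of_ne hik, Pi.single_eq_of_ne (fun h => hik (hσinj h))]; simp
    rw [h3, h5, diagonal_add] at hmem
    suffices hbe : bl σ k = fun i => (Pi.single k (1:K) : n → K) i + (Pi.single (σ k) (1:K) : n → K) i by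
      rw [hbe]; exact hmem
    ext i
    simp only [bl, Pi.single_apply]
    by_cases h1 : i = k
    · subst h1; simp [(hσ1 i).symm]
    · simp [h1]
  have D : LD H' M' (U x) (U y) lam σ c a :=
    { span := hspan'
      xH := ⟨x, hxH, rfl⟩
      yH := ⟨y, hyH, rfl⟩
      x_eq := by rw [hU, hP]
      h0 := h0
      hinj := hinj
      hσ := hσσ
      hσ1 := hσ1
      hls := fun i => eq_inv_of_mul_eq_one_right (hlm i _ (hσ i))
      hc := hσ
      hcs := hcs
      conj := by
        rintro _ ⟨h, hh, rfl⟩ T hT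
        induction hT using Submodule.span_induction with
        | mem T hT =>
          obtain ⟨w, hw, rfl⟩ := hT
          rw [← map_inv, hU, hU, ← map_mul, ← map_mul]
          exact Submodule.subset_span ⟨_, hconj h hh w hw, rfl⟩
        | zero => simp
        | add T V _ _ h1 h2 => rw [mul_add, add_mul]; exact Submodule.add_mem _ h1 h2
        | smul s T _ h1 => rw [mul_smul_comm, smul_mul_assoc]; exact Submodule.smul_mem _ _ h1
      br := by
        intro T hT V hV
        induction hT using Submodule.span_induction with
        | mem T hT =>
          obtain ⟨w, hw, rfl⟩ := hT
          induction hV using Submodule.span_induction with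
          | mem V hV =>
            obtain ⟨v, hv, rfl⟩ := hV
            rw [← map_mul, ← map_mul, ← map_add]
            exact Submodule.subset_span ⟨_, hbr w hw v hv, rfl⟩
          | zero => simp
          | add T V _ _ h1 h2 =>
            rw [mul_add, add_mul, add_add_add_comm]; exact Submodule.add_mem _ h1 h2
          | smul s T _ h1 => rw [mul_smul_comm, smul_mul_assoc, ← smul_add]; exact Submodule.smul_mem _ _ h1
        | zero => simp
        | add T V _ _ h1 h2 =>
          rw [mul_add, add_mul, add_add_add_comm]; exact Submodule.add_mem _ h1 h2
        | smul s T _ h1 => rw [mul_smul_comm, smul_mul_assoc, ← smul_add]; exact Submodule.smul_mem _ _ h1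
      alt1 := fun T hT => hal1 T (hM'alt T hT)
      alt2 := fun T hT => hal2 T (hM'alt T hT)
      he := hbl
      hZ := by
        rintro w hwx ⟨k, hk0, hk1, hwk⟩
        obtain ⟨r, hr⟩ := hN k hk0 hk1
        have h1 : Commute w ((U y : Matrix n n K) ^ N) := by
          rw [hr, pow_mul]; exact hwk.pow_right _
        have hcyc : Cyc ((U y : Matrix n n K) ^ N) := by
          rw [hU, ← map_pow]; exact TT_cyc P _ hy
        have h2 : Commute w (U y : Matrix n n K) := cyc_comm hcyc h1 ((Commute.refl _).pow_right _)
        refine scalar_of_span _ hspan' w ?_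
        rintro _ ⟨_, ⟨h, hh, rfl⟩, rfl⟩
        refine comm_closure hwx h2 _ ?_
        have h3 := Subgroup.mem_map_of_mem U (hcl hh)
        rw [MonoidHom.map_closure, Set.image_pair] at h3
        exact h3
      hm := by
        have h1 : ({a, σ a} : Finset n).card < (Finset.univ : Finset n).card := by
          refine lt_of_le_of_lt (Finset.card_le_two) ?_
          rw [Finset.card_univ]; omega
        obtain ⟨k, _, hk⟩ := Finset.exists_mem_notMem_of_card_lt_card h1
        simp only [Finset.mem_insert, Finset.mem_singleton, not_or] at hk
        exact ⟨k, hk.1, hk.2⟩ }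
  have hzz := hal z hz
  exact TT_descend P M z (D.main _ (hal1 _ hzz) (hal2 _ hzz))
end thmC
end SG
end
section
namespace SG
set_option linter.all false
open Matrix
section quad
variable {n F : Type} [Fintype n] [DecidableEq n] [Field F] [Fintype F] [CharP F 2]
structure IsQ (J : Matrix n n F) (Q : (n → F) → F) : Prop where
  add : ∀ v w, Q (v + w) = Q v + Q w + om J v w
  smul : ∀ (c : F) v, Q (c • v) = c ^ 2 * Q v
theorem IsQ.zero {J : Matrix n n F} {Q} (h : IsQ J Q) : Q 0 = 0 := by
  have := h.smul 0 0
  simpa using this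
theorem sq_inj (a b : F) (h : a ^ 2 = b ^ 2) : a = b := CharTwo.sq_injective h
theorem sq_add (a b : F) : (a + b) ^ 2 = a ^ 2 + b ^ 2 := CharTwo.add_sq a b
noncomputable def rt (a : F) : F := (char2_sqrt a).choose
theorem rt_sq (a : F) : rt a ^ 2 = a := (char2_sqrt a).choose_spec
theorem lin_vec (g : (n → F) → F) (ha : ∀ v w, g (v + w) = g v + g w) (hs : ∀ (c : F) v, g (c • v) = c * g v) :
    ∃ f : n → F, ∀ v, g v = f ⬝ᵥ v := by
  let L : (n → F) →ₗ[F] F := { toFun := g, map_add' := ha, map_smul' := hs }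
  refine ⟨fun i => g (Pi.single i 1), fun v => ?_⟩
  have h1 : L v = _ := LinearMap.pi_apply_eq_sum_univ L v
  change L v = _
  rw [h1, dotProduct]
  refine Finset.sum_congr rfl fun i _ => ?_
  rw [smul_eq_mul, mul_comm]
  have h2 : (fun j => if i = j then (1:F) else 0) = Pi.single i 1 := by
    ext j; simp [Pi.single_apply, eq_comm]
  rw [h2]; rfl
theorem cadd (a b c : F) (h : a + b = c) : b = a + c := by
  rw [← h, ← add_assoc, CharTwo.add_self_eq_zero, zero_add]
theorem difQ {J : Matrix n n F} {Q Q'} (h : IsQ J Q) (h' : IsQ J Q') : ∃ f : n → F, ∀ v, Q' v = Q v + (f ⬝ᵥ v) ^ 2 := by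
  obtain ⟨f, hf⟩ := lin_vec (fun v => rt (Q v + Q' v)) (fun v w => by
      refine sq_inj _ _ ?_
      rw [sq_add, rt_sq, rt_sq, rt_sq, h.add, h'.add]
      linear_combination CharTwo.add_self_eq_zero (om J v w))
    (fun c v => by
      refine sq_inj _ _ ?_
      rw [mul_pow, rt_sq, rt_sq, h.smul, h'.smul]; ring)
  refine ⟨f, fun v => ?_⟩
  rw [← hf, rt_sq]
  linear_combination -CharTwo.add_self_eq_zero (Q v)
theorem IsQ.add_sq {J : Matrix n n F} {Q} (h : IsQ J Q) (f : n → F) : IsQ J (fun v => Q v + (f ⬝ᵥ v) ^ 2) := by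
  refine ⟨fun v w => ?_, fun c v => ?_⟩
  · simp only [h.add, dotProduct_add, SG.sq_add]; ring
  · simp only [h.smul, dotProduct_smul, smul_eq_mul]; ring
theorem IsQ.comp {J : Matrix n n F} {Q} (h : IsQ J Q) (A : Matrix n n F) (hA : ∀ v w, om J (A *ᵥ v) (A *ᵥ w) = om J v w) : IsQ J (fun v => Q (A *ᵥ v)) := by
  refine ⟨fun v w => ?_, fun c v => ?_⟩
  · simp only [mulVec_add, h.add, hA]
  · simp only [mulVec_smul, h.smul]
theorem dot_ext0 (f : n → F) (h : ∀ v, f ⬝ᵥ v = 0) : f = 0 := dotProduct_eq_zero _ h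
theorem exists_invQ {J : Matrix n n F} {Q} (h : IsQ J Q) (A : Matrix n n F) (hA : ∀ v w, om J (A *ᵥ v) (A *ᵥ w) = om J v w)
    (hA1 : IsUnit (A - 1)) : ∃ Q', IsQ J Q' ∧ ∀ v, Q' (A *ᵥ v) = Q' v := by
  obtain ⟨f, hf⟩ := difQ h (h.comp A hA)
  obtain ⟨u, hu⟩ := hA1
  set g := f ᵥ* (u⁻¹).1 with hg
  refine ⟨_, h.add_sq g, fun v => ?_⟩
  have h1 : g ⬝ᵥ (A *ᵥ v) = g ⬝ᵥ v + f ⬝ᵥ v := by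
    have h2 : A *ᵥ v = v + u.1 *ᵥ v := by
      rw [hu, sub_mulVec, one_mulVec]; abel
    rw [h2, dotProduct_add, dotProduct_mulVec g, hg, vecMul_vecMul, Units.inv_mul, vecMul_one]
  simp only [hf, h1, SG.sq_add]
  linear_combination CharTwo.add_self_eq_zero ((f ⬝ᵥ v)^2)
theorem invQ_unique {J : Matrix n n F} {Q Q'} (h : IsQ J Q) (h' : IsQ J Q') (A : Matrix n n F) (hA1 : IsUnit (A - 1))
    (hQ : ∀ v, Q (A *ᵥ v) = Q v) (hQ' : ∀ v, Q' (A *ᵥ v) = Q' v) : Q' = Q := by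
  obtain ⟨f, hf⟩ := difQ h h'
  obtain ⟨u, hu⟩ := hA1
  have h1 : f ᵥ* u.1 = 0 := by
    refine dot_ext0 _ fun v => ?_
    have h2 := hQ' v
    rw [hf, hf, hQ] at h2
    have h3 := sq_inj _ _ (add_left_cancel h2)
    rw [← dotProduct_mulVec, hu, sub_mulVec, one_mulVec, dotProduct_sub, h3, sub_self]
  have h2 : f = 0 := by
    have := congrArg (fun g => g ᵥ* (u⁻¹).1) h1
    simpa [vecMul_vecMul] using this
  ext v
  rw [hf, h2]; simp
/-- a W stable under A with A-1 invertible, totally isotropic -/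
theorem Q_zero {J : Matrix n n F} {Q} (h : IsQ J Q) (A : Matrix n n F) (hA1 : IsUnit (A - 1)) (hQ : ∀ v, Q (A *ᵥ v) = Q v)
    (W : Submodule F (n → F)) (hW : ∀ w ∈ W, A *ᵥ w ∈ W) (hti : ∀ v ∈ W, ∀ w ∈ W, om J v w = 0) : ∀ w ∈ W, Q w = 0 := by
  obtain ⟨u, hu⟩ := hA1
  let T : W →ₗ[F] W := (Matrix.toLin' (A - 1)).restrict (fun w hw => by
    rw [toLin'_apply, sub_mulVec, one_mulVec]; exact W.sub_mem (hW w hw) hw)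
  have hT : ∀ w : W, ((T w : W) : n → F) = (A - 1) *ᵥ (w : n → F) := fun w => by
    rw [← toLin'_apply]; rfl
  have hinj : Function.Injective T := by
    intro a b hab
    have h1 := congrArg (fun w : W => (w : n → F)) hab
    simp only [hT] at h1
    rw [← hu] at h1
    have := congrArg (fun g => (u⁻¹).1 *ᵥ g) h1
    simp only [mulVec_mulVec, Units.inv_mul, one_mulVec] at this
    exact Subtype.ext this
  have hsurj := LinearMap.injective_iff_surjective.1 hinj
  intro w hw
  obtain ⟨v, hv⟩ := hsurj ⟨w, hw⟩
  have h1 : w = A *ᵥ (v : n → F) + (v : n → F) := by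
    have := congrArg (fun w : W => (w : n → F)) hv
    simp only [hT] at this
    rw [← this, sub_mulVec, one_mulVec]
    ext i
    rw [Pi.sub_apply, Pi.add_apply, CharTwo.sub_eq_add]
  rw [h1, h.add, hQ, hti _ (hW _ v.2) _ v.2, CharTwo.add_self_eq_zero, zero_add]
theorem exists_char : ∃ ψ : AddChar F ℤ, ψ ≠ 1 := by
  haveI : Algebra (ZMod 2) F := ZMod.algebra F 2
  let τ : F →+ ZMod 2 := (Algebra.trace (ZMod 2) F).toAddMonoidHom
  let χ : AddChar (ZMod 2) ℤ := AddChar.zmodChar 2 (ζ := -1) (by norm_num)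
  refine ⟨χ.compAddMonoidHom τ, ?_⟩
  haveI : FiniteDimensional (ZMod 2) F := Module.Finite.of_finite
  obtain ⟨a, ha⟩ := Algebra.trace_surjective (ZMod 2) F 1
  intro h
  have h1 : χ (τ a) = 1 := by
    rw [← AddChar.compAddMonoidHom_apply, h]; rfl
  have h2 : τ a = 1 := ha
  rw [h2] at h1
  have h3 : χ 1 = (-1) ^ (1 : ZMod 2).val := AddChar.zmodChar_apply _ _
  rw [h3] at h1
  have : (1 : ZMod 2).val = 1 := by decide
  rw [this] at h1
  norm_num at h1
noncomputable def psi (F : Type) [Field F] [Fintype F] [CharP F 2] : AddChar F ℤ := (exists_char (F := F)).choose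
theorem psi_ne : psi F ≠ 1 := (exists_char (F := F)).choose_spec
noncomputable def SS (Q : (n → F) → F) : ℤ := ∑ v, psi F (Q v)
theorem SS_comp (Q : (n → F) → F) (g : (Matrix n n F)ˣ) : SS (fun v => Q (g.1 *ᵥ v)) = SS Q := by
  let e : (n → F) ≃ (n → F) :=
    { toFun := fun v => g.1 *ᵥ v
      invFun := fun v => (g⁻¹).1 *ᵥ v
      left_inv := fun v => by simp [mulVec_mulVec]
      right_inv := fun v => by simp [mulVec_mulVec] }
  exact Equiv.sum_comp e (fun v => psi F (Q v))
theorem SS_pos {J : Matrix n n F} (hJ : Sy J) {Q} (h : IsQ J Q) (W : Submodule F (n → F)) (hW : ∀ v, v ∈ W ↔ ∀ w ∈ W, om J v w = 0)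
    (hQ : ∀ w ∈ W, Q w = 0) : 0 < SS Q := by
  classical
  have h1 : ∀ w : W, ∑ v, psi F (Q (v + w)) = SS Q := fun w => Equiv.sum_comp (Equiv.addRight (w : n → F)) (fun v => psi F (Q v))
  have h2 : ∑ w : W, ∑ v, psi F (Q (v + w)) = (Fintype.card W : ℤ) * SS Q := by
    simp [h1]
  have h3 : ∑ w : W, ∑ v, psi F (Q (v + w)) = ∑ v, psi F (Q v) * ∑ w : W, psi F (om J v w) := by
    rw [Finset.sum_comm]
    refine Finset.sum_congr rfl fun v _ => ?_
    rw [Finset.mul_sum]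
    refine Finset.sum_congr rfl fun w _ => ?_
    rw [h.add, hQ w w.2, add_zero, AddChar.map_add_eq_mul]
  have h4 : ∀ v, v ∉ W → ∑ w : W, psi F (om J v w) = 0 := by
    intro v hv
    rw [hW] at hv
    push Not at hv
    obtain ⟨w0, hw0, hne⟩ := hv
    let g : W →+ F := AddMonoidHom.mk' (fun w => om J v w) (fun a b => om_add_right _ _ _)
    let χ : AddChar W ℤ := (psi F).compAddMonoidHom g
    have hχ : χ ≠ 1 := by
      intro hc
      refine psi_ne (F := F) ?_
      ext a
      have h5 : χ ((a * (om J v w0)⁻¹) • ⟨w0, hw0⟩) = 1 := by rw [hc]; rfl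
      have h6 : om J v ((((a * (om J v w0)⁻¹) • (⟨w0, hw0⟩ : W) : W)) : n → F) = a := by
        rw [Submodule.coe_smul, om_smul_right, mul_assoc, inv_mul_cancel₀ hne, mul_one]
      change psi F (om J v _) = 1 at h5
      rw [h6] at h5
      rw [h5]; rfl
    exact AddChar.sum_eq_zero_of_ne_one hχ
  have h5 : ∀ v, v ∈ W → psi F (Q v) * ∑ w : W, psi F (om J v w) = Fintype.card W := by
    intro v hv
    rw [hQ v hv, AddChar.map_zero_eq_one, one_mul]
    have : ∀ w : W, psi F (om J v w) = 1 := fun w => by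
      rw [(hW v).1 hv w w.2, AddChar.map_zero_eq_one]
    simp [this]
  have h6 : ∑ v, psi F (Q v) * ∑ w : W, psi F (om J v w) = (Fintype.card W : ℤ) * Fintype.card W := by
    have : ∀ v, psi F (Q v) * ∑ w : W, psi F (om J v w) = if v ∈ W then (Fintype.card W : ℤ) else 0 := by
      intro v
      split_ifs with hv
      · exact h5 v hv
      · rw [h4 v hv, mul_zero]
    simp only [this]
    rw [← Finset.sum_filter, Finset.sum_const, nsmul_eq_mul]
    congr 2
    rw [← Fintype.card_subtype]
  have h7 : (0 : ℤ) < Fintype.card W := by exact_mod_cast Fintype.card_pos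
  have h8 : SS Q = Fintype.card W := by
    rw [h2, h6] at h3
    exact mul_left_cancel₀ h7.ne' h3
  rw [h8]; exact h7
end quad
end SG
end
section
namespace SG
set_option linter.all false
open Matrix
section dens
variable {n F : Type} [Fintype n] [DecidableEq n] [Field F]
theorem dens0 {V : Type} [AddCommGroup V] [Module F V] (B : Subalgebra F (Module.End F V)) [IsSimpleModule B V]
    (hsc : ∀ f : Module.End B V, ∃ s : F, ∀ v, f v = s • v) (b : Module.Basis n F V) (T : Module.End F V) : T ∈ B := by
  classical
  let g : Module.End (Module.End B V) V :=
    { toFun := T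
      map_add' := T.map_add
      map_smul' := fun f v => by
        obtain ⟨s, hs⟩ := hsc f
        simp only [Module.End.smul_def, RingHom.id_apply, hs, T.map_smul] }
  obtain ⟨r, hr⟩ := jacobson_density g (Finset.univ.image b)
  have : T = (r : Module.End F V) := by
    refine b.ext fun i => ?_
    exact hr (b i) (Finset.mem_image_of_mem _ (Finset.mem_univ i))
  rw [this]; exact r.2
theorem density [Nonempty n] (H : Subgroup (Matrix n n F)ˣ)
    (hirr : ∀ W : Submodule F (n → F), (∀ h ∈ H, ∀ w ∈ W, h.1 *ᵥ w ∈ W) → W = ⊥ ∨ W = ⊤)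
    (hend : ∀ z : Matrix n n F, (∀ h ∈ H, Commute z (h : Matrix n n F)) → ∃ s : F, z = s • 1) :
    Submodule.span F ((fun h : (Matrix n n F)ˣ => (h : Matrix n n F)) '' H) = ⊤ := by
  let V := n → F
  let Hm : Submonoid (Module.End F V) := (H.toSubmonoid.map (Units.coeHom (Matrix n n F))).map (Matrix.toLinAlgEquiv' : Matrix n n F ≃ₐ[F] _).toAlgHom.toRingHom.toMonoidHom
  let B : Subalgebra F (Module.End F V) := Algebra.adjoin F (Hm : Set (Module.End F V))
  have hmem : ∀ h ∈ H, Matrix.toLinAlgEquiv' h.1 ∈ B := fun h hh =>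
    Algebra.subset_adjoin ⟨(h : Matrix n n F), ⟨h, hh, rfl⟩, rfl⟩
  have hsm : ∀ (b : B) (v : V), b • v = (b : Module.End F V) v := fun b v => rfl
  haveI : Nontrivial V := inferInstance
  haveI : IsSimpleModule B V := by
    refine { eq_bot_or_eq_top := fun W => ?_, toNontrivial := inferInstance }
    have h1 := hirr (W.restrictScalars F) (fun h hh w hw => by
      have := W.smul_mem ⟨_, hmem h hh⟩ hw
      exact this)
    rcases h1 with h1 | h1
    · left
      rwa [Submodule.restrictScalars_eq_bot_iff] at h1
    · right
      rwa [Submodule.restrictScalars_eq_top_iff] at h1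
  have key : ∀ T : Module.End F V, T ∈ B := by
    intro T
    have hsc : ∀ f : Module.End B V, ∃ s : F, ∀ v, f v = s • v := by
      intro f
      let f' : Module.End F V := f.restrictScalars F
      obtain ⟨s, hs⟩ := hend (LinearMap.toMatrix' f') (fun h hh => by
        apply (Matrix.toLinAlgEquiv' : Matrix n n F ≃ₐ[F] _).injective
        rw [map_mul, map_mul]
        refine LinearMap.ext fun v => ?_
        have h2 : Matrix.toLinAlgEquiv' (LinearMap.toMatrix' f') = f' := Matrix.toLin'_toMatrix' f'
        rw [h2]
        exact f.map_smul (⟨_, hmem h hh⟩ : B) v)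
      refine ⟨s, fun v => ?_⟩
      have h3 : Matrix.toLin' (LinearMap.toMatrix' f') = f' := Matrix.toLin'_toMatrix' f'
      have h4 : f v = Matrix.toLin' (LinearMap.toMatrix' f') v := by rw [h3]; rfl
      rw [h4, hs]
      simp
    exact dens0 B hsc (Pi.basisFun F n) T
  rw [eq_top_iff]
  intro A _
  have hA := key (Matrix.toLinAlgEquiv' A)
  have hB : Matrix.toLinAlgEquiv' A ∈ Submodule.span F (Hm : Set (Module.End F V)) := by
    have h5 := Algebra.adjoin_eq_span F (Hm : Set (Module.End F V))
    rw [Submonoid.closure_eq] at h5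
    rw [← h5]; exact hA
  have h6 : ∀ T ∈ Submodule.span F (Hm : Set (Module.End F V)), (Matrix.toLinAlgEquiv' : Matrix n n F ≃ₐ[F] _).symm T ∈ Submodule.span F ((fun h : (Matrix n n F)ˣ => (h : Matrix n n F)) '' H) := by
    intro T hT
    induction hT using Submodule.span_induction with
    | mem T h =>
      obtain ⟨_, ⟨h, hh, rfl⟩, rfl⟩ := h
      refine Submodule.subset_span ⟨h, hh, ?_⟩
      exact ((Matrix.toLinAlgEquiv' : Matrix n n F ≃ₐ[F] _).symm_apply_apply _).symm
    | zero => simp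
    | add T V _ _ h1 h2 => rw [map_add]; exact Submodule.add_mem _ h1 h2
    | smul s T _ h1 => rw [map_smul]; exact Submodule.smul_mem _ _ h1
  have := h6 _ hB
  rwa [AlgEquiv.symm_apply_apply] at this
theorem cyc_adjoin {A : Matrix n n F} (hA : Cyc A) {z : Matrix n n F} (hz : Commute z A) : z ∈ Algebra.adjoin F {A} := by
  have hA' := hA
  obtain ⟨v, hv⟩ := hA
  have hdet := (Matrix.isUnit_iff_isUnit_det _).1 hv
  have h1 : z *ᵥ v = cycM A v *ᵥ ((cycM A v)⁻¹ *ᵥ (z *ᵥ v)) := by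
    rw [mulVec_mulVec (z *ᵥ v), mul_nonsing_inv _ hdet, one_mulVec]
  rw [cyc_mulVec] at h1
  set p := ∑ j, ((cycM A v)⁻¹ *ᵥ (z *ᵥ v)) j • A ^ (Fintype.equivFin n j : ℕ) with hp
  have hpc : Commute p A := by
    exact Commute.sum_left _ _ _ fun j _ => ((Commute.refl A).pow_left _).smul_left _
  have h2 : z * cycM A v = p * cycM A v := by
    refine Matrix.ext_of_mulVec_single fun j => ?_
    rw [← mulVec_mulVec, ← mulVec_mulVec, cyc_mulVec]
    have h3 : ∀ w : Matrix n n F, Commute w A → Commute w (∑ i, (Pi.single j 1 : n → F) i • A ^ (Fintype.equivFin n i : ℕ)) := fun w hw =>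
      Commute.sum_right _ _ _ fun j _ => (hw.pow_right _).smul_right _
    rw [mulVec_mulVec, mulVec_mulVec, (h3 z hz).eq, (h3 p hpc).eq, ← mulVec_mulVec, ← mulVec_mulVec, h1]
  have h4 : z = p := hv.mul_right_cancel h2
  have h5 : A ∈ Algebra.adjoin F {A} := Algebra.self_mem_adjoin_singleton F A
  rw [h4, hp]
  exact sum_mem fun j _ => Subalgebra.smul_mem _ (pow_mem h5 _) _
theorem stab_adjoin {A z : Matrix n n F} (hz : z ∈ Algebra.adjoin F {A}) (W : Submodule F (n → F)) (hW : ∀ w ∈ W, A *ᵥ w ∈ W) : ∀ w ∈ W, z *ᵥ w ∈ W := by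
  induction hz using Algebra.adjoin_induction with
  | mem a ha => rw [Set.mem_singleton_iff.1 ha]; exact hW
  | algebraMap r => intro w hw; rw [Algebra.algebraMap_eq_smul_one, smul_mulVec, one_mulVec]; exact W.smul_mem r hw
  | add a b _ _ h1 h2 => intro w hw; rw [add_mulVec]; exact W.add_mem (h1 w hw) (h2 w hw)
  | mul a b _ _ h1 h2 => intro w hw; rw [← mulVec_mulVec]; exact h1 _ (h2 w hw)
theorem comm_adjoin {A z w : Matrix n n F} (hz : z ∈ Algebra.adjoin F {A}) (hw : Commute w A) : Commute w z := by
  induction hz using Algebra.adjoin_induction with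
  | mem a ha => rw [Set.mem_singleton_iff.1 ha]; exact hw
  | algebraMap r => exact (Algebra.commute_algebraMap_left r w).symm
  | add a b _ _ h1 h2 => exact h1.add_right h2
  | mul a b _ _ h1 h2 => exact h1.mul_right h2
theorem inv_stab (u : (Matrix n n F)ˣ) (W : Submodule F (n → F)) (hW : ∀ w ∈ W, u.1 *ᵥ w ∈ W) : ∀ w ∈ W, (u⁻¹).1 *ᵥ w ∈ W := by
  let T : W →ₗ[F] W := (Matrix.toLin' (u : Matrix n n F)).restrict (fun w hw => by
    rw [toLin'_apply]; exact hW w hw)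
  have hT : ∀ w : W, ((T w : W) : n → F) = u.1 *ᵥ (w : n → F) := fun w => by
    rw [← toLin'_apply]; rfl
  have hinj : Function.Injective T := by
    intro a b hab
    have h1 := congrArg (fun w : W => (w : n → F)) hab
    simp only [hT] at h1
    have := congrArg (fun g => (u⁻¹).1 *ᵥ g) h1
    simp only [mulVec_mulVec, Units.inv_mul, one_mulVec] at this
    exact Subtype.ext this
  have hsurj := LinearMap.injective_iff_surjective.1 hinj
  intro w hw
  obtain ⟨v, hv⟩ := hsurj ⟨w, hw⟩
  have := congrArg (fun w : W => (w : n → F)) hv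
  simp only [hT] at this
  rw [← this, mulVec_mulVec, Units.inv_mul, one_mulVec]
  exact v.2
def perp (J : Matrix n n F) (W : Submodule F (n → F)) : Submodule F (n → F) where
  carrier := {v | ∀ w ∈ W, om J v w = 0}
  add_mem' := fun ha hb w hw => by rw [om_add_left, ha w hw, hb w hw, add_zero]
  zero_mem' := fun w _ => om_zero_left w
  smul_mem' := fun c v hv w hw => by rw [om_smul_left, hv w hw, mul_zero]
theorem mem_perp {J : Matrix n n F} {W : Submodule F (n → F)} {v} : v ∈ perp J W ↔ ∀ w ∈ W, om J v w = 0 := Iff.rfl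
theorem adj_eq_inv {J : Matrix n n F} (u : (Matrix n n F)ˣ) (h : adj J u.1 * u = 1) : adj J u.1 = (u⁻¹).1 := by
  rw [← mul_one (adj J _), ← Units.mul_inv u, ← mul_assoc, h, one_mul]
theorem perp_stab {J : Matrix n n F} (hJ : Sy J) (u : (Matrix n n F)ˣ) (h : adj J u.1 * u = 1)
    (W : Submodule F (n → F)) (hW : ∀ w ∈ W, u.1 *ᵥ w ∈ W) : ∀ w ∈ perp J W, u.1 *ᵥ w ∈ perp J W := by
  intro v hv w hw
  rw [om_adj hJ, adj_eq_inv u h]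
  exact hv _ (inv_stab u W hW w hw)
theorem perp_bot {J : Matrix n n F} (hJ : Sy J) (W : Submodule F (n → F)) (h : perp J W = ⊥) : W = ⊤ := by
  by_contra hW
  obtain ⟨v, hv⟩ : ∃ v, v ∉ W := by
    by_contra hcon; push Not at hcon
    exact hW (eq_top_iff.2 fun v _ => hcon v)
  obtain ⟨f, hf, hM⟩ := Submodule.exists_le_ker_of_notMem hv
  set g : n → F := fun i => f (Pi.single i 1) with hg
  have hfg : ∀ w, f w = g ⬝ᵥ w := by
    intro w
    rw [LinearMap.pi_apply_eq_sum_univ f w, dotProduct]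
    refine Finset.sum_congr rfl fun i _ => ?_
    have h2 : (fun j => if i = j then (1:F) else 0) = Pi.single i 1 := by
      ext j; simp [Pi.single_apply, eq_comm]
    rw [h2, smul_eq_mul, mul_comm]
  have hom : ∀ w, om J (J *ᵥ g) w = g ⬝ᵥ w := by
    intro w
    rw [om_comm hJ, om, mulVec_mulVec, hJ.sq, one_mulVec, dotProduct_comm]
  have h1 : J *ᵥ g ∈ perp J W := fun w hw => by
    rw [hom, ← hfg]; exact hM hw
  rw [h, Submodule.mem_bot] at h1
  have := hom v
  rw [h1, om_zero_left, ← hfg] at this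
  exact hf this.symm
end dens
end SG
end
section
namespace SG
set_option linter.all false
open Matrix
section irr
variable {n F : Type} [Fintype n] [DecidableEq n] [Field F] [Fintype F] [CharP F 2]
structure Good (J : Matrix n n F) (x : (Matrix n n F)ˣ) (ε : Matrix n n F) (Q : (n → F) → F) (D : ℕ) : Prop where
  sp : adj J x.1 * x = 1
  x1 : IsUnit ((x : Matrix n n F) - 1)
  sep : (x : Matrix n n F).charpoly.Separable
  hε : ε ∈ Algebra.adjoin F {(x : Matrix n n F)}
  εε : ε * ε = ε
  εa : adj J ε = ε
  fac : ∃ (A : Matrix n (Fin 2) F) (B : Matrix (Fin 2) n F), 1 - ε = A * B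
  tri : ∀ W : Submodule F (n → F), (∀ w ∈ W, x.1 *ᵥ w ∈ W) →
    (∀ w ∈ W, ε *ᵥ w = 0) ∨ (∀ v, ε *ᵥ v ∈ W) ∨ (∀ v, ε *ᵥ v ∈ W ↔ ∀ w ∈ W, om J (ε *ᵥ v) w = 0)
  two : ∀ u v, ε *ᵥ v = 0 → ε *ᵥ u = 0 → v ≠ 0 → om J u v = 0 → ∃ c : F, u = c • v
  isQ : IsQ J Q
  inv : ∀ v, Q (x.1 *ᵥ v) = Q v
  curve : ∀ j : ℕ, ∃ (Γ : Matrix n n (Polynomial F)) (c : Polynomial F), (∀ a b, (Γ a b).natDegree ≤ D) ∧ c.natDegree ≤ D ∧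
    Γ.map (Polynomial.eval 0) = 1 ∧ c.eval 0 = 1 ∧ c.coeff 1 = 0 ∧
    Γ.map (fun p => p.coeff 1) = x.1 ^ j * ε + adj J (x.1 ^ j * ε) ∧
    ∀ t : F, ∃ k : ℕ, Γ.map (Polynomial.eval t) = c.eval t • x.1 ^ k
def BadZ (z : Matrix n n F) : Prop := (∀ s : F, z ≠ s • 1) ∧ ∀ p : Polynomial F, Polynomial.aeval z p = 0 ∨ IsUnit (Polynomial.aeval z p)
def Bad (J : Matrix n n F) (y : Matrix n n F) : Prop := ∃ z, Commute z y ∧ adj J z = z ∧ BadZ z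
theorem Zq {z : Matrix n n F} (hz : BadZ z) (U : Submodule F (n → F)) (hU : ∀ w ∈ U, z *ᵥ w ∈ U) (v : n → F) (c : F)
    (h : z *ᵥ (z *ᵥ v) - c • v ∈ U) : v ∈ U := by
  have h1 := hz.2 (Polynomial.X - Polynomial.C (rt c))
  rw [map_sub, Polynomial.aeval_X, Polynomial.aeval_C, Algebra.algebraMap_eq_smul_one] at h1
  rcases h1 with h1 | ⟨u, hu⟩
  · exact absurd (sub_eq_zero.1 h1) (hz.1 _)
  · have h2 : ∀ w ∈ U, u.1 *ᵥ w ∈ U := by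
      intro w hw
      rw [hu, sub_mulVec, smul_mulVec, one_mulVec]
      exact U.sub_mem (hU w hw) (U.smul_mem _ hw)
    have h3 : u.1 *ᵥ (u.1 *ᵥ v) = z *ᵥ (z *ᵥ v) - c • v := by
      rw [hu]
      simp only [sub_mulVec, smul_mulVec, one_mulVec, mulVec_sub, mulVec_smul]
      ext i
      simp only [Pi.sub_apply, Pi.smul_apply, smul_eq_mul]
      have := rt_sq c
      linear_combination - (CharTwo.add_self_eq_zero (rt c * (z *ᵥ v) i)) + v i * this + v i * CharTwo.add_self_eq_zero c -v i * CharTwo.add_self_eq_zero c + CharTwo.add_self_eq_zero (c * v i)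
    rw [← h3] at h
    have h4 := inv_stab u U h2 _ (inv_stab u U h2 _ h)
    simpa [mulVec_mulVec] using h4
variable {J : Matrix n n F} {x y : (Matrix n n F)ˣ} {ε : Matrix n n F} {Q Qy : (n → F) → F} {D : ℕ}
theorem Good.Pz (hJ : Sy J) (G : Good J x ε Q D) {z : Matrix n n F} (hz : adj J z = z) (v : n → F) (hv : ε *ᵥ v = 0) :
    ∃ c : F, z *ᵥ (z *ᵥ v) = ε *ᵥ (z *ᵥ (z *ᵥ v)) + c • v := by
  by_cases hv0 : v = 0
  · exact ⟨0, by simp [hv0]⟩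
  · set w := z *ᵥ (z *ᵥ v) with hw
    obtain ⟨c, hc⟩ := G.two (w - ε *ᵥ w) v hv (by rw [mulVec_sub, mulVec_mulVec _ ε ε, G.εε, sub_self]) hv0 (by
      have h1 : om J (ε *ᵥ w) v = 0 := by rw [om_adj hJ, G.εa, hv, om_zero_right]
      have h2 : om J w v = 0 := by rw [hw, om_adj hJ, hz, om_self hJ]
      have h3 : w = (w - ε *ᵥ w) + ε *ᵥ w := by abel
      rw [h3, om_add_left, h1, add_zero] at h2
      exact h2)
    refine ⟨c, ?_⟩
    rw [← hc]; abel
theorem Good.irrA (hJ : Sy J) (G : Good J x ε Q D) {z : Matrix n n F} (hz : adj J z = z) (hb : BadZ z) (W : Submodule F (n → F))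
    (hW : ∀ w ∈ W, z *ᵥ w ∈ W) (h : ∀ w ∈ W, ε *ᵥ w = 0) : W = ⊥ := by
  rw [eq_bot_iff]
  intro v hv
  obtain ⟨c, hc⟩ := G.Pz hJ hz v (h v hv)
  rw [h _ (hW _ (hW _ hv)), zero_add] at hc
  refine Zq hb ⊥ (fun w hw => by rw [(Submodule.mem_bot F).1 hw, mulVec_zero]; exact Submodule.zero_mem _) v c ?_
  rw [hc, sub_self]; exact Submodule.zero_mem _
theorem Good.irrB (hJ : Sy J) (G : Good J x ε Q D) {z : Matrix n n F} (hz : adj J z = z) (hb : BadZ z) (W : Submodule F (n → F))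
    (hWx : ∀ w ∈ W, ε *ᵥ w ∈ W)
    (hW : ∀ w ∈ W, z *ᵥ w ∈ W) (h : ∀ v, ε *ᵥ v ∈ W ↔ ∀ w ∈ W, om J (ε *ᵥ v) w = 0) (hP : ∀ w ∈ W, ε *ᵥ w = 0 → w = 0) : ε = 1 := by
  have hε : ∀ w ∈ W, ε *ᵥ w = w := by
    intro w hw
    have := hP (ε *ᵥ w - w) (W.sub_mem (hWx w hw) hw) (by rw [mulVec_sub, mulVec_mulVec, G.εε, sub_self])
    exact sub_eq_zero.1 this
  refine Matrix.ext_of_mulVec_single fun j => ?_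
  rw [one_mulVec]
  set u : n → F := Pi.single j 1
  set v := u - ε *ᵥ u with hv
  have hv0 : ε *ᵥ v = 0 := by rw [hv, mulVec_sub, mulVec_mulVec, G.εε, sub_self]
  obtain ⟨c, hc⟩ := G.Pz hJ hz v hv0
  have hvW : v ∈ W := by
    refine Zq hb W hW v c ?_
    have : z *ᵥ (z *ᵥ v) - c • v = ε *ᵥ (z *ᵥ (z *ᵥ v)) := by
      conv_lhs => rw [hc]
      abel
    rw [this, h]
    intro w hw
    rw [om_adj hJ, G.εa, hε w hw, om_adj hJ, hz, om_adj hJ, hz, ← hε _ (hW _ (hW _ hw)), om_adj' hJ, G.εa, hv0, om_zero_left]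
  have h0 := hP v hvW hv0
  rw [hv, sub_eq_zero] at h0
  exact h0.symm
theorem Good.adjoin_stab (G : Good J x ε Q D) (W : Submodule F (n → F)) (hW : ∀ w ∈ W, x.1 *ᵥ w ∈ W) :
    ∀ w ∈ W, ε *ᵥ w ∈ W := stab_adjoin G.hε W hW
structure Gen (J : Matrix n n F) (y : (Matrix n n F)ˣ) (Q : (n → F) → F) (N : ℕ) : Prop where
  sp : adj J y.1 * y = 1
  y1 : IsUnit ((y : Matrix n n F) - 1)
  cyc : Cyc (y.1 ^ N)
  isQ : IsQ J Q
  inv : ∀ v, Q (y.1 *ᵥ v) = Q v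
theorem Gen.adjoin {N : ℕ} (Y : Gen J y Qy N) {z : Matrix n n F} (hz : Commute z y) : z ∈ Algebra.adjoin F {(y : Matrix n n F)} := by
  have h1 := cyc_adjoin Y.cyc (hz.pow_right N)
  refine Algebra.adjoin_le ?_ h1
  rw [Set.singleton_subset_iff]
  exact pow_mem (Algebra.self_mem_adjoin_singleton F _) _
theorem sign_contra (hJ : Sy J) {N : ℕ} (G : Good J x ε Q D) (Y : Gen J y Qy N) (hS : ¬ (0 < SS Q ∧ 0 < SS Qy))
    (W : Submodule F (n → F)) (hx : ∀ w ∈ W, x.1 *ᵥ w ∈ W) (hy : ∀ w ∈ W, y.1 *ᵥ w ∈ W)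
    (h : ∀ v, v ∈ W ↔ ∀ w ∈ W, om J v w = 0) : False := by
  have hti : ∀ v ∈ W, ∀ w ∈ W, om J v w = 0 := fun v hv => (h v).1 hv
  exact hS ⟨SS_pos hJ G.isQ W h (Q_zero G.isQ _ G.x1 G.inv W hx hti), SS_pos hJ Y.isQ W h (Q_zero Y.isQ _ Y.y1 Y.inv W hy hti)⟩
theorem irrH (hJ : Sy J) {N : ℕ} (G : Good J x ε Q D) (Y : Gen J y Qy N) (hS : ¬ (0 < SS Q ∧ 0 < SS Qy))
    (hB : ε = 1 ∨ (ε ≠ 1 ∧ Bad J (y : Matrix n n F))) (W : Submodule F (n → F))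
    (hx : ∀ w ∈ W, x.1 *ᵥ w ∈ W) (hy : ∀ w ∈ W, y.1 *ᵥ w ∈ W) : W = ⊥ ∨ W = ⊤ := by
  rcases hB with rfl | ⟨hε, z, hzy, hz, hb⟩
  · rcases G.tri W hx with h | h | h
    · left; rw [eq_bot_iff]; intro w hw; simpa using h w hw
    · right; rw [eq_top_iff]; intro w _; simpa using h w
    · simp only [one_mulVec] at h
      exact (sign_contra hJ G Y hS W hx hy h).elim
  · have hzs := Y.adjoin hzy
    have hWz := stab_adjoin hzs W hy
    have hpx := perp_stab hJ x G.sp W hx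
    have hpy := perp_stab hJ y Y.sp W hy
    have hpz := stab_adjoin hzs _ hpy
    rcases G.tri W hx with h | h | h
    · left; exact G.irrA hJ hz hb W hWz h
    · right
      refine perp_bot hJ W (G.irrA hJ hz hb _ hpz fun w hw => ?_)
      refine om_nondeg hJ _ fun v => ?_
      rw [om_adj hJ, G.εa]
      exact hw _ (h v)
    · by_cases hP : ∀ w ∈ W, ε *ᵥ w = 0 → w = 0
      · exact absurd (G.irrB hJ hz hb W (G.adjoin_stab W hx) hWz h hP) hε
      push Not at hP
      obtain ⟨v, hvW, hv, hv0⟩ := hP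
      have hεW := G.adjoin_stab W hx
      have hεo : ∀ u ∈ W, ∀ w ∈ W, om J (ε *ᵥ u) w = 0 := fun u hu => (h u).1 (hεW u hu)
      by_cases hti : ∀ u ∈ W, ∀ w ∈ W, om J u w = 0
      · refine (sign_contra hJ G Y hS W hx hy fun u => ⟨hti u, fun hu => ?_⟩).elim
        have h1 : ε *ᵥ u ∈ W := by
          rw [h]; intro w hw
          rw [om_adj hJ, G.εa]; exact hu _ (hεW w hw)
        obtain ⟨c, hc⟩ := G.two (u - ε *ᵥ u) v hv (by rw [mulVec_sub, mulVec_mulVec, G.εε, sub_self]) hv0 (by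
          have h3 : u = (u - ε *ᵥ u) + ε *ᵥ u := by abel
          have h4 := hu v hvW
          rw [h3, om_add_left, om_adj hJ (ε) u v, G.εa, hv, om_zero_right, add_zero] at h4
          exact h4)
        have h5 : u = c • v + ε *ᵥ u := by rw [← hc]; abel
        rw [h5]
        exact W.add_mem (W.smul_mem _ hvW) h1
      · push Not at hti
        obtain ⟨a, ha, b, hb', hab⟩ := hti
        have hPW : ∀ u, ε *ᵥ u = 0 → u ∈ W := by
          set v1 := a - ε *ᵥ a with hv1
          set v2 := b - ε *ᵥ b with hv2
          have e1 : ε *ᵥ v1 = 0 := by rw [hv1, mulVec_sub, mulVec_mulVec, G.εε, sub_self]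
          have e2 : ε *ᵥ v2 = 0 := by rw [hv2, mulVec_sub, mulVec_mulVec, G.εε, sub_self]
          have m1 : v1 ∈ W := W.sub_mem ha (hεW a ha)
          have m2 : v2 ∈ W := W.sub_mem hb' (hεW b hb')
          have h12 : om J v1 v2 = om J a b := by
            have h3 : a = v1 + ε *ᵥ a := by rw [hv1]; abel
            have h4 : b = v2 + ε *ᵥ b := by rw [hv2]; abel
            have h5 : om J a b = om J v1 b := by
              conv_lhs => rw [h3]
              rw [om_add_left, hεo a ha b hb', add_zero]
            rw [h5]
            conv_rhs => rw [h4]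
            rw [om_add_right, om_comm hJ v1 (ε *ᵥ b), hεo b hb' v1 m1, add_zero]
          have hne : om J v1 v2 ≠ 0 := by rw [h12]; exact hab
          have hv20 : v2 ≠ 0 := fun h => hne (by rw [h, om_zero_right])
          intro u hu
          obtain ⟨c, hc⟩ := G.two (u + (om J u v2 * (om J v1 v2)⁻¹) • v1) v2 e2 (by rw [mulVec_add, mulVec_smul, hu, e1]; simp) hv20 (by
            rw [om_add_left, om_smul_left, mul_assoc, inv_mul_cancel₀ hne, mul_one, CharTwo.add_self_eq_zero])
          have h6 : u = c • v2 - (om J u v2 * (om J v1 v2)⁻¹) • v1 := by rw [← hc]; abel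
          rw [h6]
          exact W.sub_mem (W.smul_mem _ m2) (W.smul_mem _ m1)
        rcases G.tri _ hpx with h' | h' | h'
        · right; exact perp_bot hJ W (G.irrA hJ hz hb _ hpz h')
        · left
          refine G.irrA hJ hz hb W hWz fun w hw => ?_
          refine om_nondeg hJ _ fun u => ?_
          rw [om_comm hJ, om_adj' hJ, G.εa]
          exact h' u w hw
        · refine absurd (G.irrB hJ hz hb _ (G.adjoin_stab _ hpx) hpz h' fun w hw hw0 => ?_) hε
          refine om_nondeg hJ _ fun u => ?_
          have h3 : u = (u - ε *ᵥ u) + ε *ᵥ u := by abel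
          rw [h3, om_add_right, om_adj' hJ, G.εa, hw0, om_zero_left, add_zero]
          exact hw _ (hPW _ (by rw [mulVec_sub, mulVec_mulVec, G.εε, sub_self]))
theorem comm_zero_unit (hirr : ∀ W : Submodule F (n → F), (∀ w ∈ W, x.1 *ᵥ w ∈ W) → (∀ w ∈ W, y.1 *ᵥ w ∈ W) → W = ⊥ ∨ W = ⊤)
    (z : Matrix n n F) (hx : Commute z x) (hy : Commute z y) : z = 0 ∨ IsUnit z := by
  have hst : ∀ u : (Matrix n n F)ˣ, Commute z u → ∀ w ∈ LinearMap.ker (toLin' z), u.1 *ᵥ w ∈ LinearMap.ker (toLin' z) := by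
    intro u hu w hw
    rw [LinearMap.mem_ker, toLin'_apply] at *
    rw [mulVec_mulVec, hu.eq, ← mulVec_mulVec, hw, mulVec_zero]
  rcases hirr _ (hst x hx) (hst y hy) with h | h
  · right
    rw [LinearMap.ker_eq_bot] at h
    exact mulVec_injective_iff_isUnit.1 h
  · left
    rw [LinearMap.ker_eq_top] at h
    exact toLin'.injective (by rw [h, map_zero])
theorem comm_adj (hJ : Sy J) (u : (Matrix n n F)ˣ) (hu : adj J u.1 * u = 1) (z : Matrix n n F) (h : Commute z u) : Commute (adj J z) u := by
  have h1 : Commute (adj J z) (u⁻¹).1 := by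
    rw [← adj_eq_inv u hu, Commute, SemiconjBy, ← adj_mul hJ, ← adj_mul hJ, h.eq]
  have := h1.units_inv_right
  simpa using this
theorem endH (hJ : Sy J) {N : ℕ} (G : Good J x ε Q D) (Y : Gen J y Qy N) (hne : Q ≠ Qy)
    (hB : (ε = 1 ∧ ¬ Bad J (y : Matrix n n F)) ∨ (ε ≠ 1 ∧ Bad J (y : Matrix n n F)))
    (hirr : ∀ W : Submodule F (n → F), (∀ w ∈ W, x.1 *ᵥ w ∈ W) → (∀ w ∈ W, y.1 *ᵥ w ∈ W) → W = ⊥ ∨ W = ⊤)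
    (z : Matrix n n F) (hx : Commute z x) (hy : Commute z y) : ∃ s : F, z = s • 1 := by
  have hx' := comm_adj hJ x G.sp z hx
  have hy' := comm_adj hJ y Y.sp z hy
  have hzz : Commute z (adj J z) := cyc_comm Y.cyc (hy.pow_right N) (hy'.pow_right N)
  rcases comm_zero_unit hirr (z + adj J z) (hx.add_left hx') (hy.add_left hy') with h0 | ⟨t, ht⟩
  · have hza : adj J z = z := by
      ext i j
      have := congrFun (congrFun h0 i) j
      rw [Matrix.add_apply, Matrix.zero_apply] at this
      exact ((CharTwo.add_eq_zero).1 this).symm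
    by_contra hcon
    push Not at hcon
    have hb : BadZ z := by
      refine ⟨hcon, fun p => comm_zero_unit hirr _ ?_ ?_⟩
      · exact (comm_adjoin (Polynomial.aeval_mem_adjoin_singleton F z) hx.symm).symm
      · exact (comm_adjoin (Polynomial.aeval_mem_adjoin_singleton F z) hy.symm).symm
    rcases hB with ⟨_, h⟩ | ⟨hε, _⟩
    · exact h ⟨z, hy, hza, hb⟩
    · apply hε
      have hzε : Commute z ε := comm_adjoin G.hε hx
      have key : ∀ v, ε *ᵥ v = 0 → v = 0 := by
        intro v hv
        obtain ⟨c, hc⟩ := G.Pz hJ hza v hv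
        have h1 : ε *ᵥ (z *ᵥ (z *ᵥ v)) = 0 := by
          rw [mulVec_mulVec, ← hzε.eq, ← mulVec_mulVec, mulVec_mulVec _ ε, ← hzε.eq, ← mulVec_mulVec, hv, mulVec_zero, mulVec_zero]
        rw [h1, zero_add] at hc
        have := Zq hb ⊥ (fun w hw => by rw [(Submodule.mem_bot F).1 hw, mulVec_zero]; exact Submodule.zero_mem _) v c (by
          rw [hc, sub_self]; exact Submodule.zero_mem _)
        exact (Submodule.mem_bot F).1 this
      refine Matrix.ext_of_mulVec_single fun j => ?_
      have := key (ε *ᵥ (Pi.single j 1) - Pi.single j 1) (by rw [mulVec_sub, mulVec_mulVec, G.εε, sub_self])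
      rw [one_mulVec]
      exact sub_eq_zero.1 this
  · exfalso
    set T := (t⁻¹).1 with hT
    have hct : ∀ w : Matrix n n F, Commute z w → Commute (adj J z) w → Commute T w := by
      intro w h1 h2
      have h3 : Commute (t : Matrix n n F) w := by rw [ht]; exact h1.add_left h2
      exact h3.units_inv_left
    have hta : adj J t.1 = t := by rw [ht, adj_add, adj_adj hJ, add_comm]
    have hTa : adj J T = T := by
      have h1 : adj J T * adj J t.1 = 1 := by rw [← adj_mul hJ, hT, Units.mul_inv, adj_one hJ]
      rw [hta] at h1
      rw [← mul_one (adj J T), ← Units.mul_inv t, ← mul_assoc, h1, one_mul]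
    set d := z * T with hd
    have hda : adj J d = adj J z * T := by
      rw [hd, adj_mul hJ, hTa]
      exact (hct _ hzz (Commute.refl _)).eq
    have hdd : d + adj J d = 1 := by
      rw [hda, hd, ← add_mul, ← ht, hT, Units.mul_inv]
    have hQ : IsQ J (fun v => om J v (d *ᵥ v)) := by
      refine ⟨fun v w => ?_, fun c v => ?_⟩
      · have h1 : om J v w = om J v (d *ᵥ w) + om J w (d *ᵥ v) := by
          rw [om_comm hJ w, om_adj hJ d v w, ← om_add_right, ← add_mulVec, hdd, one_mulVec]
        rw [h1]
        simp only [mulVec_add, om_add_left, om_add_right]; ring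
      · simp only [mulVec_smul, om_smul_left, om_smul_right]; ring
    have hinv : ∀ u : (Matrix n n F)ˣ, adj J u.1 * u = 1 → Commute z u → Commute (adj J z) u → ∀ v, om J (u.1 *ᵥ v) (d *ᵥ (u.1 *ᵥ v)) = om J v (d *ᵥ v) := by
      intro u hu h1 h2 v
      have h3 : Commute d u := h1.mul_left (hct _ h1 h2)
      rw [mulVec_mulVec, h3.eq, ← mulVec_mulVec, om_adj hJ, mulVec_mulVec, hu, one_mulVec]
    have e1 := invQ_unique G.isQ hQ x G.x1 G.inv (hinv x G.sp hx hx')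
    have e2 := invQ_unique Y.isQ hQ y Y.y1 Y.inv (hinv y Y.sp hy hy')
    exact hne (e1.symm.trans e2)
theorem spanH [Nonempty n] (hJ : Sy J) {N : ℕ} (G : Good J x ε Q D) (Y : Gen J y Qy N) (hne : Q ≠ Qy) (hS : ¬ (0 < SS Q ∧ 0 < SS Qy))
    (hB : (ε = 1 ∧ ¬ Bad J (y : Matrix n n F)) ∨ (ε ≠ 1 ∧ Bad J (y : Matrix n n F))) :
    (∀ W : Submodule F (n → F), (∀ w ∈ W, x.1 *ᵥ w ∈ W) → (∀ w ∈ W, y.1 *ᵥ w ∈ W) → W = ⊥ ∨ W = ⊤) ∧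
    Submodule.span F ((fun h : (Matrix n n F)ˣ => (h : Matrix n n F)) '' (Subgroup.closure {x, y} : Subgroup (Matrix n n F)ˣ)) = ⊤ := by
  have hirr := irrH hJ G Y hS (hB.imp (fun h => h.1) id)
  refine ⟨hirr, ?_⟩
  have hxm : x ∈ Subgroup.closure {x, y} := Subgroup.subset_closure (by simp)
  have hym : y ∈ Subgroup.closure {x, y} := Subgroup.subset_closure (by simp)
  exact density _ (fun W hW => hirr W (hW x hxm) (hW y hym)) (fun z hz => endH hJ G Y hne hB hirr z (hz x hxm) (hz y hym))
end irr
end SG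
end
section
namespace SG
set_option linter.all false
open Matrix
section brk
variable {n F : Type} [Fintype n] [DecidableEq n] [Field F]
theorem poly_coeff [Fintype F] (M : Submodule F (Matrix n n F)) (p : Matrix n n (Polynomial F)) (d : ℕ) (hd : ∀ i j, (p i j).natDegree ≤ d)
    (hq : d < Fintype.card F) (h : ∀ t : F, p.map (Polynomial.eval t) ∈ M) (k : ℕ) : p.map (fun a => a.coeff k) ∈ M := by
  classical
  by_contra hz
  obtain ⟨f, hf, hM⟩ := Submodule.exists_le_ker_of_notMem hz
  have hfe : ∀ A : Matrix n n F, f A = ∑ i, ∑ j, f (single i j 1) * A i j := by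
    intro A
    conv_lhs => rw [matrix_eq_sum_single A]
    rw [map_sum]
    refine Finset.sum_congr rfl fun i _ => ?_
    rw [map_sum]
    refine Finset.sum_congr rfl fun j _ => ?_
    have : single i j (A i j) = A i j • single i j (1:F) := by rw [smul_single]; simp
    rw [this, map_smul, smul_eq_mul, mul_comm]
  set g : Polynomial F := ∑ i, ∑ j, Polynomial.C (f (single i j 1)) * p i j with hg
  have hge : ∀ t, g.eval t = 0 := by
    intro t
    have h1 := hM (h t)
    rw [LinearMap.mem_ker, hfe] at h1
    rw [hg, Polynomial.eval_finset_sum, ← h1]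
    refine Finset.sum_congr rfl fun i _ => ?_
    rw [Polynomial.eval_finset_sum]
    refine Finset.sum_congr rfl fun j _ => ?_
    rw [Polynomial.eval_mul, Polynomial.eval_C]; rfl
  have hgd : g.natDegree < Fintype.card F := by
    refine lt_of_le_of_lt ?_ hq
    refine Polynomial.natDegree_sum_le_of_forall_le _ _ fun i _ => ?_
    refine Polynomial.natDegree_sum_le_of_forall_le _ _ fun j _ => ?_
    exact (Polynomial.natDegree_C_mul_le _ _).trans (hd i j)
  have hg0 : g = 0 := by
    refine Polynomial.eq_zero_of_natDegree_lt_card_of_eval_eq_zero' g Finset.univ (fun t _ => hge t) ?_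
    rw [Finset.card_univ]; exact hgd
  apply hf
  rw [hfe]
  have h2 : g.coeff k = 0 := by rw [hg0]; simp
  rw [hg, Polynomial.finset_sum_coeff] at h2
  rw [← h2]
  refine Finset.sum_congr rfl fun i _ => ?_
  rw [Polynomial.finset_sum_coeff]
  refine Finset.sum_congr rfl fun j _ => ?_
  rw [Polynomial.coeff_C_mul]; rfl
theorem map_mul_eval (A B : Matrix n n (Polynomial F)) (t : F) : (A * B).map (Polynomial.eval t) = A.map (Polynomial.eval t) * B.map (Polynomial.eval t) :=
  Matrix.map_mul (f := Polynomial.evalRingHom t)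
theorem map_mul_c1 (A B : Matrix n n (Polynomial F)) : (A * B).map (fun p => p.coeff 1) =
    A.map (Polynomial.eval 0) * B.map (fun p => p.coeff 1) + A.map (fun p => p.coeff 1) * B.map (Polynomial.eval 0) := by
  ext i j
  simp only [Matrix.map_apply, Matrix.mul_apply, Matrix.add_apply, Polynomial.finset_sum_coeff, Polynomial.mul_coeff_one, Finset.sum_add_distrib, Polynomial.coeff_zero_eq_eval_zero]
theorem map_C_eval (A : Matrix n n F) (t : F) : (A.map Polynomial.C).map (Polynomial.eval t) = A := by
  ext i j; simp
theorem map_C_c1 (A : Matrix n n F) : (A.map Polynomial.C).map (fun p => p.coeff 1) = 0 := by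
  ext i j; simp [Polynomial.coeff_C]
theorem deg_mul (A B : Matrix n n (Polynomial F)) (a b : ℕ) (hA : ∀ i j, (A i j).natDegree ≤ a) (hB : ∀ i j, (B i j).natDegree ≤ b) :
    ∀ i j, ((A * B) i j).natDegree ≤ a + b := by
  intro i j
  rw [Matrix.mul_apply]
  refine Polynomial.natDegree_sum_le_of_forall_le _ _ fun k _ => ?_
  exact Polynomial.natDegree_mul_le_of_le (hA i k) (hB k j)
theorem deg_C (A : Matrix n n F) : ∀ i j, ((A.map Polynomial.C) i j).natDegree ≤ 0 := by
  intro i j; simp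
variable [CharP F 2]
theorem altM_add {A B : Matrix n n F} (h1 : AltM A) (h2 : AltM B) : AltM (A + B) :=
  ⟨by rw [transpose_add, h1.1, h2.1], fun i => by rw [Matrix.add_apply, h1.2, h2.2, add_zero]⟩
theorem altM_smul {A : Matrix n n F} (h1 : AltM A) (s : F) : AltM (s • A) :=
  ⟨by rw [transpose_smul, h1.1], fun i => by rw [Matrix.smul_apply, h1.2, smul_zero]⟩
theorem isAlt_tr {J : Matrix n n F} (hJ : Sy J) (B : Matrix n n F) : IsAlt J (B + adj J B) := by
  have : J * (B + adj J B) = J * B + (J * B)ᵀ := by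
    rw [mul_add, adj, ← mul_assoc, ← mul_assoc, hJ.sq, one_mul, transpose_mul, hJ.symm]
  rw [IsAlt, this]
  refine ⟨by rw [transpose_add, transpose_transpose, add_comm], fun i => ?_⟩
  rw [Matrix.add_apply, transpose_apply, CharTwo.add_self_eq_zero]
theorem isAlt_conj {J : Matrix n n F} (hJ : Sy J) (h : (Matrix n n F)ˣ) (hh : adj J h.1 * h = 1) (z : Matrix n n F) (hz : IsAlt J z) :
    IsAlt J (h.1 * z * (h⁻¹).1) := by
  have h1 : J * h.1 = (h⁻¹).1ᵀ * J := by
    rw [← adj_eq_inv h hh, adj, transpose_mul, transpose_mul, transpose_transpose, hJ.symm]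
    simp only [mul_assoc, hJ.sq, mul_one]
  rw [IsAlt]
  have h2 : J * (h.1 * z * (h⁻¹).1) = (h⁻¹).1ᵀ * (J * z) * (h⁻¹).1 := by
    rw [← mul_assoc, ← mul_assoc, h1]; simp only [mul_assoc]
  rw [h2]
  exact altM_conj hz _
theorem closure_sp {J : Matrix n n F} (hJ : Sy J) {x y : (Matrix n n F)ˣ} (hx : adj J x.1 * x = 1) (hy : adj J y.1 * y = 1)
    (h : (Matrix n n F)ˣ) (hh : h ∈ Subgroup.closure {x, y}) : adj J h.1 * h = 1 := by
  induction hh using Subgroup.closure_induction with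
  | mem g hg =>
    rcases hg with rfl | hg
    · exact hx
    · rw [Set.mem_singleton_iff.1 hg]; exact hy
  | one => simp [adj_one hJ]
  | mul a b _ _ h1 h2 =>
    rw [Units.val_mul, adj_mul hJ]
    calc adj J b.1 * adj J a.1 * (a * b) = adj J b.1 * (adj J a.1 * a) * b := by simp only [mul_assoc]
      _ = 1 := by rw [h1, mul_one, h2]
  | inv a _ h1 =>
    rw [← adj_eq_inv a h1, adj_adj hJ, adj_eq_inv a h1, Units.mul_inv]
variable [Fintype F]
theorem allAlt {J : Matrix n n F} {x y : (Matrix n n F)ˣ} {ε : Matrix n n F} {Q Qy : (n → F) → F} {D : ℕ} [Nonempty n]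
    (hJ : Sy J) {N : ℕ} (G : Good J x ε Q D) (Y : Gen J y Qy N) (hN : ∀ k, 0 < k → k ≤ Fintype.card n ^ Fintype.card n → k ∣ N)
    (hspan : Submodule.span F ((fun h : (Matrix n n F)ˣ => (h : Matrix n n F)) '' (Subgroup.closure {x, y} : Subgroup (Matrix n n F)ˣ)) = ⊤)
    (hcard : 4 ≤ Fintype.card n) (hq : D + D < Fintype.card F) (z : Matrix n n F) (hz : IsAlt J z) :
    z ∈ Submodule.span F {w | ∃ h ∈ Subgroup.closure {x, y}, ∃ j : ℕ, w = h.1 * (x.1 ^ j * ε + adj J (x.1 ^ j * ε)) * (h⁻¹).1} := by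
  set H := Subgroup.closure {x, y} with hH
  set s : ℕ → Matrix n n F := fun j => x.1 ^ j * ε + adj J (x.1 ^ j * ε) with hs
  set M := Submodule.span F {w | ∃ h ∈ H, ∃ j : ℕ, w = h.1 * s j * (h⁻¹).1} with hM
  have hxm : x ∈ H := Subgroup.subset_closure (by simp)
  have hym : y ∈ H := Subgroup.subset_closure (by simp)
  have hsp := closure_sp hJ G.sp Y.sp
  have hconj : ∀ h ∈ H, ∀ z ∈ M, h.1 * z * (h⁻¹).1 ∈ M := by
    intro h hh T hT
    induction hT using Submodule.span_induction with
    | mem T hT =>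
      obtain ⟨k, hk, j, rfl⟩ := hT
      refine Submodule.subset_span ⟨h * k, H.mul_mem hh hk, j, ?_⟩
      rw [_root_.mul_inv_rev, Units.val_mul, Units.val_mul]
      simp only [mul_assoc]
    | zero => simp
    | add T V _ _ h1 h2 => rw [mul_add, add_mul]; exact Submodule.add_mem _ h1 h2
    | smul s T _ h1 => rw [mul_smul_comm, smul_mul_assoc]; exact Submodule.smul_mem _ _ h1
  have halt : ∀ z ∈ M, IsAlt J z := by
    intro T hT
    induction hT using Submodule.span_induction with
    | mem T hT =>
      obtain ⟨k, hk, j, rfl⟩ := hT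
      exact isAlt_conj hJ k (hsp k hk) _ (isAlt_tr hJ _)
    | zero => rw [IsAlt, mul_zero]; exact ⟨by simp, by simp⟩
    | add T V _ _ h1 h2 => rw [IsAlt, mul_add]; exact altM_add h1 h2
    | smul s T _ h1 => rw [IsAlt, mul_smul_comm]; exact altM_smul h1 s
  have hbr0 : ∀ j, ∀ w ∈ M, s j * w + w * s j ∈ M := by
    intro j w hw
    obtain ⟨Γ, c, hΓd, hcd, h0, hc0, hc1, h1, ht⟩ := G.curve j
    set Ga : Matrix n n (Polynomial F) := J.map Polynomial.C * Γᵀ * J.map Polynomial.C with hGa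
    have hGae : ∀ t, Ga.map (Polynomial.eval t) = adj J (Γ.map (Polynomial.eval t)) := by
      intro t
      rw [hGa, map_mul_eval, map_mul_eval, map_C_eval, adj]; rfl
    have hGa1 : Ga.map (fun p => p.coeff 1) = adj J (Γ.map (fun p => p.coeff 1)) := by
      rw [hGa, map_mul_c1, map_mul_c1, map_C_eval, map_C_c1, adj]
      simp; rfl
    have hGd : ∀ a b, (Ga a b).natDegree ≤ D := by
      intro a b
      have := deg_mul _ _ (0 + D) 0 (deg_mul (J.map Polynomial.C) Γᵀ 0 D (deg_C J) (fun a b => hΓd b a)) (deg_C J) a b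
      simpa using this
    have key := poly_coeff M (Γ * w.map Polynomial.C * Ga) (D + 0 + D) (deg_mul _ _ _ _ (deg_mul _ _ _ _ hΓd (deg_C w)) hGd) (by omega) (by
      intro t
      obtain ⟨k, hk⟩ := ht t
      rw [map_mul_eval, map_mul_eval, map_C_eval, hGae, hk, adj_smul]
      have h2 : adj J (x.1 ^ k) = (((x ^ k)⁻¹ : (Matrix n n F)ˣ) : Matrix n n F) := by
        rw [← Units.val_pow_eq_pow_val, adj_eq_inv _ (hsp _ (H.pow_mem hxm k))]
      rw [h2, smul_mul_assoc, smul_mul_assoc, mul_smul_comm, ← Units.val_pow_eq_pow_val]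
      exact M.smul_mem _ (M.smul_mem _ (hconj _ (H.pow_mem hxm k) w hw))) 1
    clear_value Ga
    rw [map_mul_c1, map_mul_c1, map_mul_eval, map_C_eval, map_C_c1, hGae, hGa1, h0, h1, adj_one hJ] at key
    have h3 : adj J (s j) = s j := by
      rw [hs]; simp only; rw [adj_add, adj_adj hJ, add_comm]
    change 1 * w * adj J (s j) + (1 * 0 + s j * w) * 1 ∈ M at key
    rw [h3] at key
    simpa [add_comm] using key
  have hbr : ∀ z ∈ M, ∀ w ∈ M, z * w + w * z ∈ M := by
    intro T hT w hw
    induction hT using Submodule.span_induction with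
    | mem T hT =>
      obtain ⟨k, hk, j, rfl⟩ := hT
      have h1 := hconj k hk _ (hbr0 j _ (hconj k⁻¹ (H.inv_mem hk) w hw))
      convert h1 using 1
      generalize s j = σ
      rw [inv_inv, mul_add, add_mul]
      simp only [mul_assoc, Units.mul_inv, mul_one, Units.mul_inv_cancel_left]
    | zero => simp
    | add T V _ _ h1 h2 => rw [mul_add, add_mul, add_add_add_comm]; exact Submodule.add_mem _ h1 h2
    | smul s T _ h1 => rw [mul_smul_comm, smul_mul_assoc, ← smul_add]; exact Submodule.smul_mem _ _ h1
  obtain ⟨A, B, hAB⟩ := G.fac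
  refine thmC hJ H x y hxm hym le_rfl G.sp hspan G.sep N hN Y.cyc M hconj hbr halt ε ?_ G.εε G.εa A B hAB ?_ hcard z hz
  · exact (comm_adjoin G.hε (Commute.refl _)).symm
  · intro j
    exact Submodule.subset_span ⟨1, H.one_mem, j, by simp [hs]⟩
end brk
end SG
end
section
namespace SG
set_option linter.all false
open Matrix
section hat
variable {n F : Type} [Fintype n] [DecidableEq n] [Field F] [Fintype F] [CharP F 2]
variable {J : Matrix n n F} {x y : (Matrix n n F)ˣ} {ε : Matrix n n F} {Q Qy : (n → F) → F} {D : ℕ}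
def sj (J : Matrix n n F) (x : (Matrix n n F)ˣ) (ε : Matrix n n F) (j : ℕ) : Matrix n n F := x.1 ^ j * ε + adj J (x.1 ^ j * ε)
theorem ell_mul (ell : (Matrix n n F)ˣ → n → F) (H : Subgroup (Matrix n n F)ˣ) (hell : ∀ h ∈ H, ∀ v, Q (h.1 *ᵥ v) = Q v + (ell h ⬝ᵥ v) ^ 2)
    (h k) (hh : h ∈ H) (hk : k ∈ H) : ell (h * k) = ell h ᵥ* k.1 + ell k := by
  refine dotProduct_eq _ _ fun v => sq_inj _ _ ?_
  have h1 := hell (h * k) (H.mul_mem hh hk) v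
  rw [Units.val_mul, ← mulVec_mulVec, hell h hh, hell k hk] at h1
  rw [add_dotProduct, ← dotProduct_mulVec, SG.sq_add]
  linear_combination -h1
theorem hatfull [Nonempty n] (hJ : Sy J) {N : ℕ} (G : Good J x ε Q D) (Y : Gen J y Qy N) (hN : ∀ k, 0 < k → k ≤ Fintype.card n ^ Fintype.card n → k ∣ N)
    (hne : Q ≠ Qy) (hS : ¬ (0 < SS Q ∧ 0 < SS Qy))
    (hB : (ε = 1 ∧ ¬ Bad J (y : Matrix n n F)) ∨ (ε ≠ 1 ∧ Bad J (y : Matrix n n F)))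
    (hcard : 4 ≤ Fintype.card n) (hq : D + D < Fintype.card F) (ell : (Matrix n n F)ˣ → n → F)
    (hell : ∀ h ∈ Subgroup.closure {x, y}, ∀ v, Q (h.1 *ᵥ v) = Q v + (ell h ⬝ᵥ v) ^ 2)
    (z : Matrix n n F) (hz : IsAlt J z) (f : n → F) :
    (z, f) ∈ Submodule.span F {p : Matrix n n F × (n → F) | ∃ h ∈ Subgroup.closure {x, y}, ∃ j : ℕ, p = (h.1 * sj J x ε j * (h⁻¹).1, ell h ᵥ* (sj J x ε j * (h⁻¹).1))} := by
  obtain ⟨hirr, hspan⟩ := spanH hJ G Y hne hS hB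
  have hall := allAlt hJ G Y hN hspan hcard hq
  have hsp := closure_sp hJ G.sp Y.sp
  set H := Subgroup.closure {x, y} with hH
  have hxm : x ∈ H := Subgroup.subset_closure (by simp)
  have hym : y ∈ H := Subgroup.subset_closure (by simp)
  set M := Submodule.span F {p : Matrix n n F × (n → F) | ∃ h ∈ H, ∃ j : ℕ, p = (h.1 * sj J x ε j * (h⁻¹).1, ell h ᵥ* (sj J x ε j * (h⁻¹).1))} with hM
  have hact : ∀ k ∈ H, ∀ p ∈ M, (k.1 * p.1 * (k⁻¹).1, (ell k ᵥ* p.1 + p.2) ᵥ* (k⁻¹).1) ∈ M := by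
    intro k hk p hp
    induction hp using Submodule.span_induction with
    | mem p hp =>
      obtain ⟨h, hh, j, rfl⟩ := hp
      refine Submodule.subset_span ⟨k * h, H.mul_mem hk hh, j, ?_⟩
      rw [ell_mul ell H hell k h hk hh, _root_.mul_inv_rev, Units.val_mul, Units.val_mul]
      simp only [add_vecMul, vecMul_vecMul, mul_assoc]
    | zero => simp; exact M.zero_mem
    | add p r _ _ h1 h2 =>
      convert M.add_mem h1 h2 using 1
      simp only [Prod.fst_add, Prod.snd_add, mul_add, add_mul, vecMul_add, add_vecMul, Prod.mk_add_mk]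
      congr 1; abel
    | smul c p _ h1 =>
      convert M.smul_mem c h1 using 1
      simp only [Prod.smul_fst, Prod.smul_snd, mul_smul_comm, smul_mul_assoc, vecMul_smul, add_vecMul, smul_vecMul, Prod.smul_mk, smul_add]
  have hpr : ∀ z, IsAlt J z → ∃ f, (z, f) ∈ M := by
    intro z hz
    have h1 : z ∈ M.map (LinearMap.fst F _ _) := by
      rw [hM, Submodule.map_span]
      refine Submodule.span_mono ?_ (hall z hz)
      rintro w ⟨h, hh, j, rfl⟩
      exact ⟨_, ⟨h, hh, j, rfl⟩, rfl⟩
    obtain ⟨⟨a, b⟩, hp, rfl⟩ := h1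
    exact ⟨b, hp⟩
  let W : Submodule F (n → F) := M.comap ((LinearMap.inr F (Matrix n n F) (n → F)).comp (Matrix.vecMulLinear J))
  have hWm : ∀ w, w ∈ W ↔ ((0 : Matrix n n F), w ᵥ* J) ∈ M := fun w => Iff.rfl
  have hWs : ∀ k ∈ H, ∀ w ∈ W, k.1 *ᵥ w ∈ W := by
    intro k hk w hw
    have h1 := hact k hk _ ((hWm w).1 hw)
    rw [hWm]
    convert h1 using 2
    · simp
    · rw [vecMul_zero, zero_add, vecMul_vecMul, ← adj_eq_inv k (hsp k hk), adj, ← mul_assoc, ← mul_assoc, hJ.sq, one_mul, ← vecMul_vecMul, vecMul_transpose]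
  rcases hirr W (hWs x hxm) (hWs y hym) with hW | hW
  · exfalso
    obtain ⟨f1, hf1⟩ := hpr 1 (by rw [IsAlt, mul_one]; exact ⟨hJ.symm, hJ.diag⟩)
    have hz0 : ∀ f, ((0 : Matrix n n F), f) ∈ M → f = 0 := by
      intro f hf
      have h1 : f ᵥ* J ∈ W := by rw [hWm, vecMul_vecMul, hJ.sq, vecMul_one]; exact hf
      rw [hW, Submodule.mem_bot] at h1
      rw [← vecMul_one f, ← hJ.sq, ← vecMul_vecMul, h1, zero_vecMul]
    have hl : ∀ k ∈ H, ell k = f1 ᵥ* k.1 + f1 := by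
      intro k hk
      have h1 := M.sub_mem (hact k hk _ hf1) hf1
      simp only [mul_one, Units.mul_inv, Prod.mk_sub_mk, sub_self, vecMul_one] at h1
      have h2 := sub_eq_zero.1 (hz0 _ h1)
      have h3 : ell k + f1 = f1 ᵥ* k.1 := by
        conv_rhs => rw [← h2]
        rw [vecMul_vecMul, Units.inv_mul, vecMul_one]
      rw [← h3]; ext i; simp [add_assoc, CharTwo.add_self_eq_zero]
    have hi : ∀ k ∈ H, ∀ v, Q (k.1 *ᵥ v) + (f1 ⬝ᵥ (k.1 *ᵥ v)) ^ 2 = Q v + (f1 ⬝ᵥ v) ^ 2 := by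
      intro k hk v
      rw [hell k hk, hl k hk, add_dotProduct, ← dotProduct_mulVec, SG.sq_add]
      linear_combination CharTwo.add_self_eq_zero ((f1 ⬝ᵥ k.1 *ᵥ v) ^ 2)
    have e1 := invQ_unique G.isQ (G.isQ.add_sq f1) _ G.x1 G.inv (hi x hxm)
    have e2 := invQ_unique Y.isQ (G.isQ.add_sq f1) _ Y.y1 Y.inv (hi y hym)
    exact hne (e1.symm.trans e2)
  · obtain ⟨f0, h0⟩ := hpr z hz
    have h1 : (f - f0) ᵥ* J ∈ W := hW ▸ Submodule.mem_top
    rw [hWm, vecMul_vecMul, hJ.sq, vecMul_one] at h1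
    have := M.add_mem h0 h1
    simpa using this
theorem tri_finrank (hJ : Sy J) (M : Submodule F (Matrix n n F × (n → F))) (h : ∀ z, IsAlt J z → ∀ f, (z, f) ∈ M) : Fintype.card (Tri n) ≤ Module.finrank F M := by
  let S : (Tri n → F) → Matrix n n F := fun c => of fun i j => if i = j then 0 else if hij : Fintype.equivFin n i ≤ Fintype.equivFin n j then c ⟨(i, j), hij⟩ else c ⟨(j, i), (not_le.1 hij).le⟩
  have hS : ∀ c, AltM (S c) := by
    intro c
    refine ⟨?_, fun i => by simp [S]⟩
    ext i j
    simp only [S, transpose_apply, of_apply]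
    by_cases hij : i = j
    · simp [hij]
    · rw [if_neg hij, if_neg (Ne.symm hij)]
      have := fun h => hij ((Fintype.equivFin n).injective h)
      rcases lt_or_gt_of_ne this with h1 | h1
      · rw [dif_neg (not_le.2 h1), dif_pos h1.le]
      · rw [dif_pos h1.le, dif_neg (not_le.2 h1)]
  let φ : (Tri n → F) →ₗ[F] M :=
    { toFun := fun c => ⟨(J * S c, fun i => c ⟨(i, i), le_rfl⟩), h _ (by rw [IsAlt, ← mul_assoc, hJ.sq, one_mul]; exact hS c) _⟩
      map_add' := fun a b => by
        have : S (a + b) = S a + S b := by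
          ext i j; simp only [S, of_apply, Matrix.add_apply, Pi.add_apply]; split_ifs <;> simp
        ext <;> simp [this, mul_add]
      map_smul' := fun r a => by
        have : S (r • a) = r • S a := by
          ext i j; simp only [S, of_apply, Matrix.smul_apply, Pi.smul_apply]; split_ifs <;> simp
        ext <;> simp [this] }
  have hφ : Function.Injective φ := by
    rw [← LinearMap.ker_eq_bot, LinearMap.ker_eq_bot']
    intro c hc
    have h1 : (J * S c, fun i => c ⟨(i, i), le_rfl⟩) = ((0 : Matrix n n F), (0 : n → F)) := congrArg Subtype.val hc
    obtain ⟨h2, h3⟩ := Prod.mk.inj h1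
    have h4 : S c = 0 := by rw [← one_mul (S c), ← hJ.sq, mul_assoc, h2, mul_zero]
    funext ⟨⟨i, j⟩, hij⟩
    by_cases e : i = j
    · subst e; exact congrFun h3 i
    · have := congrFun (congrFun h4 i) j
      simpa [S, e, hij] using this
  have := LinearMap.finrank_le_finrank_of_injective hφ
  simpa using this
end hat
end SG
end
section
namespace SG
set_option linter.all false
open Matrix
section cnt
variable {n F : Type} [Fintype n] [DecidableEq n] [Field F]
def hm (A : Matrix n n F) (f : n → F) (c : F) : Matrix (n ⊕ Unit) (n ⊕ Unit) F := fromBlocks A 0 (of fun _ j => f j) (of fun _ _ => c)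
theorem hm_mul (A B : Matrix n n F) (f g : n → F) (c d : F) : hm A f c * hm B g d = hm (A * B) (f ᵥ* B + c • g) (c * d) := by
  rw [hm, hm, fromBlocks_multiply, hm]
  congr 1
  · simp
  · simp
  · ext i j; simp [Matrix.mul_apply, vecMul, dotProduct]
  · ext i j; simp [Matrix.mul_apply]
theorem hm_one : hm (1 : Matrix n n F) 0 1 = 1 := by
  rw [hm, ← fromBlocks_one]; congr 1
theorem hm_smul (c : F) (A : Matrix n n F) (f : n → F) (d : F) : c • hm A f d = hm (c • A) (c • f) (c * d) := by
  rw [hm, fromBlocks_smul, hm]; congr 1; simp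
variable [Fintype F] [CharP F 2]
variable {J : Matrix n n F} {x y : (Matrix n n F)ˣ} {ε : Matrix n n F} {Q Qy : (n → F) → F} {D : ℕ}
theorem countH [Nonempty n] (hJ : Sy J) {N : ℕ} (G : Good J x ε Q D) (Y : Gen J y Qy N) (hN : ∀ k, 0 < k → k ≤ Fintype.card n ^ Fintype.card n → k ∣ N)
    (hne : Q ≠ Qy) (hS : ¬ (0 < SS Q ∧ 0 < SS Qy))
    (hB : (ε = 1 ∧ ¬ Bad J (y : Matrix n n F)) ∨ (ε ≠ 1 ∧ Bad J (y : Matrix n n F)))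
    (hcard : 4 ≤ Fintype.card n) (hq : D + D < Fintype.card F) (hD : 0 < D) :
    Fintype.card F ^ Fintype.card (Tri n) ≤ ((Fintype.card (Tri n) + 1) ^ 2 * D) ^ (Fintype.card (Tri n) + 1) * Nat.card (Subgroup.closure {x, y}) := by
  have hsp := closure_sp hJ G.sp Y.sp
  have hex : ∀ h : (Matrix n n F)ˣ, ∃ f : n → F, h ∈ Subgroup.closure {x, y} → ∀ v, Q (h.1 *ᵥ v) = Q v + (f ⬝ᵥ v) ^ 2 := by
    intro h
    by_cases hh : h ∈ Subgroup.closure {x, y}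
    · obtain ⟨f, hf⟩ := difQ G.isQ (G.isQ.comp (h : Matrix n n F) (fun v w => by
        rw [om_adj hJ, mulVec_mulVec, hsp h hh, one_mulVec]))
      exact ⟨f, fun _ => hf⟩
    · exact ⟨0, fun h' => absurd h' hh⟩
  choose ell hell using hex
  have hfull := hatfull hJ G Y hN hne hS hB hcard hq ell hell
  have hmul := fun h k => ell_mul (Q := Q) ell _ hell h k
  set H := Subgroup.closure {x, y} with hH
  have hxm : x ∈ H := Subgroup.subset_closure (by simp)
  have hone : ell 1 = 0 := by
    have := hmul 1 1 H.one_mem H.one_mem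
    simpa using this
  have hxk : ∀ k : ℕ, ell (x ^ k) = 0 := by
    intro k
    induction k with
    | zero => simpa using hone
    | succ k ih =>
      rw [pow_succ, hmul _ _ (H.pow_mem hxm k) hxm, ih, zero_vecMul, zero_add]
      refine dot_ext0 _ fun v => sq_inj _ _ ?_
      have h1 := hell x hxm v
      rw [G.inv] at h1
      linear_combination -h1
  set S := {p : Matrix n n F × (n → F) | ∃ h ∈ H, ∃ j : ℕ, p = (h.1 * sj J x ε j * (h⁻¹).1, ell h ᵥ* (sj J x ε j * (h⁻¹).1))} with hSd
  have hrank := tri_finrank hJ _ hfull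
  set d := Fintype.card (Tri n) with hd
  obtain ⟨b, hbS, hbsp, hbli⟩ := exists_linearIndependent F S
  haveI : Fintype b := Fintype.ofFinite _
  have hbf : Module.finrank F (Submodule.span F b) = b.ncard := by
    have := finrank_span_eq_card hbli
    rw [Subtype.range_coe] at this
    rw [this, Set.ncard_eq_toFinset_card', Set.toFinset_card]
  have hfe : ∃ e : Fin d → b, Function.Injective e := by
    have : Fintype.card (Fin d) ≤ Fintype.card b := by
      rw [Fintype.card_fin, ← Nat.card_eq_fintype_card]
      change d ≤ b.ncard
      rw [← hbf, hbsp]; exact hrank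
    obtain ⟨e⟩ := Function.Embedding.nonempty_of_card_le this
    exact ⟨e, e.injective⟩
  obtain ⟨e, he⟩ := hfe
  have hS' : ∀ i : Fin d, ∃ h ∈ H, ∃ j : ℕ, (e i : Matrix n n F × (n → F)) = (h.1 * sj J x ε j * (h⁻¹).1, ell h ᵥ* (sj J x ε j * (h⁻¹).1)) := fun i => hbS (e i).2
  choose h hh j hj using hS'
  let Φ : (Matrix n n F × (n → F)) →ₗ[F] Matrix (n ⊕ Unit) (n ⊕ Unit) F :=
    { toFun := fun p => hm p.1 p.2 0
      map_add' := fun a b => by simp only [hm, fromBlocks_add]; congr 1 <;> ext <;> simp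
      map_smul' := fun r a => by simp [hm_smul] }
  have hΦ : LinearMap.ker Φ = ⊥ := by
    rw [LinearMap.ker_eq_bot']
    rintro ⟨A, f⟩ hp
    have hp' : hm A f 0 = 0 := hp
    rw [hm, ← fromBlocks_zero] at hp'
    obtain ⟨h1, _, h2, _⟩ := fromBlocks_inj.1 hp'
    have : f = 0 := by funext k; exact congrFun (congrFun h2 ()) k
    rw [h1, this]; rfl
  have hli : LinearIndependent F (fun i => Φ (e i)) := (hbli.comp e he).map' Φ hΦ
  have hli1 : LinearIndependent F (Fin.cons (1 : Matrix (n ⊕ Unit) (n ⊕ Unit) F) (fun i => Φ (e i)) : Fin (d + 1) → _) := by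
    refine hli.finCons ?_
    intro h1
    have h2 : (1 : Matrix (n ⊕ Unit) (n ⊕ Unit) F) ∈ LinearMap.range Φ := by
      refine Submodule.span_le.2 ?_ h1
      rintro _ ⟨i, rfl⟩
      exact ⟨_, rfl⟩
    obtain ⟨p, hp⟩ := h2
    have := congrFun (congrFun hp (Sum.inr ())) (Sum.inr ())
    simp [Φ, hm] at this
  choose Γ c hΓd hcd h0 hc0 hc1 h1 ht using fun i => G.curve (j i)
  let P : (Matrix n n F)ˣ → Matrix (n ⊕ Unit) (n ⊕ Unit) F := fun g => hm (g : Matrix n n F) (ell g) 1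
  have hP : ∀ g ∈ H, ∀ k ∈ H, P (g * k) = P g * P k := by
    intro g hg k hk
    simp only [P]
    rw [hm_mul, hmul g k hg hk, Units.val_mul, one_smul, one_mul]
  have hP1 : P 1 = 1 := by simp only [P]; rw [hone, Units.val_one, hm_one]
  let T : Submonoid (Matrix (n ⊕ Unit) (n ⊕ Unit) F) :=
    { carrier := {X | ∃ c : F, ∃ g ∈ H, X = c • P g}
      one_mem' := ⟨1, 1, H.one_mem, by rw [hP1, one_smul]⟩
      mul_mem' := by
        rintro _ _ ⟨c, g, hg, rfl⟩ ⟨c', k, hk, rfl⟩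
        exact ⟨c * c', g * k, H.mul_mem hg hk, by rw [hP g hg k hk, smul_mul_smul_comm]⟩ }
  have hTc : Nat.card T ≤ Fintype.card F * Nat.card H := by
    rw [← Nat.card_eq_fintype_card, ← Nat.card_prod]
    refine Nat.card_le_card_of_surjective (fun p : F × H => (⟨p.1 • P p.2, p.1, p.2, p.2.2, rfl⟩ : T)) ?_
    rintro ⟨_, c, g, hg, rfl⟩
    exact ⟨(c, ⟨g, hg⟩), rfl⟩
  let B : Fin d → Matrix (n ⊕ Unit) (n ⊕ Unit) (Polynomial F) := fun i => fromBlocks (Γ i) 0 0 (of fun _ _ => c i)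
  have hBe : ∀ i t, (B i).map (Polynomial.eval t) = hm ((Γ i).map (Polynomial.eval t)) 0 ((c i).eval t) := by
    intro i t
    simp only [B, hm, fromBlocks_map]
    congr 1 <;> ext <;> simp
  have hB1 : ∀ i, (B i).map (fun p => p.coeff 1) = hm (sj J x ε (j i)) 0 0 := by
    intro i
    simp only [B, hm, fromBlocks_map, h1]
    congr 1 <;> ext <;> simp [hc1]
  have hBd : ∀ i a b, (B i a b).natDegree ≤ D := by
    intro i a b
    rcases a with a | a <;> rcases b with b | b <;> simp [B, hΓd, hcd]
  let Cv : Fin (d + 1) → Matrix (n ⊕ Unit) (n ⊕ Unit) (Polynomial F) :=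
    Fin.cons ((1 + Polynomial.X : Polynomial F) • (1 : Matrix (n ⊕ Unit) (n ⊕ Unit) (Polynomial F))) (fun i => (P (h i)).map Polynomial.C * B i * (P (h i)⁻¹).map Polynomial.C)
  have hq0 : 0 < Fintype.card F := Fintype.card_pos
  set K := (d + 1) ^ 2 * D with hK
  have hK0 : 0 < K := by positivity
  have hPP : ∀ i, P (h i) * P (h i)⁻¹ = 1 := fun i => by
    rw [← hP _ (hh i) _ (H.inv_mem (hh i)), mul_inv_cancel, hP1]
  have key := curve_count T Cv _ D ((Fintype.card F - 1) / K) ?_ ?_ ?_ ?_ hli1 ?_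
  · have h5 : Fintype.card F ≤ ((Fintype.card F - 1) / K + 1) * K := by
      have := Nat.lt_div_mul_add hK0 (a := Fintype.card F - 1)
      rw [add_mul, one_mul]; omega
    have h6 : Fintype.card F ^ (d + 1) ≤ K ^ (d + 1) * (Fintype.card F * Nat.card H) := by
      calc Fintype.card F ^ (d + 1) ≤ (((Fintype.card F - 1) / K + 1) * K) ^ (d + 1) := Nat.pow_le_pow_left h5 _
        _ = K ^ (d + 1) * ((Fintype.card F - 1) / K + 1) ^ (d + 1) := by rw [mul_pow, mul_comm]
        _ ≤ _ := Nat.mul_le_mul_left _ (key.trans hTc)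
    refine Nat.le_of_mul_le_mul_left ?_ hq0
    calc _ = Fintype.card F ^ (d + 1) := by rw [pow_succ, mul_comm]
      _ ≤ _ := h6
      _ = _ := by ring
  · intro i a b
    refine Fin.cases ?_ (fun i => ?_) i
    · simp only [Cv, Fin.cons_zero, Matrix.smul_apply, smul_eq_mul, Matrix.one_apply]
      split_ifs
      · rw [mul_one]
        refine (Polynomial.natDegree_add_le _ _).trans ?_
        simp; omega
      · simp
    · have := deg_mul _ _ _ _ (deg_mul ((P (h i)).map Polynomial.C) (B i) 0 D (deg_C _) (hBd i)) (deg_C (P (h i)⁻¹)) a b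
      simpa [Cv] using this
  · intro i
    refine Fin.cases ?_ (fun i => ?_) i
    · ext a b
      simp [Cv, Matrix.smul_apply, Matrix.one_apply]
      split_ifs <;> simp
    · simp only [Cv, Fin.cons_succ]
      rw [map_mul_eval, map_mul_eval, map_C_eval, map_C_eval, hBe, h0, hc0, hm_one, mul_one, hPP]
  · intro i
    refine Fin.cases ?_ (fun i => ?_) i
    · ext a b
      simp [Cv, Matrix.smul_apply, Matrix.one_apply]
      split_ifs <;> simp [Polynomial.coeff_one]
    · simp only [Cv, Fin.cons_succ]
      rw [map_mul_c1, map_mul_c1, map_C_eval, map_C_eval, map_C_c1, map_C_c1, hB1, mul_zero, zero_mul, zero_add, add_zero]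
      change hm _ _ _ * hm _ _ _ * hm _ _ _ = hm _ _ _
      rw [hj, hm_mul, hm_mul]
      simp [vecMul_vecMul]
  · intro i t
    refine Fin.cases ?_ (fun i => ?_) i
    · refine ⟨1 + t, 1, H.one_mem, ?_⟩
      rw [hP1]
      ext a b
      simp [Cv, Matrix.smul_apply, Matrix.one_apply]
      split_ifs <;> simp
    · obtain ⟨k, hk⟩ := ht i t
      refine ⟨(c i).eval t, h i * x ^ k * (h i)⁻¹, H.mul_mem (H.mul_mem (hh i) (H.pow_mem hxm k)) (H.inv_mem (hh i)), ?_⟩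
      rw [hP _ (H.mul_mem (hh i) (H.pow_mem hxm k)) _ (H.inv_mem (hh i)), hP _ (hh i) _ (H.pow_mem hxm k)]
      simp only [Cv, Fin.cons_succ]
      rw [map_mul_eval, map_mul_eval, map_C_eval, map_C_eval, hBe, hk]
      have : hm ((c i).eval t • x.1 ^ k) 0 ((c i).eval t) = (c i).eval t • P (x ^ k) := by
        simp only [P]
        rw [hxk, hm_smul, smul_zero, mul_one, Units.val_pow_eq_pow_val]
      rw [this, mul_smul_comm, smul_mul_assoc]
  · calc (Fintype.card F - 1) / K * (d + 1) * ((d + 1) * D) = (Fintype.card F - 1) / K * K := by rw [hK]; ring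
      _ ≤ _ := Nat.div_mul_le_self _ _
end cnt
end SG
end
section
namespace SG
set_option linter.all false
open Matrix
def NN (m : ℕ) : ℕ := ((2 * m) ^ (2 * m)).factorial
abbrev uu {m : ℕ} {F : Type} [Field F] (x : symplecticGroup (Fin m) F) : (Matrix (Fin m ⊕ Fin m) (Fin m ⊕ Fin m) F)ˣ :=
  (symplecticGroup (Fin m) F).subtype.toHomUnits x
theorem genTop (m D : ℕ) (hm : 2 ≤ m) (hD : 0 < D) : ∃ q0 : ℕ, ∀ (F : Type) [Field F] [Fintype F] [CharP F 2], q0 ≤ Fintype.card F →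
    ∀ (x y : symplecticGroup (Fin m) F) (ε : Matrix (Fin m ⊕ Fin m) (Fin m ⊕ Fin m) F) (Q Qy), Good (Matrix.J (Fin m) F) (uu x) ε Q D →
      Gen (Matrix.J (Fin m) F) (uu y) Qy (NN m) → Q ≠ Qy → ¬ (0 < SS Q ∧ 0 < SS Qy) →
      ((ε = 1 ∧ ¬ Bad (Matrix.J (Fin m) F) (y : Matrix (Fin m ⊕ Fin m) (Fin m ⊕ Fin m) F)) ∨ (ε ≠ 1 ∧ Bad (Matrix.J (Fin m) F) (y : Matrix (Fin m ⊕ Fin m) (Fin m ⊕ Fin m) F))) →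
      Subgroup.closure {x, y} = ⊤ := by
  obtain ⟨q1, hq1⟩ := card_sp_le m
  set d := Fintype.card (Tri (Fin m ⊕ Fin m)) with hd
  set K := ((d + 1) ^ 2 * D) ^ (d + 1) with hK
  refine ⟨max q1 (max (D + D + 1) ((2 * K).factorial + 1)), ?_⟩
  intro F _ _ _ hq x y ε Q Qy G Y hne hS hB
  simp only [max_le_iff] at hq
  obtain ⟨h1, h2, h3⟩ := hq
  haveI : Nonempty (Fin m) := ⟨⟨0, by omega⟩⟩
  have hc : Fintype.card (Fin m ⊕ Fin m) = 2 * m := by simp; ring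
  have key := countH sy_J G Y (by
    intro k hk hk2
    rw [hc] at hk2
    exact Nat.dvd_factorial hk hk2) hne hS hB (by omega) (by omega) hD
  have hmap : Subgroup.closure {uu x, uu y} = (Subgroup.closure {x, y}).map (symplecticGroup (Fin m) F).subtype.toHomUnits := by
    rw [MonoidHom.map_closure, Set.image_pair]
  have hcard : Nat.card (Subgroup.closure {uu x, uu y}) ≤ Nat.card (Subgroup.closure {x, y}) := by
    rw [hmap]
    exact Nat.card_le_card_of_surjective (fun h : Subgroup.closure {x, y} => (⟨_, Subgroup.mem_map_of_mem _ h.2⟩ : (Subgroup.closure {x, y}).map (symplecticGroup (Fin m) F).subtype.toHomUnits)) (by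
      rintro ⟨_, h, hh, rfl⟩
      exact ⟨⟨h, hh⟩, rfl⟩)
  refine index_bound _ (2 * K) (by omega) ?_
  have h5 := hq1 F h1
  have h6 := (Subgroup.closure {x, y}).card_mul_index
  have h7 : 0 < Nat.card (Subgroup.closure {x, y}) := Nat.card_pos
  refine Nat.le_of_mul_le_mul_left ?_ h7
  rw [h6]
  calc _ ≤ _ := h5
    _ ≤ 2 * (K * Nat.card (Subgroup.closure {uu x, uu y})) := Nat.mul_le_mul_left _ key
    _ ≤ 2 * (K * Nat.card (Subgroup.closure {x, y})) := by gcongr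
    _ = _ := by ring
end SG
end
section
namespace SG
set_option linter.all false
open Matrix
section mk
variable {n F : Type} [Fintype n] [DecidableEq n] [Field F]
theorem deg_det (A : Matrix n n (Polynomial F)) (hA : ∀ i j, (A i j).natDegree ≤ 1) : A.det.natDegree ≤ Fintype.card n := by
  rw [det_apply]
  refine Polynomial.natDegree_sum_le_of_forall_le _ _ fun σ _ => ?_
  refine (Polynomial.natDegree_smul_le _ _).trans ?_
  refine (Polynomial.natDegree_prod_le _ _).trans ?_
  refine (Finset.sum_le_sum fun i _ => hA _ _).trans ?_
  simp
theorem deg_adjugate (A : Matrix n n (Polynomial F)) (hA : ∀ i j, (A i j).natDegree ≤ 1) (i j : n) : (A.adjugate i j).natDegree ≤ Fintype.card n := by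
  rw [adjugate_apply]
  refine deg_det _ fun a b => ?_
  rw [updateRow_apply]
  split_ifs
  · rw [Pi.single_apply]; split_ifs <;> simp
  · exact hA a b
variable {E : Type} [CommRing E] [Algebra F E] [StarRing E]
theorem curve_mk [CharP F 2] (b : Module.Basis n F E) (hst : ∀ (c : F) (u : E), star (c • u) = c • star u) (x s : E)
    (hcur : ∀ u t : E, (∃ c : F, u = 1 + c • s) → star u * t = 1 → ∃ k : ℕ, (u * t) ^ 3 = x ^ k) :
    ∃ (Γ : Matrix n n (Polynomial F)) (c : Polynomial F), (∀ i j, (Γ i j).natDegree ≤ 6 * Fintype.card n + 3) ∧ c.natDegree ≤ 6 * Fintype.card n + 3 ∧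
    Γ.map (Polynomial.eval 0) = 1 ∧ c.eval 0 = 1 ∧ c.coeff 1 = 0 ∧
    Γ.map (fun p => p.coeff 1) = Algebra.leftMulMatrix b (s + star s) ∧
    ∀ t : F, ∃ k : ℕ, Γ.map (Polynomial.eval t) = c.eval t • (Algebra.leftMulMatrix b x) ^ k := by
  set μ := Algebra.leftMulMatrix b with hμ
  let P : E → Matrix n n (Polynomial F) := fun s => 1 + (Polynomial.X : Polynomial F) • (μ s).map Polynomial.C
  have hPe : ∀ s t, (P s).map (Polynomial.eval t) = μ (1 + t • s) := by
    intro s t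
    rw [map_add, map_one, map_smul]
    ext i j
    simp only [P, Matrix.map_apply, Matrix.add_apply, Matrix.smul_apply, smul_eq_mul, Polynomial.eval_add, Polynomial.eval_mul, Polynomial.eval_X, Polynomial.eval_C, Matrix.one_apply]
    split_ifs <;> simp
  have hP1 : ∀ s, (P s).map (fun p => p.coeff 1) = μ s := by
    intro s
    ext i j
    simp only [P, Matrix.map_apply, Matrix.add_apply, Matrix.smul_apply, smul_eq_mul, Polynomial.coeff_add, Polynomial.mul_coeff_one, Matrix.one_apply]
    split_ifs <;> simp [Polynomial.coeff_one]
  have hPd : ∀ s i j, (P s i j).natDegree ≤ 1 := by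
    intro s i j
    simp only [P, Matrix.map_apply, Matrix.add_apply, Matrix.smul_apply, smul_eq_mul, Matrix.one_apply]
    refine Polynomial.natDegree_add_le_of_degree_le ?_ ?_
    · split_ifs <;> simp
    · exact (Polynomial.natDegree_mul_C_le _ _).trans Polynomial.natDegree_X_le
  set δ := (P (star s)).det with hδ
  have hδd : δ.natDegree ≤ Fintype.card n := deg_det _ (hPd _)
  set Γ := P s * (δ • (P (star s)).adjugate) with hΓ
  have hδe : ∀ t, δ.eval t = (μ (1 + t • star s)).det := by
    intro t
    rw [← hPe, hδ]; exact RingHom.map_det (Polynomial.evalRingHom t) _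
  have hΓm : Γ * P (star s) = P s * (δ ^ 2 • (1 : Matrix n n (Polynomial F))) := by
    rw [hΓ, mul_assoc, smul_mul_assoc, adjugate_mul, ← hδ, smul_smul, sq]
  have hΓe : ∀ t, Γ.map (Polynomial.eval t) = μ (1 + t • s) * (δ.eval t • (μ (1 + t • star s)).adjugate) := by
    intro t
    rw [hΓ, map_mul_eval, hPe]
    congr 1
    rw [← hPe]
    have : (P (star s)).adjugate.map (Polynomial.eval t) = ((P (star s)).map (Polynomial.eval t)).adjugate := (RingHom.map_adjugate (Polynomial.evalRingHom t) (P (star s)))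
    rw [← this]
    ext i j; simp
  have hδ0 : δ.eval 0 = 1 := by rw [hδe]; simp
  have hΓ0 : Γ.map (Polynomial.eval 0) = 1 := by
    rw [hΓe, hδ0]; simp
  have hδ2 : (δ ^ 2).coeff 1 = 0 := by
    rw [sq, Polynomial.mul_coeff_one, mul_comm]; exact CharTwo.add_self_eq_zero _
  have hΓd : ∀ i j, (Γ i j).natDegree ≤ 1 + (Fintype.card n + Fintype.card n) := by
    refine deg_mul _ _ _ _ (hPd s) fun i j => ?_
    rw [Matrix.smul_apply, smul_eq_mul]
    exact Polynomial.natDegree_mul_le_of_le hδd (deg_adjugate _ (hPd _) i j)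
  clear_value Γ
  have hΓ1 : Γ.map (fun p => p.coeff 1) = μ (s + star s) := by
    have h1 := congrArg (fun M : Matrix n n (Polynomial F) => M.map (fun p => p.coeff 1)) hΓm
    rw [map_mul_c1, map_mul_c1, hΓ0, hP1, hP1, hPe, hPe] at h1
    have h2 : (δ ^ 2 • (1 : Matrix n n (Polynomial F))).map (fun p => p.coeff 1) = 0 := by
      ext i j
      simp only [Matrix.map_apply, Matrix.smul_apply, smul_eq_mul, Matrix.one_apply]
      split_ifs <;> simp [hδ2]
    have h3 : (δ ^ 2 • (1 : Matrix n n (Polynomial F))).map (Polynomial.eval 0) = 1 := by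
      ext i j
      simp only [Matrix.map_apply, Matrix.smul_apply, smul_eq_mul, Matrix.one_apply]
      split_ifs <;> simp [hδ0]
    rw [h2, h3] at h1
    simp only [zero_smul, add_zero, map_one, one_mul, mul_one, mul_zero, zero_add] at h1
    rw [map_add, ← h1]
    ext i j
    simp only [Matrix.add_apply]
    linear_combination -CharTwo.add_self_eq_zero (μ (star s) i j)
  have hG3 : (Γ * Γ * Γ).map (fun p => p.coeff 1) = μ (s + star s) := by
    rw [map_mul_c1, map_mul_c1, map_mul_eval, hΓ0, hΓ1]
    ext i j
    simp only [Matrix.add_apply, mul_one, one_mul]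
    linear_combination CharTwo.add_self_eq_zero (μ (s + star s) i j)
  refine ⟨Γ * Γ * Γ, (δ ^ 2) * (δ ^ 2) * (δ ^ 2), ?_, ?_, ?_, ?_, ?_, hG3, ?_⟩
  · intro i j
    refine (deg_mul _ _ _ _ (deg_mul _ _ _ _ hΓd hΓd) hΓd i j).trans (by omega)
  · have h2 : (δ ^ 2).natDegree ≤ 2 * Fintype.card n := Polynomial.natDegree_pow_le_of_le 2 hδd
    exact (Polynomial.natDegree_mul_le_of_le (Polynomial.natDegree_mul_le_of_le h2 h2) h2).trans (by omega)
  · rw [map_mul_eval, map_mul_eval, hΓ0]; simp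
  · simp [hδ0]
  · rw [Polynomial.mul_coeff_one, Polynomial.mul_coeff_one, hδ2]; simp
  · intro t
    rw [map_mul_eval, map_mul_eval, hΓe]
    by_cases h0 : δ.eval t = 0
    · exact ⟨0, by simp [h0]⟩
    have h1 : IsUnit (μ (1 + t • star s)) := by rw [isUnit_iff_isUnit_det, ← hδe]; exact isUnit_iff_ne_zero.2 h0
    have h2 : ∃ v, (1 + t • star s) * v = 1 := by
      refine ⟨b.equivFun.symm (h1.unit⁻¹.1 *ᵥ b.equivFun 1), b.equivFun.injective ?_⟩
      have := Algebra.leftMulMatrix_mulVec_repr b (1 + t • star s) (b.equivFun.symm (h1.unit⁻¹.1 *ᵥ b.equivFun 1))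
      change _ *ᵥ b.equivFun _ = b.equivFun _ at this
      rw [← this, LinearEquiv.apply_symm_apply, mulVec_mulVec, ← hμ, IsUnit.mul_val_inv, one_mulVec]
    obtain ⟨v, hv⟩ := h2
    obtain ⟨k, hk⟩ := hcur (1 + t • s) v ⟨t, rfl⟩ (by rw [star_add, star_one, hst, hv])
    refine ⟨k, ?_⟩
    have h3 : δ.eval t • (μ (1 + t • star s)).adjugate = (δ.eval t) ^ 2 • μ v := by
      have h4 := congrArg (fun M => M * μ v) (adjugate_mul (μ (1 + t • star s)))
      simp only [mul_assoc] at h4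
      rw [← map_mul, hv, map_one, mul_one, smul_mul_assoc, one_mul, ← hδe] at h4
      rw [h4, smul_smul, sq]
    rw [h3, mul_smul_comm, ← map_mul, ← map_pow, ← hk, map_pow, pow_three', smul_mul_smul_comm, smul_mul_smul_comm]
    simp
end mk
end SG
end
section
namespace SG
set_option linter.all false
open Matrix
section mk2
variable {n F : Type} [Fintype n] [DecidableEq n] [Field F] [Fintype F] [CharP F 2]
variable {E : Type} [CommRing E] [Algebra F E] [StarRing E]
theorem adj_mu {J : Matrix n n F} (hJ : Sy J) (b : Module.Basis n F E) (B : E → E → F) (hB : ∀ u v, om J (b.equivFun u) (b.equivFun v) = B u v)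
    (hBa : ∀ a u v, B (a * u) v = B u (star a * v)) (a : E) : adj J (Algebra.leftMulMatrix b a) = Algebra.leftMulMatrix b (star a) := by
  refine Matrix.ext_of_mulVec_single fun i => ?_
  generalize (Pi.single i 1 : n → F) = v
  refine om_ext hJ _ _ fun w => ?_
  obtain ⟨v, rfl⟩ := b.equivFun.surjective v
  obtain ⟨w, rfl⟩ := b.equivFun.surjective w
  have h : ∀ a u, Algebra.leftMulMatrix b a *ᵥ b.equivFun u = b.equivFun (a * u) := fun a u => Algebra.leftMulMatrix_mulVec_repr b a u
  have h1 := om_adj hJ (adj J (Algebra.leftMulMatrix b a)) (b.equivFun v) (b.equivFun w)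
  rw [adj_adj hJ, h, hB] at h1
  rw [h1, h, hB, hBa, star_star]
theorem sep_mu [IsReduced E] (b : Module.Basis n F E) (x : E) (hx : Algebra.adjoin F {x} = ⊤) : (Algebra.leftMulMatrix b x).charpoly.Separable := by
  haveI : FiniteDimensional F E := Module.Basis.finiteDimensional_of_finite b
  have hi : IsIntegral F x := IsIntegral.of_finite F x
  have h1 := charpoly_leftMulMatrix (PowerBasis.ofAdjoinEqTop hi hx)
  rw [PowerBasis.ofAdjoinEqTop_gen] at h1
  have h2 : (Algebra.leftMulMatrix b x).charpoly = minpoly F x := by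
    rw [← h1, Algebra.leftMulMatrix_apply, LinearMap.charpoly_toMatrix, Algebra.leftMulMatrix_apply, LinearMap.charpoly_toMatrix]
  rw [h2, PerfectField.separable_iff_squarefree]
  exact (isRadical_iff_squarefree_of_ne_zero (minpoly.ne_zero hi)).1 (minpoly.isRadical F x)
theorem mkGood [IsReduced E] {J : Matrix n n F} (hJ : Sy J) (b : Module.Basis n F E) (B : E → E → F) (hB : ∀ u v, om J (b.equivFun u) (b.equivFun v) = B u v)
    (hBa : ∀ a u v, B (a * u) v = B u (star a * v)) (hst : ∀ (c : F) (u : E), star (c • u) = c • star u)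
    (x e : E) (hx : Algebra.adjoin F {x} = ⊤) (hxx : star x * x = 1) (hx1 : IsUnit (x - 1)) (hee : e * e = e) (hes : star e = e)
    (q : E → F) (hqa : ∀ u v, q (u + v) = q u + q v + B u v) (hqs : ∀ (c : F) u, q (c • u) = c ^ 2 * q u) (hqx : ∀ u, q (x * u) = q u)
    (hcur : ∀ u t : E, (1 - e) * u = 1 - e → star u * t = 1 → ∃ k : ℕ, (u * t) ^ 3 = x ^ k)
    (htri : ∀ W : Submodule F E, (∀ u, ∀ w ∈ W, u * w ∈ W) → (∀ w ∈ W, e * w = 0) ∨ (∀ v, e * v ∈ W) ∨ (∀ v, e * v ∈ W ↔ ∀ w ∈ W, B (e * v) w = 0))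
    (htwo : ∀ u v, e * v = 0 → e * u = 0 → v ≠ 0 → B u v = 0 → ∃ c : F, u = c • v)
    (hfac : ∃ (p : Fin 2 → E) (φ : Fin 2 → E →ₗ[F] F), ∀ u, u - e * u = ∑ j, φ j u • p j)
    (ux : (Matrix n n F)ˣ) (hux : ux.1 = Algebra.leftMulMatrix b x) :
    Good J ux (Algebra.leftMulMatrix b e) (fun v => q (b.equivFun.symm v)) (6 * Fintype.card n + 3) := by
  have hm : ∀ a u, Algebra.leftMulMatrix b a *ᵥ b.equivFun u = b.equivFun (a * u) := fun a u => Algebra.leftMulMatrix_mulVec_repr b a u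
  have hadj := adj_mu hJ b B hB hBa
  set μ := Algebra.leftMulMatrix b with hμ
  have hall : ∀ a, μ a ∈ Algebra.adjoin F {(ux : Matrix n n F)} := by
    intro a
    have h1 : a ∈ Algebra.adjoin F {x} := hx ▸ Algebra.mem_top
    have h2 : μ a ∈ (Algebra.adjoin F {x}).map μ := ⟨a, h1, rfl⟩
    rwa [AlgHom.map_adjoin_singleton, ← hux] at h2
  have hinj : ∀ A A' : Matrix n n F, (∀ u, A *ᵥ b.equivFun u = A' *ᵥ b.equivFun u) → A = A' := by
    intro A A' h
    refine Matrix.ext_of_mulVec_single fun i => ?_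
    obtain ⟨u, hu⟩ := b.equivFun.surjective (Pi.single i (1 : F))
    rw [← hu, h]
  refine ⟨?_, ?_, ?_, hall e, ?_, ?_, ?_, ?_, ?_, ⟨?_, ?_⟩, ?_, ?_⟩
  · rw [hux, hadj, ← map_mul, hxx, map_one]
  · rw [hux, ← map_one μ, ← map_sub]; exact hx1.map μ
  · rw [hux]; exact sep_mu b x hx
  · rw [← map_mul, hee]
  · rw [hadj, hes]
  · obtain ⟨p, φ, h⟩ := hfac
    refine ⟨of fun i j => b.equivFun (p j) i, of fun j i => φ j (b i), hinj _ _ fun u => ?_⟩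
    rw [sub_mulVec, one_mulVec, hm, ← mulVec_mulVec]
    have h1 : ∀ j, (of (fun j i => φ j (b i)) *ᵥ b.equivFun u) j = φ j u := by
      intro j
      conv_rhs => rw [← b.sum_equivFun u, map_sum]
      simp only [mulVec, dotProduct, of_apply, map_smul, smul_eq_mul]
      exact Finset.sum_congr rfl fun i _ => mul_comm _ _
    rw [← map_sub, h, map_sum]
    ext i
    simp only [mulVec, dotProduct] at h1 ⊢
    simp only [of_apply] at h1 ⊢
    simp only [h1, Finset.sum_apply, map_smul, Pi.smul_apply, smul_eq_mul]
    exact Finset.sum_congr rfl fun i _ => mul_comm _ _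
  · intro W hW
    have hWs := fun a => stab_adjoin (hall a) W hW
    have := htri (W.comap b.equivFun.toLinearMap) (fun u w hw => by
      have h1 := hWs u _ hw
      change μ u *ᵥ b.equivFun w ∈ W at h1
      rw [hm] at h1; exact h1)
    rcases this with h | h | h
    · left; intro w hw
      obtain ⟨w, rfl⟩ := b.equivFun.surjective w
      rw [hm, h w hw, map_zero]
    · right; left; intro v
      obtain ⟨v, rfl⟩ := b.equivFun.surjective v
      rw [hm]; exact h v
    · right; right; intro v
      obtain ⟨v, rfl⟩ := b.equivFun.surjective v
      rw [hm]; refine (h v).trans ⟨fun h w hw => ?_, fun h w hw => ?_⟩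
      · obtain ⟨w, rfl⟩ := b.equivFun.surjective w
        rw [hB]; exact h w hw
      · rw [← hB]; exact h _ hw
  · intro u v h1 h2 h3 h4
    obtain ⟨v, rfl⟩ := b.equivFun.surjective v
    obtain ⟨u, rfl⟩ := b.equivFun.surjective u
    rw [hm] at h1 h2
    rw [hB] at h4
    obtain ⟨c, hc⟩ := htwo u v (by simpa using h1) (by simpa using h2) (fun h => h3 (by rw [h, map_zero])) h4
    exact ⟨c, by rw [hc, map_smul]⟩
  · intro v w
    simp only [map_add, hqa]
    rw [← hB, LinearEquiv.apply_symm_apply, LinearEquiv.apply_symm_apply]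
  · intro c v
    simp only [map_smul, hqs]
  · intro v
    obtain ⟨v, rfl⟩ := b.equivFun.surjective v
    rw [hux, hm, LinearEquiv.symm_apply_apply, LinearEquiv.symm_apply_apply, hqx]
  · intro j
    obtain ⟨Γ, c, h1, h2, h3, h4, h5, h6, h7⟩ := curve_mk b hst x (x ^ j * e) (by
      rintro u t ⟨c, rfl⟩ ht
      refine hcur _ t ?_ ht
      have : (1 - e) * (1 + c • (x ^ j * e)) = 1 - e + c • (x ^ j * (e - e * e)) := by
        rw [mul_add, mul_one, mul_smul_comm]; congr 2; ring
      rw [this, hee, sub_self, mul_zero, smul_zero, add_zero])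
    refine ⟨Γ, c, h1, h2, h3, h4, h5, ?_, ?_⟩
    · rw [h6, map_add, hux, ← map_pow, ← map_mul, hadj]
    · rw [hux]; exact h7
end mk2
end SG
end
section
namespace SG
set_option linter.all false
section qa
variable {K : Type} [Field K] [CharP K 2] {a : K}
abbrev QA (a : K) := QuadraticAlgebra K a 1
theorem qa_star (u : QA a) : star u = ⟨u.re + u.im, u.im⟩ := by
  ext <;> simp [CharTwo.neg_eq]
theorem qa_mul_star (u : QA a) : star u * u = algebraMap K _ (u.re * u.re + u.re * u.im + a * u.im * u.im) := by
  rw [qa_star]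
  have := CharTwo.add_self_eq_zero (u.re * u.im)
  have h2 := CharTwo.add_self_eq_zero (u.im * u.im)
  ext <;> simp
  · ring
  · linear_combination this + h2
instance qa_red : IsReduced (QA a) := by
  rw [isReduced_iff_pow_one_lt 2 (by norm_num)]
  intro u hu
  have h1 : (u ^ 2).im = 0 := by rw [hu]; rfl
  have h0 : (u ^ 2).re = 0 := by rw [hu]; rfl
  rw [sq] at h1 h0
  simp at h1 h0
  have h2 : u.im * u.im = 0 := by linear_combination h1 - CharTwo.add_self_eq_zero (u.re * u.im)
  have h3 : u.im = 0 := by simpa using h2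
  rw [h3] at h0
  ext
  · simpa using h0
  · exact h3
theorem qa_char : (2 : QA a) = 0 := by
  ext
  · exact CharTwo.two_eq_zero
  · rfl
theorem qa_cyc [Finite K] : ∃ g : QA a, star g * g = 1 ∧ ∀ v : QA a, star v * v = 1 → ∃ k : ℕ, v = g ^ k := by
  obtain ⟨θ, hθ⟩ : ∃ θ : AlgebraicClosure K, θ * θ = a • 1 + (1 : K) • θ := by
    obtain ⟨θ, hθ⟩ := IsAlgClosed.exists_root (Polynomial.X ^ 2 - Polynomial.X - Polynomial.C (algebraMap K (AlgebraicClosure K) a)) (by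
      have : (Polynomial.X ^ 2 - Polynomial.X - Polynomial.C (algebraMap K (AlgebraicClosure K) a)).degree = 2 := by compute_degree!
      rw [this]; norm_num)
    refine ⟨θ, ?_⟩
    simp [Polynomial.IsRoot] at hθ
    rw [one_smul, ← Algebra.algebraMap_eq_smul_one]
    linear_combination hθ
  let f : QA a →ₐ[K] AlgebraicClosure K := QuadraticAlgebra.lift ⟨θ, hθ⟩
  have hf : ∀ u : QA a, f u = algebraMap K _ u.re + algebraMap K _ u.im * θ := by
    intro u
    change u.re • (1 : AlgebraicClosure K) + u.im • θ = _
    rw [Algebra.smul_def, Algebra.smul_def, mul_one]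
  haveI : CharP (AlgebraicClosure K) 2 := charP_of_injective_algebraMap (algebraMap K _).injective 2
  haveI : Finite (QA a) := Finite.of_equiv _ (QuadraticAlgebra.equivProd a 1).symm
  haveI : Finite (unitary (QA a)) := Subtype.finite
  have hinj : Function.Injective (f.toRingHom.toMonoidHom.comp (unitary (QA a)).subtype) := by
    intro u v h
    have h : f u = f v := h
    have hu : f (star (u : QA a)) * f u = 1 := by rw [← map_mul, (Unitary.mem_iff.1 u.2).1, map_one]
    have hv : f (star (v : QA a)) * f v = 1 := by rw [← map_mul, (Unitary.mem_iff.1 v.2).1, map_one]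
    have h2 : f (star (u : QA a)) = f (star (v : QA a)) := by
      rw [h] at hu
      exact mul_right_cancel₀ (right_ne_zero_of_mul_eq_one hu) (hu.trans hv.symm)
    have hs : ∀ u : QA a, f (star u) = f u + algebraMap K _ u.im := by
      intro u; rw [qa_star, hf, hf]; simp; ring
    rw [hs, hs, h] at h2
    have him : (u : QA a).im = (v : QA a).im := (algebraMap K (AlgebraicClosure K)).injective (add_left_cancel h2)
    rw [hf, hf, him] at h
    have hre := (algebraMap K (AlgebraicClosure K)).injective (add_right_cancel h)
    exact Subtype.ext (QuadraticAlgebra.ext hre him)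
  haveI := isCyclic_of_subgroup_isDomain _ hinj
  obtain ⟨g, hg⟩ := IsCyclic.exists_monoid_generator (α := unitary (QA a))
  refine ⟨g, (Unitary.mem_iff.1 g.2).1, fun v hv => ?_⟩
  obtain ⟨k, hk⟩ := hg ⟨v, Unitary.mem_iff.2 ⟨hv, by rw [mul_comm]; exact hv⟩⟩
  exact ⟨k, (congrArg Subtype.val hk).symm⟩
def nz (a c : K) : K := c * c + c + a
theorem nz_card [Fintype K] [DecidableEq K] (a : K) : (Finset.univ.filter fun c => nz a c = 0).card ≤ 2 := by
  by_cases h : ∃ c, nz a c = 0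
  · obtain ⟨c, hc⟩ := h
    refine (Finset.card_le_card (t := {c, c + 1}) ?_).trans Finset.card_le_two
    intro d hd
    have hd := (Finset.mem_filter.1 hd).2
    simp only [nz] at hd hc
    have : (c + d) * (c + 1 + d) = 0 := by linear_combination hc + hd - CharTwo.add_self_eq_zero a + CharTwo.add_self_eq_zero (c * d)
    rw [Finset.mem_insert, Finset.mem_singleton]
    rcases mul_eq_zero.1 this with h | h
    · left; exact (CharTwo.add_eq_zero.1 h).symm
    · right; exact (CharTwo.add_eq_zero.1 h).symm
  · push Not at h
    simp [h]
theorem qa_re1 : (1 : QA a).re = 1 := rfl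
theorem qa_im1 : (1 : QA a).im = 0 := rfl
theorem qa_inv (c : K) (h : nz a c ≠ 0) : (⟨c, 1⟩ : QA a) * ((nz a c)⁻¹ • ⟨c + 1, 1⟩) = 1 := by
  ext <;> simp
  · rw [qa_re1]; field_simp; rw [nz]; ring
  · rw [qa_im1]; field_simp; linear_combination CharTwo.add_self_eq_zero (c + 1)
theorem qa_gen {F : Type} [Field F] [Algebra F K] [Fintype K] (hK : 6 ≤ Fintype.card K) : ∃ g : QA a, star g * g = 1 ∧ Algebra.adjoin F {g} = ⊤ ∧ g.im ≠ 0 ∧ g.im ≠ 1 ∧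
    ∀ v : QA a, star v * v = 1 → ∃ k : ℕ, v = g ^ k := by
  classical
  haveI : Finite (QA a) := Finite.of_equiv _ (QuadraticAlgebra.equivProd a 1).symm
  obtain ⟨g, hg, hgen⟩ := qa_cyc (a := a)
  have hu : ∀ c : K, nz a c ≠ 0 → ∃ k : ℕ, (1 : QA a) + (nz a c)⁻¹ • ⟨c + 1, 1⟩ = g ^ k := by
    intro c hc
    refine hgen (1 + (nz a c)⁻¹ • ⟨c + 1, 1⟩) ?_
    have h1 := qa_inv c hc
    have h2 := congrArg star h1
    rw [star_mul', star_one, qa_star ⟨c, 1⟩] at h2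
    set v : QA a := (nz a c)⁻¹ • ⟨c + 1, 1⟩ with hv
    have h3 : (⟨c + 1, 1⟩ : QA a) = ⟨c, 1⟩ + 1 := by
      ext
      · rfl
      · exact (add_zero _).symm
    have h4 : ((⟨c, 1⟩ + 1) * star v : QA a) = 1 := by rw [← h3]; exact h2
    rw [star_add, star_one]
    generalize star v = w at *
    generalize (⟨c, 1⟩ : QA a) = z at *
    have h5 : 1 + v = v * (z + 1) := by linear_combination -h1
    have h6 : 1 + w = w * z := by linear_combination -h4 + w * (qa_char : (2 : QA a) = 0)
    rw [h5, h6]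
    linear_combination w * (z + 1) * h1 + h4
  have hbad : ∀ b : K, ∀ l, (Finset.univ.filter fun c => nz a c = 0) ∪ (Finset.univ.filter fun c => nz b c = 0).image (· + l) ≠ Finset.univ := by
    intro b l h
    have h1 := congrArg Finset.card h
    have h2 := Finset.card_union_le (Finset.univ.filter fun c => nz a c = 0) ((Finset.univ.filter fun c => nz b c = 0).image (· + l))
    have h3 := Finset.card_image_le (s := Finset.univ.filter fun c => nz b c = 0) (f := (· + l))
    have h4 := nz_card a
    have h5 := nz_card b
    rw [Finset.card_univ] at h1
    omega
  have hc : ∀ b l, ∃ c, nz a c ≠ 0 ∧ nz b (c + l) ≠ 0 := by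
    intro b l
    by_contra! h
    refine hbad b l (Finset.eq_univ_iff_forall.2 fun c => ?_)
    rw [Finset.mem_union, Finset.mem_image]
    by_cases hc : nz a c = 0
    · left; simp [hc]
    · right
      exact ⟨c + l, by simp [h c hc], by rw [add_assoc, CharTwo.add_self_eq_zero, add_zero]⟩
  obtain ⟨c0, hc0, -⟩ := hc a 0
  have him : ∀ c, ((1 : QA a) + (nz a c)⁻¹ • ⟨c + 1, 1⟩).im = (nz a c)⁻¹ := by
    intro c; simp; rfl
  refine ⟨g, hg, ?_, ?_, ?_, hgen⟩
  · have hz : ∀ c, nz a c ≠ 0 → (⟨c, 1⟩ : QA a) ∈ Algebra.adjoin F {g} := by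
      intro c hc
      obtain ⟨k, hk⟩ := hu c hc
      have hi := qa_inv c hc
      have hv : (nz a c)⁻¹ • (⟨c + 1, 1⟩ : QA a) ∈ Algebra.adjoin F {g} := by
        rw [← add_sub_cancel_left (1 : QA a) ((nz a c)⁻¹ • ⟨c + 1, 1⟩), hk]
        exact Subalgebra.sub_mem _ (Subalgebra.pow_mem _ (Algebra.self_mem_adjoin_singleton _ _) _) (Subalgebra.one_mem _)
      generalize (nz a c)⁻¹ • (⟨c + 1, 1⟩ : QA a) = v at *
      have hp : v ^ Nat.card (QA a)ˣ = 1 := by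
        obtain ⟨w, hw⟩ : IsUnit v := IsUnit.of_mul_eq_one _ ((mul_comm _ _).trans hi)
        rw [← hw, ← Units.val_pow_eq_pow_val, pow_card_eq_one', Units.val_one]
      have : (⟨c, 1⟩ : QA a) = v ^ (Nat.card (QA a)ˣ - 1) := by
        obtain ⟨n, hn⟩ := Nat.exists_eq_succ_of_ne_zero (Nat.card_pos (α := (QA a)ˣ)).ne'
        rw [hn, pow_succ] at hp
        rw [hn, Nat.succ_sub_one]
        linear_combination v ^ n * hi - ⟨c, 1⟩ * hp
      rw [this]
      exact Subalgebra.pow_mem _ hv _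
    have hl : ∀ l : K, (⟨l, 0⟩ : QA a) ∈ Algebra.adjoin F {g} := by
      intro l
      obtain ⟨c, h1, h2⟩ := hc a l
      have := Subalgebra.sub_mem _ (hz _ h2) (hz _ h1)
      convert this using 1
      ext <;> simp
    rw [eq_top_iff]
    intro u _
    have : u = ⟨u.re, 0⟩ + ⟨u.im, 0⟩ * (⟨c0, 1⟩ - ⟨c0, 0⟩) := by ext <;> simp
    rw [this]
    exact Subalgebra.add_mem _ (hl _) (Subalgebra.mul_mem _ (hl _) (Subalgebra.sub_mem _ (hz _ hc0) (hl _)))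
  · intro h0
    have h1 : star g = g := by
      rw [qa_star]; ext <;> simp [h0]
    have h2 : (g - 1) ^ 2 = 0 := by rw [h1] at hg; linear_combination hg + (1 - g) * (qa_char : (2 : QA a) = 0)
    have h3 : g = 1 := by rw [← sub_eq_zero]; exact pow_eq_zero_iff (two_ne_zero) |>.1 h2
    obtain ⟨k, hk⟩ := hu c0 hc0
    rw [h3, one_pow] at hk
    have := him c0
    rw [hk] at this
    exact inv_ne_zero hc0 this.symm
  · intro h0
    have h1 : star g = g + 1 := by
      rw [qa_star, h0]
      ext
      · rfl
      · exact h0.symm.trans (add_zero _).symm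
    rw [h1] at hg
    have h2 : ∀ k : ℕ, g ^ k = 1 ∨ g ^ k = g ∨ g ^ k = g + 1 := by
      intro k
      induction k with
      | zero => left; simp
      | succ k ih =>
        rw [pow_succ]
        rcases ih with h | h | h <;> rw [h]
        · simp
        · right; right; linear_combination hg - g * (qa_char : (2 : QA a) = 0)
        · left; exact hg
    have h3 : ∀ c, nz a c ≠ 0 → nz a c = 1 := by
      intro c hc
      obtain ⟨k, hk⟩ := hu c hc
      have h4 := him c
      have h5 : (g + 1).im = 1 := (add_zero g.im).trans h0
      rw [← inv_inj, inv_one, ← h4, hk]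
      rcases h2 k with h | h | h
      · rw [hk, h] at h4
        exact absurd h4.symm (inv_ne_zero hc)
      · rw [h, h0]
      · rw [h, h5]
    obtain ⟨c, h4, h5⟩ := hc (a + 1) 0
    refine h5 ?_
    have := h3 c h4
    rw [add_zero]
    simp only [nz] at this ⊢
    linear_combination this + CharTwo.two_eq_zero (R := K)
end qa
end SG
end
section
namespace SG
set_option linter.all false
open Matrix
section bas
variable {F L E : Type} [Field F] [AddCommGroup L] [Module F L] [AddCommGroup E] [Module F E] {m : ℕ}
theorem symp_basis [FiniteDimensional F L] (hL : Module.finrank F L = m) (β : LinearMap.BilinForm F L) (hβ : ∀ r, (∀ s, β r s = 0) → r = 0)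
    (hs : ∀ r s, β r s = β s r) (φ : E ≃ₗ[F] L × L) [CharP F 2] :
    ∃ b : Module.Basis (Fin m ⊕ Fin m) F E, ∀ u v, om (Matrix.J (Fin m) F) (b.equivFun u) (b.equivFun v) = β (φ u).1 (φ v).2 + β (φ u).2 (φ v).1 := by
  have hn : β.Nondegenerate := ⟨hβ, fun r h => hβ r fun s => (hs r s).trans (h s)⟩
  let c := Module.finBasisOfFinrankEq F L hL
  let d := β.dualBasis hn c
  refine ⟨(c.prod d).map φ.symm, fun u v => ?_⟩
  have h1 : ∀ r s : L, β r s = ∑ i, c.repr r i * d.repr s i := by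
    intro r s
    conv_lhs => rw [← c.sum_repr r, ← d.sum_repr s]
    simp only [map_sum, LinearMap.sum_apply, map_smul, LinearMap.smul_apply, smul_eq_mul]
    refine Finset.sum_congr rfl fun i _ => ?_
    rw [Finset.sum_eq_single i]
    · rw [hs, LinearMap.BilinForm.apply_dualBasis_left, if_pos rfl]; ring
    · intro j _ hj
      rw [hs, LinearMap.BilinForm.apply_dualBasis_left, if_neg hj]; ring
    · simp
  rw [hs (φ u).2, h1, h1]
  simp [om, Matrix.J, dotProduct, mulVec, Fintype.sum_sum_type, fromBlocks, Matrix.one_apply, CharTwo.neg_eq]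
  exact Finset.sum_congr rfl fun i _ => mul_comm _ _
end bas
section qb
variable {K : Type} [Field K] [CharP K 2] {a : K}
def qb (u v : QA a) : K := u.re * v.im + u.im * v.re
def qn (u : QA a) : K := u.re * u.re + u.re * u.im + a * u.im * u.im
theorem qb_adj (c u v : QA a) : qb (c * u) v = qb u (star c * v) := by
  have h2 := CharTwo.two_eq_zero (R := K)
  rw [qa_star]
  simp [qb]
  linear_combination -(u.re * c.im * v.im) * h2
theorem qn_add (u v : QA a) : qn (u + v) = qn u + qn v + qb u v := by
  have h2 := CharTwo.two_eq_zero (R := K)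
  simp [qb, qn]
  linear_combination (u.re*v.re + a*u.im*v.im) * h2
theorem qn_mul (u v : QA a) : qn (u * v) = qn u * qn v := by
  have h2 := CharTwo.two_eq_zero (R := K)
  simp [qn]
  linear_combination (2*u.re*v.re*a*u.im*v.im + u.re*a*u.im*v.im^2 + v.re*a*u.im^2*v.im + a*u.im^2*v.im^2) * h2
theorem qn_smul {F : Type} [Field F] [Algebra F K] (c : F) (u : QA a) : qn (c • u) = c ^ 2 • qn u := by
  change (c • u.re) * (c • u.re) + (c • u.re) * (c • u.im) + a * (c • u.im) * (c • u.im) = _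
  simp only [qn, Algebra.smul_def, map_pow]
  ring
theorem qn_star (u : QA a) : star u * u = algebraMap K _ (qn u) := qa_mul_star u
end qb
section cons
variable {F K : Type} [Field F] [CharP F 2] [Field K] [CharP K 2] [Algebra F K] [FiniteDimensional F K] (a : K) (k : ℕ)
abbrev EE (F : Type) [Field F] {K : Type} [Field K] (a : K) (k : ℕ) := QuadraticAlgebra K a 1 × (Fin k → QuadraticAlgebra F 1 1)
def eL : EE F a k ≃ₗ[F] (K × (Fin k → F)) × (K × (Fin k → F)) where
  toFun u := ((u.1.re, fun i => (u.2 i).re), (u.1.im, fun i => (u.2 i).im))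
  invFun p := (⟨p.1.1, p.2.1⟩, fun i => ⟨p.1.2 i, p.2.2 i⟩)
  map_add' u v := rfl
  map_smul' c u := rfl
  left_inv u := rfl
  right_inv p := rfl
variable {a k} (ℓ : K →ₗ[F] F)
noncomputable def eB (u v : EE F a k) : F := ℓ (qb u.1 v.1) + ∑ i, qb (u.2 i) (v.2 i)
noncomputable def eQ (u : EE F a k) : F := ℓ (qn u.1) + ∑ i, qn (u.2 i)
theorem eB_adj (c u v : EE F a k) : eB ℓ (c * u) v = eB ℓ u (star c * v) := by
  simp only [eB, Prod.fst_mul, Prod.snd_mul, Pi.mul_apply, qb_adj, Prod.fst_star, Prod.snd_star, Pi.star_apply]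
theorem eQ_add (u v : EE F a k) : eQ ℓ (u + v) = eQ ℓ u + eQ ℓ v + eB ℓ u v := by
  simp only [eQ, eB, Prod.fst_add, Prod.snd_add, Pi.add_apply, qn_add, map_add, Finset.sum_add_distrib]
  ring
theorem eQ_smul (c : F) (u : EE F a k) : eQ ℓ (c • u) = c ^ 2 * eQ ℓ u := by
  simp only [eQ, Prod.smul_fst, Prod.smul_snd, Pi.smul_apply, qn_smul, map_smul, smul_eq_mul, mul_add, Finset.mul_sum]
theorem ell_nd (hℓ : ℓ ≠ 0) (r : K) (h : ∀ s, ℓ (s * r) = 0) : r = 0 := by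
  by_contra hr
  refine hℓ (LinearMap.ext fun s => ?_)
  have := h (s * r⁻¹)
  rwa [inv_mul_cancel_right₀ hr] at this
theorem e_basis (hℓ : ℓ ≠ 0) {m : ℕ} (hm : Module.finrank F K + k = m) :
    ∃ b : Module.Basis (Fin m ⊕ Fin m) F (EE F a k), ∀ u v, om (Matrix.J (Fin m) F) (b.equivFun u) (b.equivFun v) = eB ℓ u v := by
  let t : (K × (Fin k → F)) →ₗ[F] F := ℓ.coprod (∑ i, LinearMap.proj i)
  have ht : ∀ r, t r = ℓ r.1 + ∑ i, r.2 i := by intro r; simp [t]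
  have hnd : ∀ r, (∀ s, (LinearMap.mul F (K × (Fin k → F))).compr₂ t r s = 0) → r = 0 := by
    intro r h
    ext i
    · refine ell_nd ℓ hℓ _ fun s => ?_
      have := h (s, 0)
      simpa [ht, mul_comm] using this
    · have := h (0, Pi.single i 1)
      simpa [ht, Pi.single_apply] using this
  obtain ⟨b, hb⟩ := symp_basis (m := m) (by rw [Module.finrank_prod, Module.finrank_fin_fun, hm]) _ hnd (fun r s => by simp [mul_comm]) (eL a k)
  refine ⟨b, fun u v => ?_⟩
  rw [hb]
  simp [ht, eL, eB, qb, Finset.sum_add_distrib]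
  ring
end cons
end SG
end
section
namespace SG
set_option linter.all false
open Matrix
section mk3
variable {F K : Type} [Field F] [Fintype F] [CharP F 2] [Field K] [Fintype K] [CharP K 2] [Algebra F K] {a : K} {k : ℕ}
noncomputable instance {a : K} : Fintype (QA a) := Fintype.ofEquiv _ (QuadraticAlgebra.equivProd a 1).symm
theorem om_fac : (⟨0, 1⟩ : QA (1 : F)) * ⟨0, 1⟩ = ⟨0, 1⟩ + 1 := by
  ext
  · simp; rfl
  · simp; rfl
theorem e_adjoin (g : QA a) (hg : star g * g = 1) (ha : Algebra.adjoin F {g} = ⊤) (h1 : g.im ≠ 1) (hk : k ≤ 1) :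
    Algebra.adjoin F {((g, fun _ => ⟨0, 1⟩) : EE F a k)} = ⊤ := by
  set x : EE F a k := (g, fun _ => ⟨0, 1⟩) with hx
  have hxm : x ∈ Algebra.adjoin F {x} := Algebra.self_mem_adjoin_singleton _ _
  have hg2 : g * g + g + 1 = algebraMap K _ (g.im + 1) * g := by
    have hs : star g = g + algebraMap K _ g.im := by
      rw [qa_star]; ext <;> simp
    rw [hs] at hg
    rw [map_add, map_one]
    linear_combination hg + (1 - g * algebraMap K _ g.im) * (qa_char : (2 : QA a) = 0)
  have h2 : x * x + x + 1 = (algebraMap K _ (g.im + 1) * g, 0) := by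
    refine Prod.ext hg2 (funext fun i => ?_)
    change (⟨0, 1⟩ : QA (1 : F)) * ⟨0, 1⟩ + ⟨0, 1⟩ + 1 = 0
    rw [om_fac]
    linear_combination (⟨0, 1⟩ + 1) * (qa_char : (2 : QA (1 : F)) = 0)
  have hu : IsUnit (algebraMap K (QA a) (g.im + 1) * g) := by
    refine IsUnit.mul ((IsUnit.mk0 _ fun h => h1 (CharTwo.add_eq_zero.1 h)).map _) (IsUnit.of_mul_eq_one _ ((mul_comm _ _).trans hg))
  have he : ((1, 0) : EE F a k) ∈ Algebra.adjoin F {x} := by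
    obtain ⟨w, hw⟩ := hu
    have h3 : ((1, 0) : EE F a k) = (x * x + x + 1) ^ Nat.card (QA a)ˣ := by
      rw [h2, ← hw]
      refine Prod.ext ?_ ?_
      · rw [Prod.pow_fst, ← Units.val_pow_eq_pow_val, pow_card_eq_one', Units.val_one]
      · rw [Prod.pow_snd, zero_pow Nat.card_pos.ne']
    rw [h3]
    exact Subalgebra.pow_mem _ (Subalgebra.add_mem _ (Subalgebra.add_mem _ (Subalgebra.mul_mem _ hxm hxm) hxm) (Subalgebra.one_mem _)) _
  rw [eq_top_iff]
  rintro ⟨u, w⟩ -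
  have h4 : ((u, 0) : EE F a k) ∈ Algebra.adjoin F {x} := by
    have h5 : u ∈ (Algebra.adjoin F {x}).map (AlgHom.fst F (QA a) (Fin k → QA (1 : F))) := by
      rw [AlgHom.map_adjoin_singleton]
      change u ∈ Algebra.adjoin F {g}
      rw [ha]; trivial
    obtain ⟨z, hz, hz2⟩ := h5
    have := Subalgebra.mul_mem _ hz he
    convert this using 1
    refine Prod.ext ?_ ?_
    · change u = z.1 * 1
      rw [mul_one]; exact hz2.symm
    · change 0 = z.2 * 0
      rw [mul_zero]
  have h5 : ((0, w) : EE F a k) ∈ Algebra.adjoin F {x} := by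
    rcases Nat.le_one_iff_eq_zero_or_eq_one.1 hk with rfl | rfl
    · rw [Subsingleton.elim w 0]
      exact Subalgebra.zero_mem _
    · have h6 : ((0, w) : EE F a 1) = ((w 0).re • (1 : EE F a 1) + (w 0).im • x) * (1 - (1, 0)) := by
        refine Prod.ext ?_ (funext fun i => ?_)
        · simp
        · rw [Subsingleton.elim i 0]
          simp [hx]
          ext <;> simp
          · exact (mul_one _).symm
          · exact Or.inr rfl
      rw [h6]
      exact Subalgebra.mul_mem _ (Subalgebra.add_mem _ (Subalgebra.smul_mem _ (Subalgebra.one_mem _) _) (Subalgebra.smul_mem _ hxm _)) (Subalgebra.sub_mem _ (Subalgebra.one_mem _) he)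
  convert Subalgebra.add_mem _ h4 h5 using 1
  refine Prod.ext ?_ ?_ <;> simp
theorem qb_par (v w0 : QA a) (hne : w0 ≠ 0) (h1 : qb v w0 = 0) : ∃ c : K, v = algebraMap K _ c * w0 := by
  simp only [qb] at h1
  have h2 : v.re * w0.im = v.im * w0.re := CharTwo.add_eq_zero.1 h1
  by_cases hi : w0.im = 0
  · have hr : w0.re ≠ 0 := fun hr => hne (QuadraticAlgebra.ext hr hi)
    rw [hi, mul_zero] at h2
    have h3 : v.im = 0 := by
      rcases mul_eq_zero.1 h2.symm with h | h
      · exact h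
      · exact absurd h hr
    refine ⟨v.re / w0.re, ?_⟩
    ext <;> simp [hi, h3]
    field_simp
  · refine ⟨v.im / w0.im, ?_⟩
    ext <;> simp <;> field_simp
    linear_combination h2
theorem qa_star_smul (c : F) (u : QA a) : star (c • u) = c • star u := by
  rw [qa_star, qa_star]
  ext
  · exact (smul_add _ _ _).symm
  · rfl
theorem qn_zero_sub (W : Set (QA a)) (hW : ∀ u, ∀ w ∈ W, u * w ∈ W) (hWa : ∀ u ∈ W, ∀ w ∈ W, u + w ∈ W) (h0 : ∀ w ∈ W, qn w = 0) (w0 : QA a) (hw0 : w0 ∈ W) (hne : w0 ≠ 0)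
    (ℓ : K →ₗ[F] F) (hℓ : ℓ ≠ 0) (v : QA a) : v ∈ W ↔ ∀ w ∈ W, ℓ (qb v w) = 0 := by
  constructor
  · intro hv w hw
    have h1 := qn_add v w
    rw [h0 _ (hWa _ hv _ hw), h0 _ hv, h0 _ hw, zero_add, zero_add] at h1
    rw [← h1, map_zero]
  · intro h
    have h1 : qb v w0 = 0 := by
      refine ell_nd ℓ hℓ _ fun s => ?_
      have := h (algebraMap K _ s * w0) (hW _ _ hw0)
      convert this using 2
      simp [qb]; ring
    obtain ⟨c, rfl⟩ := qb_par v w0 hne h1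
    exact hW _ _ hw0
theorem qn_unit (u : QA a) (h : qn u ≠ 0) : ∃ w, w * u = 1 := by
  refine ⟨algebraMap K _ (qn u)⁻¹ * star u, ?_⟩
  rw [mul_assoc, qn_star, ← map_mul, inv_mul_cancel₀ h, map_one]
theorem mkX {m : ℕ} (ℓ : K →ₗ[F] F) (hℓ : ℓ ≠ 0) (hk : k ≤ 1) (hm : Module.finrank F K + k = m) (hK : 6 ≤ Fintype.card K) (a : K) :
    ∃ (x : symplecticGroup (Fin m) F) (ε : Matrix (Fin m ⊕ Fin m) (Fin m ⊕ Fin m) F) (Q : (Fin m ⊕ Fin m → F) → F),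
      Good (Matrix.J (Fin m) F) (uu x) ε Q (6 * Fintype.card (Fin m ⊕ Fin m) + 3) ∧ (k = 0 → ε = 1) ∧ (k = 1 → ε ≠ 1) ∧
      SS Q = (∑ u : QA a, psi F (ℓ (qn u))) * (∑ u : QA (1 : F), psi F (qn u)) ^ k := by
  obtain ⟨b, hb⟩ := e_basis (a := a) ℓ hℓ hm
  obtain ⟨g, hg, had, hg0, hg1, hgen⟩ := qa_gen (a := a) (F := F) hK
  have hstar : star (⟨0, 1⟩ : QA (1 : F)) = ⟨0, 1⟩ + 1 := by
    rw [qa_star]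
    ext
    · rfl
    · exact (add_zero _).symm
  have hom : star (⟨0, 1⟩ : QA (1 : F)) * ⟨0, 1⟩ = 1 := by
    rw [hstar, add_mul, om_fac]
    linear_combination (⟨0, 1⟩ : QA (1 : F)) * (qa_char : (2 : QA (1 : F)) = 0)
  have hom3 : (⟨0, 1⟩ : QA (1 : F)) ^ 3 = 1 := by
    rw [hstar] at hom
    linear_combination (⟨0, 1⟩ : QA (1 : F)) * om_fac (F := F) + hom
  set x : EE F a k := (g, fun _ => ⟨0, 1⟩) with hx
  have hxx : star x * x = 1 := Prod.ext hg (funext fun i => hom)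
  have hN : ∀ (K : Type) [Field K] [CharP K 2] (a : K) (g : QA a), star g * g = 1 → qn g = 1 := by
    intro K _ _ a g hg
    rw [qn_star] at hg
    exact congrArg QuadraticAlgebra.re hg
  have hxs : Algebra.leftMulMatrix b x ∈ symplecticGroup (Fin m) F := by
    rw [mem_sp', adj_mu sy_J b _ hb (eB_adj ℓ), ← map_mul, hxx, map_one]
  refine ⟨⟨_, hxs⟩, _, _, mkGood sy_J b _ hb (eB_adj ℓ) (fun c u => ?_) x (1, 0) (e_adjoin g hg had hg1 hk) hxx ?_ ?_ ?_ (eQ ℓ) (eQ_add ℓ) (eQ_smul ℓ) ?_ ?_ ?_ ?_ ?_ _ rfl, ?_, ?_, ?_⟩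
  · exact Prod.ext (qa_star_smul _ _) (funext fun i => qa_star_smul _ _)
  · rw [Prod.isUnit_iff, Pi.isUnit_iff]
    have hne : ∀ (K : Type) [Field K] [CharP K 2] (a : K) (g : QA a), g - 1 = g + 1 := fun K _ _ a g => by
      linear_combination -(qa_char : (2 : QA a) = 0)
    refine ⟨?_, fun i => ?_⟩
    · obtain ⟨w, hw⟩ := qn_unit (g + 1) (by
        rw [qn_add, hN _ _ _ hg, hN _ _ _ (show star (1 : QA a) * 1 = 1 by simp), CharTwo.add_self_eq_zero, zero_add, qb, qa_re1, qa_im1]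
        simpa using hg0)
      change IsUnit (g - 1)
      rw [hne]
      exact IsUnit.of_mul_eq_one _ ((mul_comm _ _).trans hw)
    · change IsUnit ((⟨0, 1⟩ : QA (1 : F)) - 1)
      rw [hne, ← hstar]
      exact IsUnit.of_mul_eq_one _ hom
  · refine Prod.ext ?_ ?_ <;> simp
  · refine Prod.ext ?_ ?_ <;> simp
  · intro u
    simp only [eQ, Prod.fst_mul, Prod.snd_mul, Pi.mul_apply, qn_mul, hx, hN _ _ _ hg, hN _ _ _ hom, one_mul]
  · intro u t hu ht
    have hu2 : u.2 = 1 := by simpa using congrArg Prod.snd hu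
    have ht2 : star u.2 * t.2 = 1 := congrArg Prod.snd ht
    have ht1 : star u.1 * t.1 = 1 := congrArg Prod.fst ht
    rw [hu2, star_one, one_mul] at ht2
    obtain ⟨i, hi⟩ := hgen (u.1 * t.1) (by
      have h2 := congrArg star ht1
      rw [star_mul', star_star, star_one] at h2
      rw [star_mul']
      linear_combination ht1 + (star u.1 * t.1) * h2)
    refine ⟨3 * i, Prod.ext ?_ ?_⟩
    · change (u.1 * t.1) ^ 3 = g ^ (3 * i)
      rw [hi, ← pow_mul, mul_comm]
    · refine funext fun j => ?_
      change ((u.2 * t.2) ^ 3) j = (⟨0, 1⟩ : QA (1 : F)) ^ (3 * i)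
      rw [hu2, ht2, pow_mul, hom3]
      simp
  · intro W hW
    have he : ∀ w : EE F a k, ((1, 0) : EE F a k) * w = (w.1, 0) := fun w => Prod.ext (one_mul _) (zero_mul _)
    have hWe : ∀ w ∈ W, ((w.1, 0) : EE F a k) ∈ W := fun w hw => he w ▸ hW _ _ hw
    simp only [he]
    by_cases h1 : ∀ w ∈ W, w.1 = 0
    · left; intro w hw; rw [h1 w hw]; rfl
    right
    push Not at h1
    obtain ⟨w0, hw0, hne⟩ := h1
    by_cases h2 : ∃ w ∈ W, qn w.1 ≠ 0
    · left
      obtain ⟨w, hw, h2⟩ := h2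
      obtain ⟨c, hc⟩ := qn_unit _ h2
      intro v
      have := hW ((v.1 * c, 0)) _ hw
      convert this using 1
      refine Prod.ext ?_ (zero_mul _).symm
      change v.1 = v.1 * c * w.1
      rw [mul_assoc, hc, mul_one]
    · right
      push Not at h2
      intro v
      have h3 := qn_zero_sub {w : QA a | ((w, 0) : EE F a k) ∈ W} (fun u w hw => by
          have := hW (u, 0) _ hw
          rwa [Prod.mk_mul_mk, mul_zero] at this) (fun u hu w hw => by
          have := W.add_mem hu hw
          rwa [Prod.mk_add_mk, add_zero] at this) (fun w hw => h2 _ hw) w0.1 (hWe _ hw0) hne ℓ hℓ v.1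
      refine h3.trans ⟨fun h w hw => ?_, fun h w hw => ?_⟩
      · have := h w.1 (hWe _ hw)
        simpa [eB, qb] using this
      · have := h _ hw
        simpa [eB, qb] using this
  · intro u v hv hu hv0 hB
    have hv1 : v.1 = 0 := by simpa using congrArg Prod.fst hv
    have hu1 : u.1 = 0 := by simpa using congrArg Prod.fst hu
    rcases Nat.le_one_iff_eq_zero_or_eq_one.1 hk with rfl | rfl
    · exact absurd (Prod.ext hv1 (Subsingleton.elim _ _)) hv0
    · have hv2 : v.2 0 ≠ 0 := fun h => hv0 (Prod.ext hv1 (funext fun i => by rw [Subsingleton.elim i 0]; exact h))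
      obtain ⟨c, hc⟩ := qb_par (u.2 0) _ hv2 (by simpa [eB, hv1, hu1, qb] using hB)
      refine ⟨c, Prod.ext ?_ (funext fun i => ?_)⟩
      · simp [hu1, hv1]
      · rw [Subsingleton.elim i 0, hc, ← Algebra.smul_def]; rfl
  · refine ⟨![(0, 1), (0, fun _ => ⟨0, 1⟩)], ![∑ i, { toFun := fun u => (u.2 i).re, map_add' := fun _ _ => rfl, map_smul' := fun _ _ => rfl }, ∑ i, { toFun := fun u => (u.2 i).im, map_add' := fun _ _ => rfl, map_smul' := fun _ _ => rfl }], fun u => ?_⟩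
    rw [Fin.sum_univ_two]
    refine Prod.ext ?_ (funext fun j => ?_)
    · simp
    · rcases Nat.le_one_iff_eq_zero_or_eq_one.1 hk with rfl | rfl
      · exact j.elim0
      · rw [Subsingleton.elim j 0]
        simp
        ext <;> simp [qa_re1, qa_im1]
  · rintro rfl
    convert map_one (Algebra.leftMulMatrix b) using 2
    exact Prod.ext rfl (Subsingleton.elim _ _)
  · rintro rfl h
    rw [← map_one (Algebra.leftMulMatrix b)] at h
    have := congrFun (congrArg Prod.snd (Algebra.leftMulMatrix_injective b h)) 0
    exact zero_ne_one this
  · rw [SS, Fintype.sum_pow, Finset.sum_mul_sum, ← Fintype.sum_prod_type']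
    refine (Equiv.sum_comp b.equivFun.symm.toEquiv (fun u => psi F (eQ ℓ u))).trans (Finset.sum_congr rfl fun u _ => ?_)
    rw [eQ, AddChar.map_add_eq_mul]
    congr 1
    rcases Nat.le_one_iff_eq_zero_or_eq_one.1 hk with rfl | rfl <;> simp
end mk3
end SG
end
section
namespace SG
set_option linter.all false
open Matrix
section sgn
variable {K : Type} [Field K] [Fintype K] [CharP K 2]
theorem sum_sq (ψ : AddChar K ℤ) (hψ : ψ ≠ 1) (z : K) (hz : z ≠ 0) : ∑ s : K, ψ (s * s * z) = 0 := by
  rw [← AddChar.sum_eq_zero_of_ne_one hψ]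
  refine Fintype.sum_bijective (fun s => s * s * z) (Finite.injective_iff_bijective.1 fun s t h => ?_) _ _ fun _ => rfl
  have h1 := mul_right_cancel₀ hz h
  exact CharTwo.sq_injective (by simpa only [sq] using h1)
theorem sgn_eq (ψ : AddChar K ℤ) (hψ : ψ ≠ 1) (a : K) [DecidableEq K] :
    ∑ u : QA a, ψ (qn u) = Fintype.card K * (Finset.univ.filter fun c => nz a c = 0).card - Fintype.card K := by
  have h1 : ∑ u : QA a, ψ (qn u) = ∑ s : K, ∑ r : K, ψ (r * r + r * s + a * s * s) := by
    rw [Finset.sum_comm, ← Fintype.sum_prod_type']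
    exact Fintype.sum_equiv (QuadraticAlgebra.equivProd a 1) _ _ fun u => rfl
  have h2 : ∀ s : K, ∑ r : K, ψ (r * r + r * s + a * s * s) = ∑ r : K, ψ (s * s * nz a r) - if s = 0 then (Fintype.card K : ℤ) else 0 := by
    intro s
    split_ifs with hs
    · have := sum_sq ψ hψ 1 one_ne_zero
      simp only [mul_one] at this
      simp [hs, this]
    · rw [sub_zero]
      symm
      refine Fintype.sum_bijective (fun r => s * r) (mulLeft_bijective₀ s hs) _ _ fun r => ?_
      rw [nz]; congr 1; ring
  have h3 : ∀ r : K, ∑ s : K, ψ (s * s * nz a r) = if nz a r = 0 then (Fintype.card K : ℤ) else 0 := by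
    intro r
    split_ifs with h
    · simp [h]
    · exact sum_sq ψ hψ _ h
  rw [h1, Finset.sum_congr rfl fun s _ => h2 s, Finset.sum_sub_distrib, Finset.sum_comm, Finset.sum_congr rfl fun s _ => h3 s]
  simp
  rw [Finset.sum_ite]
  simp [mul_comm]
theorem sgn_neg (ψ : AddChar K ℤ) (hψ : ψ ≠ 1) (a : K) (h : ∀ c, nz a c ≠ 0) : ∑ u : QA a, ψ (qn u) < 0 := by
  classical
  rw [sgn_eq ψ hψ]
  simp [h]
  exact Fintype.card_pos
theorem sgn_pos (ψ : AddChar K ℤ) (hψ : ψ ≠ 1) (a : K) (c : K) (h : nz a c = 0) : 0 < ∑ u : QA a, ψ (qn u) := by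
  classical
  rw [sgn_eq ψ hψ]
  have h1 : 1 < (Finset.univ.filter fun c => nz a c = 0).card := by
    rw [Finset.one_lt_card]
    refine ⟨c, by simp [h], c + 1, ?_, by simp⟩
    simp only [Finset.mem_filter, Finset.mem_univ, true_and]
    simp only [nz] at h ⊢
    linear_combination h + (c + 1) * CharTwo.two_eq_zero (R := K)
  have h2 : 0 < Fintype.card K := Fintype.card_pos
  have h3 : (0 : ℤ) < Fintype.card K := by exact_mod_cast h2
  have h4 : (1 : ℤ) < (Finset.univ.filter fun c => nz a c = 0).card := by exact_mod_cast h1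
  nlinarith
theorem ex_as : ∃ a : K, ∀ c, nz a c ≠ 0 := by
  have h : ¬ Function.Surjective fun c : K => c * c + c := by
    rw [← Finite.injective_iff_surjective]
    intro h
    exact zero_ne_one (h (show (0 : K) * 0 + 0 = 1 * 1 + 1 by rw [mul_one, CharTwo.add_self_eq_zero]; simp))
  rw [Function.Surjective] at h
  push Not at h
  obtain ⟨a, ha⟩ := h
  exact ⟨a, fun c hc => ha c (CharTwo.add_eq_zero.1 hc)⟩
end sgn
theorem mkFam (m : ℕ) (hm : 2 ≤ m) (F : Type) [Field F] [Fintype F] [CharP F 2] (hF : 6 ≤ Fintype.card F) (k : ℕ) (hk : k ≤ 1) (P : Prop) :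
    ∃ (x : symplecticGroup (Fin m) F) (ε : Matrix (Fin m ⊕ Fin m) (Fin m ⊕ Fin m) F) (Q : (Fin m ⊕ Fin m → F) → F),
      Good (Matrix.J (Fin m) F) (uu x) ε Q (6 * Fintype.card (Fin m ⊕ Fin m) + 3) ∧ (k = 0 → ε = 1) ∧ (k = 1 → ε ≠ 1) ∧ (0 < SS Q ↔ P) := by
  haveI : Fact (Nat.Prime 2) := ⟨Nat.prime_two⟩
  let K := FiniteField.Extension F 2 (m - k)
  haveI : NeZero (m - k) := ⟨by omega⟩
  have hfr : Module.finrank F K = m - k := FiniteField.finrank_extension F 2 (m - k)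
  haveI : Finite K := Module.finite_of_finite F
  haveI : Fintype K := Fintype.ofFinite K
  haveI : CharP K 2 := charP_of_injective_algebraMap (algebraMap F K).injective 2
  have hK : 6 ≤ Fintype.card K := hF.trans (Fintype.card_le_of_injective _ (algebraMap F K).injective)
  let ℓ := Algebra.trace F K
  have hℓ : ℓ ≠ 0 := Algebra.trace_ne_zero F K
  let ψ : AddChar K ℤ := (psi F).compAddMonoidHom ℓ.toAddMonoidHom
  have hψ : ψ ≠ 1 := by
    intro h
    refine psi_ne (F := F) (DFunLike.ext _ _ fun c => ?_)
    obtain ⟨y, hy⟩ := Algebra.trace_surjective F K c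
    have := DFunLike.congr_fun h y
    rw [← hy]; exact this
  have hmk : ∀ a : K, _ := mkX ℓ hℓ hk (by omega : Module.finrank F K + k = m) hK
  have hT : (∑ u : QA (1 : F), psi F (qn u)) ≠ 0 := by
    by_cases h : ∃ c : F, nz 1 c = 0
    · obtain ⟨c, h⟩ := h
      exact (sgn_pos _ psi_ne _ c h).ne'
    · push Not at h
      exact (sgn_neg _ psi_ne _ h).ne
  set T := (∑ u : QA (1 : F), psi F (qn u)) ^ k with hTk
  have hT0 : T ≠ 0 := pow_ne_zero _ hT
  obtain ⟨a, ha⟩ := ex_as (K := K)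
  have h1 : 0 < ∑ u : QA (0 : K), psi F (ℓ (qn u)) := sgn_pos ψ hψ 0 0 (by simp [nz])
  have h2 : ∑ u : QA a, psi F (ℓ (qn u)) < 0 := sgn_neg ψ hψ a ha
  obtain ⟨x, ε, Q, h3, h4, h5, h6⟩ := hmk 0
  obtain ⟨x', ε', Q', h3', h4', h5', h6'⟩ := hmk a
  by_cases hs : (0 < SS Q ↔ P)
  · exact ⟨x, ε, Q, h3, h4, h5, hs⟩
  · refine ⟨x', ε', Q', h3', h4', h5', ?_⟩
    rw [h6] at hs
    rw [h6']
    clear h6 h6' h3 h3' h4 h4' h5 h5' hmk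
    generalize ∑ u : QA (0 : K), psi F (ℓ (qn u)) = T1 at *
    generalize ∑ u : QA a, psi F (ℓ (qn u)) = T2 at *
    clear_value T
    rcases lt_or_gt_of_ne hT0 with h | h
    · have := mul_neg_of_pos_of_neg h1 h
      have := mul_pos_of_neg_of_neg h2 h
      have : ¬ 0 < T1 * T := by linarith
      tauto
    · have := mul_pos h1 h
      have := mul_neg_of_neg_of_pos h2 h
      have : ¬ 0 < T2 * T := by linarith
      tauto
end SG
end
section
namespace SG
set_option linter.all false
open Matrix
section conj
variable {n F : Type} [Fintype n] [DecidableEq n] [Field F] [Fintype F] [CharP F 2]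
noncomputable def cj (P P' : Matrix n n F) (h : P' * P = 1) : Matrix n n F →ₐ[F] Matrix n n F :=
  AlgHom.ofLinearMap (LinearMap.mulLeft F P ∘ₗ LinearMap.mulRight F P') (by
    simp; exact mul_eq_one_comm.1 h) (fun x y => by
    simp only [LinearMap.comp_apply, LinearMap.mulLeft_apply, LinearMap.mulRight_apply]
    calc P * (x * y * P') = P * x * 1 * y * P' := by simp [Matrix.mul_assoc]
      _ = _ := by rw [← h]; simp only [Matrix.mul_assoc])
theorem cj_apply (P P' : Matrix n n F) (h : P' * P = 1) (A) : cj P P' h A = P * (A * P') := rfl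
theorem cj_cj (P P' : Matrix n n F) (h : P' * P = 1) (h' : P * P' = 1) (A) : cj P' P h' (cj P P' h A) = A := by
  rw [cj_apply, cj_apply]
  calc P' * (P * (A * P') * P) = (P' * P) * A * (P' * P) := by simp only [Matrix.mul_assoc]
    _ = A := by rw [h, Matrix.one_mul, Matrix.mul_one]
theorem bad_conj {J : Matrix n n F} (hJ : Sy J) (P P' : Matrix n n F) (h : P' * P = 1) (h' : P * P' = 1) (ha : adj J P = P') (y : Matrix n n F) (hb : Bad J y) : Bad J (cj P P' h y) := by
  obtain ⟨z, h1, h2, h3, h4⟩ := hb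
  refine ⟨cj P P' h z, h1.map _, ?_, ?_, fun p => ?_⟩
  · rw [cj_apply, adj_mul hJ, adj_mul hJ, h2, ← ha, adj_adj hJ, Matrix.mul_assoc]
  · intro s hs
    refine h3 s ?_
    rw [← cj_cj P P' h h' z, hs, map_smul, map_one]
  · rw [Polynomial.aeval_algHom_apply]
    rcases h4 p with h | h
    · left; rw [h, map_zero]
    · right; exact h.map _
theorem cyc_conj (P P' : Matrix n n F) (h : P' * P = 1) (A : Matrix n n F) (hA : Cyc A) : Cyc (cj P P' h A) := by
  obtain ⟨v, hv⟩ := hA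
  refine ⟨P *ᵥ v, ?_⟩
  have : cycM (cj P P' h A) (P *ᵥ v) = P * cycM A v := by
    ext i j
    rw [cycM, of_apply, ← map_pow, cj_apply, mulVec_mulVec, Matrix.mul_assoc, Matrix.mul_assoc, h, Matrix.mul_one, ← mulVec_mulVec]
    rfl
  rw [this]
  exact (IsUnit.of_mul_eq_one _ (mul_eq_one_comm.1 h)).mul hv
end conj
theorem gen_of_PP {m N : ℕ} {F : Type} [Field F] [Fintype F] [CharP F 2] {Q0} (hQ0 : IsQ (Matrix.J (Fin m) F) Q0) (y : symplecticGroup (Fin m) F) (hy : PP N (y : Matrix (Fin m ⊕ Fin m) (Fin m ⊕ Fin m) F) ≠ 0) :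
    ∃ Q, Gen (Matrix.J (Fin m) F) (uu y) Q N := by
  have h1 := left_ne_zero_of_mul hy
  have h2 := right_ne_zero_of_mul hy
  have h3 : IsUnit ((y : Matrix (Fin m ⊕ Fin m) (Fin m ⊕ Fin m) F) - 1) := (isUnit_iff_isUnit_det _).2 (IsUnit.mk0 _ h2)
  obtain ⟨Q, hQ, hi⟩ := exists_invQ hQ0 _ (sp_om y.2) h3
  refine ⟨Q, mem_sp'.1 y.2, h3, ⟨fun _ => 1, (isUnit_iff_isUnit_det _).2 (IsUnit.mk0 _ ?_)⟩, hQ, hi⟩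
  convert h1 using 2
  ext i j
  rw [cycM, of_apply, of_apply, ← pow_mul]; rfl
theorem gen_conj {m N : ℕ} {F : Type} [Field F] [Fintype F] [CharP F 2] {Q} (y h : symplecticGroup (Fin m) F) (G : Gen (Matrix.J (Fin m) F) (uu y) Q N) :
    ∃ Q', Gen (Matrix.J (Fin m) F) (uu (h * y * h⁻¹)) Q' N ∧ SS Q' = SS Q ∧
    (Bad (Matrix.J (Fin m) F) ((h * y * h⁻¹ : symplecticGroup (Fin m) F) : Matrix (Fin m ⊕ Fin m) (Fin m ⊕ Fin m) F) ↔ Bad (Matrix.J (Fin m) F) (y : Matrix (Fin m ⊕ Fin m) (Fin m ⊕ Fin m) F)) := by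
  set P : Matrix (Fin m ⊕ Fin m) (Fin m ⊕ Fin m) F := h.1 with hP
  set P' : Matrix (Fin m ⊕ Fin m) (Fin m ⊕ Fin m) F := ((h⁻¹ : symplecticGroup (Fin m) F) : Matrix (Fin m ⊕ Fin m) (Fin m ⊕ Fin m) F) with hP'
  have h1 : P' * P = 1 := congrArg Subtype.val (inv_mul_cancel h)
  have h2 : P * P' = 1 := congrArg Subtype.val (mul_inv_cancel h)
  have ha : adj (Matrix.J (Fin m) F) P = P' := by
    have := mem_sp'.1 h.2
    calc _ = adj (Matrix.J (Fin m) F) P * (P * P') := by rw [h2, Matrix.mul_one]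
      _ = P' := by rw [← Matrix.mul_assoc, this, Matrix.one_mul]
  have ha' : adj (Matrix.J (Fin m) F) P' = P := by rw [← ha, adj_adj sy_J]
  have hy : ((h * y * h⁻¹ : symplecticGroup (Fin m) F) : Matrix (Fin m ⊕ Fin m) (Fin m ⊕ Fin m) F) = cj P P' h1 y := by
    rw [cj_apply, ← Matrix.mul_assoc]; rfl
  refine ⟨fun v => Q (P' *ᵥ v), ⟨mem_sp'.1 (h * y * h⁻¹).2, ?_, ?_, G.isQ.comp P' (sp_om h⁻¹.2), fun v => ?_⟩, SS_comp Q (uu h⁻¹), ?_⟩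
  · have : cj P P' h1 (y : Matrix (Fin m ⊕ Fin m) (Fin m ⊕ Fin m) F) - 1 = cj P P' h1 ((y : Matrix (Fin m ⊕ Fin m) (Fin m ⊕ Fin m) F) - 1) := by rw [map_sub, map_one]
    change IsUnit (((h * y * h⁻¹ : symplecticGroup (Fin m) F) : Matrix (Fin m ⊕ Fin m) (Fin m ⊕ Fin m) F) - 1)
    rw [hy, this]
    exact G.y1.map _
  · change Cyc (((h * y * h⁻¹ : symplecticGroup (Fin m) F) : Matrix (Fin m ⊕ Fin m) (Fin m ⊕ Fin m) F) ^ N)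
    rw [hy, ← map_pow]
    exact cyc_conj _ _ _ _ G.cyc
  · change Q (P' *ᵥ (((h * y * h⁻¹ : symplecticGroup (Fin m) F) : Matrix (Fin m ⊕ Fin m) (Fin m ⊕ Fin m) F) *ᵥ v)) = _
    rw [hy, cj_apply, mulVec_mulVec, ← Matrix.mul_assoc, h1, Matrix.one_mul, ← mulVec_mulVec]
    exact G.inv _
  · rw [hy]
    refine ⟨fun hb => ?_, bad_conj sy_J P P' h1 h2 ha _⟩
    have := bad_conj sy_J P' P h2 h1 ha' _ hb
    rwa [cj_cj] at this
theorem main0 (m : ℕ) (hm : 2 ≤ m) : ∃ C : ℕ, 0 < C ∧ ∀ (F : Type) [Field F] [Fintype F] [CharP F 2], C ≤ Fintype.card F →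
  ∃ A : Finset (Matrix.symplecticGroup (Fin m) F), A.card ≤ 4 ∧ ∀ y : Matrix.symplecticGroup (Fin m) F,
    PP (NN m) (y : Matrix (Fin m ⊕ Fin m) (Fin m ⊕ Fin m) F) ≠ 0 → ∃ x ∈ A, ∀ g h : Matrix.symplecticGroup (Fin m) F, Subgroup.closure {g * x * g⁻¹, h * y * h⁻¹} = ⊤ := by
  classical
  obtain ⟨q0, hq0⟩ := genTop m (6 * Fintype.card (Fin m ⊕ Fin m) + 3) hm (by omega)
  refine ⟨q0 + 6, by omega, fun F _ _ _ hF => ?_⟩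
  have hX := fun k s : Bool => mkFam m hm F (by omega) (cond k 1 0) (by cases k <;> simp) (s = true)
  choose X ε Q hG h0 h1 hS using hX
  refine ⟨Finset.univ.image fun p : Bool × Bool => X p.1 p.2, Finset.card_image_le.trans (by simp), fun y hy => ?_⟩
  obtain ⟨Qy, hQy⟩ := gen_of_PP (hG true true).isQ y hy
  refine ⟨X (decide (Bad (Matrix.J (Fin m) F) (y : Matrix (Fin m ⊕ Fin m) (Fin m ⊕ Fin m) F))) (decide (¬ 0 < SS Qy)), Finset.mem_image.2 ⟨(_, _), Finset.mem_univ _, rfl⟩, fun g h => ?_⟩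
  generalize hk : decide (Bad (Matrix.J (Fin m) F) (y : Matrix (Fin m ⊕ Fin m) (Fin m ⊕ Fin m) F)) = k
  generalize hs : decide (¬ 0 < SS Qy) = s
  obtain ⟨Q', hQ', hSS, hB⟩ := gen_conj y (g⁻¹ * h) hQy
  have hsig : 0 < SS (Q k s) ↔ ¬ 0 < SS Q' := by rw [hS, hSS, ← hs, decide_eq_true_iff]
  have := hq0 F (by omega) (X k s) _ _ _ _ (hG k s) hQ' (by rintro rfl; tauto) (by tauto) (by
    rw [hB]
    by_cases hb : Bad (Matrix.J (Fin m) F) (y : Matrix (Fin m ⊕ Fin m) (Fin m ⊕ Fin m) F)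
    · right; exact ⟨h1 k s (by simp [← hk, hb]), hb⟩
    · left; exact ⟨h0 k s (by simp [← hk, hb]), hb⟩)
  have h2 := congrArg (Subgroup.map (MulAut.conj g).toMonoidHom) this
  rw [MonoidHom.map_closure, Set.image_pair, Subgroup.map_top_of_surjective _ (MulAut.conj g).surjective] at h2
  have h3 : (MulAut.conj g).toMonoidHom (g⁻¹ * h * y * (g⁻¹ * h)⁻¹) = h * y * h⁻¹ := by
    change g * (g⁻¹ * h * y * (g⁻¹ * h)⁻¹) * g⁻¹ = _
    group
  rw [h3] at h2
  exact h2
end SG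
end

theorem stmt_7 :
    ∀ m : ℕ, 2 ≤ m →
      ∃ C : ℝ, 0 < C ∧
        ∀ (F : Type) [Field F] [Fintype F], Even (Fintype.card F) →
          ∃ A : Finset (Matrix.symplecticGroup (Fin m) F),
            A.card ≤ 4 ∧
            (Nat.card {y : Matrix.symplecticGroup (Fin m) F //
                ∃ x ∈ A, InvGen x y} : ℝ) ≥
              (1 - C / Fintype.card F) *
                Nat.card (Matrix.symplecticGroup (Fin m) F) := by
  intro m hm
  obtain ⟨C1, hC1, h1⟩ := SG.main0 m hm
  obtain ⟨C0, h0⟩ := SG.count_generic m (SG.NN m) (Nat.factorial_pos _)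
  refine ⟨C0 + C1, by positivity, fun F _ _ hF => ?_⟩
  have : CharP F 2 := ringChar.of_eq (FiniteField.even_card_iff_char_two.2 (Nat.even_iff.1 hF))
  have hq : (0 : ℝ) < Fintype.card F := by exact_mod_cast Fintype.card_pos
  by_cases hc : C1 ≤ Fintype.card F
  · obtain ⟨A, hA, h2⟩ := h1 F hc
    refine ⟨A, hA, ?_⟩
    have h3 := h0 F
    set p : Matrix.symplecticGroup (Fin m) F → Prop := fun y => SG.PP (SG.NN m) (y : Matrix (Fin m ⊕ Fin m) (Fin m ⊕ Fin m) F) = 0 with hp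
    have h4 : Nat.card {y // p y} + Nat.card {y // ¬ p y} = Nat.card (Matrix.symplecticGroup (Fin m) F) := by
      classical
      rw [← Nat.card_sum, Nat.card_congr (Equiv.sumCompl p)]
    have h5 : Nat.card {y // ¬ p y} ≤ Nat.card {y : Matrix.symplecticGroup (Fin m) F // ∃ x ∈ A, InvGen x y} :=
      Nat.card_le_card_of_injective (Subtype.map id h2) (Subtype.map_injective _ Function.injective_id)
    have h3' : (Fintype.card F : ℝ) * Nat.card {y // p y} ≤ C0 * Nat.card (Matrix.symplecticGroup (Fin m) F) := by exact_mod_cast h3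
    have h4' : (Nat.card {y // p y} : ℝ) + Nat.card {y // ¬ p y} = Nat.card (Matrix.symplecticGroup (Fin m) F) := by exact_mod_cast h4
    have h5' : (Nat.card {y // ¬ p y} : ℝ) ≤ Nat.card {y : Matrix.symplecticGroup (Fin m) F // ∃ x ∈ A, InvGen x y} := by exact_mod_cast h5
    have h6 : (Nat.card {y // p y} : ℝ) ≤ C0 / Fintype.card F * Nat.card (Matrix.symplecticGroup (Fin m) F) := by
      rw [div_mul_eq_mul_div, le_div_iff₀ hq, mul_comm]; exact h3'
    have h7 : (0 : ℝ) ≤ C1 / Fintype.card F * Nat.card (Matrix.symplecticGroup (Fin m) F) := by positivity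
    rw [add_div]
    linarith
  · refine ⟨∅, by simp, ?_⟩
    have h3 : (1 : ℝ) - (C0 + C1) / Fintype.card F ≤ 0 := by
      rw [sub_nonpos, le_div_iff₀ hq]
      have : (Fintype.card F : ℝ) ≤ C1 := by exact_mod_cast (not_le.1 hc).le
      have : (0 : ℝ) ≤ C0 := by positivity
      linarith
    exact (mul_nonpos_of_nonpos_of_nonneg h3 (by positivity)).trans (by positivity)
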